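/- Let p > 3 be a prime. Then the number of isomorphism classes of Cayley digraphs on the dihedral group D_{6p} equals (2^{4p−2}/(3p(p−1)))·(2^{2p} + 5) + (2^{2p}/p)·(2^p + 1) + (8/(3(p−1)))·Σ_{r : |r|_3 = 1 and 3 ∤ |r|_p} (2^{4(p−1)/|r|_p} + 2^{1 + 6(p−1)/|r|_p}) + (8/(p−1))·Σ_{r : |r|_3 = 1 and 3 | |r|_p} 2^{6(p−1)/|r|_p} + (4/(p−1))·( Σ_{r : |r|_3 = 2, |r|_p odd and |r|_p > 1} 2^{4(p−1)/|r|_p} + Σ_{r : |r|_3 = 2 and 2 | |r|_p} 2^{6(p−1)/|r|_p} ), where in each sum r ranges over integers with 1 < r < 3p and gcd(r, 3p) = 1 satisfying the indicated conditions. -/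

import Mathlib

/-- `|r|_m`: the multiplicative order of the integer `r` modulo `m`. -/
noncomputable def ordMod (m : ℕ) (r : ℤ) : ℕ := orderOf ((r : ZMod m))

/-- The Cayley digraphs `Cay(R,S)` and `Cay(R,T)` are isomorphic: there is a bijection of `R`
carrying the arc set `{(x,y) : y x⁻¹ ∈ S}` of `Cay(R,S)` onto the arc set of `Cay(R,T)`. -/
def cayleyIso {R : Type*} [Group R] (S T : Set R) : Prop :=
  ∃ e : R ≃ R, ∀ x y : R, y * x⁻¹ ∈ S ↔ e y * (e x)⁻¹ ∈ T

namespace D6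
open Equiv Equiv.Perm
open scoped Pointwise

section basics
variable {Ω : Type*}

/-- Automorphism group of a binary relation. -/
def autG (Γ : Ω → Ω → Prop) : Subgroup (Perm Ω) where
  carrier := {g | ∀ x y, Γ (g x) (g y) ↔ Γ x y}
  mul_mem' := by
    intro a b ha hb x y
    simp only [Set.mem_ofPred_eq, Perm.mul_apply] at *
    rw [ha, hb]
  one_mem' := by intro x y; simp
  inv_mem' := by
    intro a ha x y
    simp only [Set.mem_ofPred_eq] at *
    rw [← ha]; simp

theorem mem_autG {Γ : Ω → Ω → Prop} {g : Perm Ω} :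
    g ∈ autG Γ ↔ ∀ x y, Γ (g x) (g y) ↔ Γ x y := Iff.rfl

/-- A regular dihedral group of order `6p`, given by generators. -/
structure Dih (p : ℕ) (c z s : Perm Ω) : Prop where
  hc : c ^ p = 1
  hz : z ^ 3 = 1
  hs : s * s = 1
  cz : Commute c z
  sc : s * c = c⁻¹ * s
  sz : s * z = z⁻¹ * s
  cov : ∀ o y, (∃ i j : ℤ, y = (c ^ i) ((z ^ j) o)) ∨ (∃ i j : ℤ, y = (c ^ i) ((z ^ j) (s o)))
  free1 : ∀ (i j : ℤ) x, (c ^ i) ((z ^ j) x) = x → (p : ℤ) ∣ i ∧ (3 : ℤ) ∣ j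
  free2 : ∀ (i j : ℤ) x, (c ^ i) ((z ^ j) (s x)) ≠ x

theorem zpow_eq_of_dvd {G : Type*} [Group G] {c : G} {p : ℕ} (h : c ^ p = 1) {i j : ℤ}
    (hd : (p : ℤ) ∣ i - j) : c ^ i = c ^ j := by
  obtain ⟨k, hk⟩ := hd
  have : i = p * k + j := by linarith
  rw [this, zpow_add, zpow_mul, zpow_natCast, h, one_zpow, one_mul]

theorem zadd (c : Perm Ω) (i j : ℤ) (x : Ω) : (c ^ i) ((c ^ j) x) = (c ^ (i + j)) x := by
  rw [zpow_add]; rfl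

theorem invap (g : Perm Ω) (x : Ω) : g⁻¹ (g x) = x := g.symm_apply_apply x
theorem apinv (g : Perm Ω) (x : Ω) : g (g⁻¹ x) = x := g.apply_symm_apply x

namespace Dih
variable {p : ℕ} {c z s : Perm Ω}

theorem zc (h : Dih p c z s) (i j : ℤ) (x : Ω) :
    (z ^ j) ((c ^ i) x) = (c ^ i) ((z ^ j) x) := by
  have := (h.cz.zpow_zpow i j).eq
  rw [← Perm.mul_apply, ← Perm.mul_apply, this]

theorem s_c (h : Dih p c z s) (i : ℤ) (x : Ω) : s ((c ^ i) x) = (c ^ (-i)) (s x) := by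
  have h1 : SemiconjBy s c c⁻¹ := h.sc
  have := (h1.zpow_right i).eq
  rw [← Perm.mul_apply, this, zpow_neg, inv_zpow]; rfl

theorem s_z (h : Dih p c z s) (i : ℤ) (x : Ω) : s ((z ^ i) x) = (z ^ (-i)) (s x) := by
  have h1 : SemiconjBy s z z⁻¹ := h.sz
  have := (h1.zpow_right i).eq
  rw [← Perm.mul_apply, this, zpow_neg, inv_zpow]; rfl

theorem s_s (h : Dih p c z s) (x : Ω) : s (s x) = x := by
  rw [← Perm.mul_apply, h.hs]; rfl

theorem s_inv (h : Dih p c z s) : s⁻¹ = s := inv_eq_of_mul_eq_one_right h.hs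

theorem conj (h : Dih p c z s) (g : Perm Ω) :
    Dih p (g * c * g⁻¹) (g * z * g⁻¹) (g * s * g⁻¹) where
  hc := by rw [conj_pow, h.hc]; simp
  hz := by rw [conj_pow, h.hz]; simp
  hs := by
    have : g * s * g⁻¹ * (g * s * g⁻¹) = g * (s * s) * g⁻¹ := by group
    rw [this, h.hs]; simp
  cz := by
    have := h.cz.eq
    show g * c * g⁻¹ * (g * z * g⁻¹) = g * z * g⁻¹ * (g * c * g⁻¹)
    calc _ = g * (c * z) * g⁻¹ := by group
      _ = _ := by rw [this]; group
  sc := by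
    calc _ = g * (s * c) * g⁻¹ := by group
      _ = _ := by rw [h.sc]; group
  sz := by
    calc _ = g * (s * z) * g⁻¹ := by group
      _ = _ := by rw [h.sz]; group
  cov := by
    intro o y
    rcases h.cov (g⁻¹ o) (g⁻¹ y) with ⟨i, j, e⟩ | ⟨i, j, e⟩
    · left; refine ⟨i, j, ?_⟩
      rw [conj_zpow, conj_zpow]; simp only [Perm.mul_apply, invap]; rw [← e, apinv]
    · right; refine ⟨i, j, ?_⟩
      rw [conj_zpow, conj_zpow]; simp only [Perm.mul_apply, invap]; rw [← e, apinv]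
  free1 := by
    intro i j x e
    rw [conj_zpow, conj_zpow] at e
    apply h.free1 i j (g⁻¹ x)
    apply g.injective
    simpa using e
  free2 := by
    intro i j x e
    rw [conj_zpow, conj_zpow] at e
    apply h.free2 i j (g⁻¹ x)
    apply g.injective
    simpa using e

theorem cpow (h : Dih p c z s) (hp : p.Prime) (a b : ℤ) (hab : c = (c ^ a) ^ b) :
    Dih p (c ^ a) z s where
  hc := by rw [← zpow_natCast, ← zpow_mul, mul_comm, zpow_mul, zpow_natCast, h.hc, one_zpow]
  hz := h.hz
  hs := h.hs
  cz := h.cz.zpow_left a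
  sc := by
    have h1 : SemiconjBy s c c⁻¹ := h.sc
    have := (h1.zpow_right a).eq
    rw [this, inv_zpow]
  sz := h.sz
  cov := by
    intro o y
    rcases h.cov o y with ⟨i, j, e⟩ | ⟨i, j, e⟩
    · left; refine ⟨b * i, j, ?_⟩
      rw [zpow_mul, ← hab]; exact e
    · right; refine ⟨b * i, j, ?_⟩
      rw [zpow_mul, ← hab]; exact e
  free1 := by
    intro i j x e
    rw [← zpow_mul] at e
    obtain ⟨h1, h2⟩ := h.free1 _ _ _ e
    refine ⟨?_, h2⟩
    rcases (Nat.prime_iff_prime_int.mp hp).dvd_or_dvd h1 with h3 | h3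
    · exfalso
      have hc1 : c ^ a = 1 := by
        have := zpow_eq_of_dvd h.hc (i := a) (j := 0) (by simpa using h3)
        simpa using this
      have hc2 : c = 1 := by rw [hab, hc1, one_zpow]
      have := (h.free1 1 0 x (by rw [hc2]; simp)).1
      have h5 := Int.eq_one_of_dvd_one (by positivity) this
      exact hp.one_lt.ne' (by exact_mod_cast h5)
    · exact h3
  free2 := by
    intro i j x e
    rw [← zpow_mul] at e
    exact h.free2 _ _ _ e

theorem zinv (h : Dih p c z s) : Dih p c z⁻¹ s where
  hc := h.hc
  hz := by rw [inv_pow, h.hz, inv_one]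
  hs := h.hs
  cz := h.cz.inv_right
  sc := h.sc
  sz := by
    have h1 : SemiconjBy s z z⁻¹ := h.sz
    exact h1.inv_right.eq
  cov := by
    intro o y
    rcases h.cov o y with ⟨i, j, e⟩ | ⟨i, j, e⟩
    · left; refine ⟨i, -j, ?_⟩
      simpa using e
    · right; refine ⟨i, -j, ?_⟩
      simpa using e
  free1 := by
    intro i j x e
    rw [inv_zpow, ← zpow_neg] at e
    obtain ⟨h1, h2⟩ := h.free1 _ _ _ e
    exact ⟨h1, by simpa using h2⟩
  free2 := by
    intro i j x e
    rw [inv_zpow, ← zpow_neg] at e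
    exact h.free2 _ _ _ e

theorem szmul (h : Dih p c z s) (k : ℤ) : Dih p c z (z ^ k * s) where
  hc := h.hc
  hz := h.hz
  hs := by
    ext x
    simp only [Perm.mul_apply, h.s_z, zadd, h.s_s]; simp
  cz := h.cz
  sc := by
    ext x
    have := h.s_c 1 x
    have h2 := h.zc (-1) k (s x)
    simp only [Perm.mul_apply, zpow_one, zpow_neg] at *
    rw [this, h2]
  sz := by
    ext x
    have := h.s_z 1 x
    simp only [Perm.mul_apply, zpow_one, zpow_neg] at *
    rw [this, ← zpow_neg_one, zadd, zadd, add_comm]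
  cov := by
    intro o y
    rcases h.cov o y with ⟨i, j, e⟩ | ⟨i, j, e⟩
    · left; exact ⟨i, j, e⟩
    · right; refine ⟨i, j - k, ?_⟩
      simp only [Perm.mul_apply, zadd]; simpa using e
  free1 := h.free1
  free2 := by
    intro i j x e
    simp only [Perm.mul_apply, zadd] at e
    exact h.free2 _ _ _ e

theorem sside (h : Dih p c z s) {x : Ω} (i j : ℤ) : s x ≠ (c ^ i) ((z ^ j) x) := by
  intro e
  apply h.free2 (-i) (-j) x
  rw [e, h.zc, zadd, zadd]; simp

end Dih

/-- Conjugacy goal. -/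
def Good (Γ : Ω → Ω → Prop) (R : Subgroup (Perm Ω)) (c z s : Perm Ω) : Prop :=
  ∃ φ ∈ autG Γ, φ * c * φ⁻¹ ∈ R ∧ φ * z * φ⁻¹ ∈ R ∧ φ * s * φ⁻¹ ∈ R

theorem Good.of_conj {Γ : Ω → Ω → Prop} {R : Subgroup (Perm Ω)} {c z s : Perm Ω} {h : Perm Ω}
    (hh : h ∈ autG Γ) (hg : Good Γ R (h * c * h⁻¹) (h * z * h⁻¹) (h * s * h⁻¹)) :
    Good Γ R c z s := by
  obtain ⟨φ, hφ, h1, h2, h3⟩ := hg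
  refine ⟨φ * h, mul_mem hφ hh, ?_, ?_, ?_⟩
  · convert h1 using 1; group
  · convert h2 using 1; group
  · convert h3 using 1; group

theorem Good.of_cpow {Γ : Ω → Ω → Prop} {R : Subgroup (Perm Ω)} {c c' z s : Perm Ω} (k : ℤ)
    (e : c = c' ^ k) (hg : Good Γ R c' z s) : Good Γ R c z s := by
  obtain ⟨φ, hφ, h1, h2, h3⟩ := hg
  refine ⟨φ, hφ, ?_, h2, h3⟩
  rw [e, ← conj_zpow]; exact zpow_mem h1 k

theorem Good.of_zinv {Γ : Ω → Ω → Prop} {R : Subgroup (Perm Ω)} {c z s : Perm Ω}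
    (hg : Good Γ R c z⁻¹ s) : Good Γ R c z s := by
  obtain ⟨φ, hφ, h1, h2, h3⟩ := hg
  refine ⟨φ, hφ, h1, ?_, h3⟩
  rw [← conj_inv] at h2
  exact inv_mem_iff.mp h2

theorem Good.of_szmul {Γ : Ω → Ω → Prop} {R : Subgroup (Perm Ω)} {c z s : Perm Ω} (k : ℤ)
    (hg : Good Γ R c z (z ^ k * s)) : Good Γ R c z s := by
  obtain ⟨φ, hφ, h1, h2, h3⟩ := hg
  refine ⟨φ, hφ, h1, h2, ?_⟩
  have h4 : φ * s * φ⁻¹ = (φ * z * φ⁻¹) ^ (-k) * (φ * (z ^ k * s) * φ⁻¹) := by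
    rw [conj_zpow]; group
  rw [h4]; exact mul_mem (zpow_mem h2 _) h3

/-- Glue permutations along the classes of an invariant map. -/
theorem exists_glue [Finite Ω] {X : Type*} (cl : Ω → X) (K : X → Perm Ω)
    (h : ∀ x, cl (K (cl x) x) = cl x) : ∃ φ : Perm Ω, ∀ x, φ x = K (cl x) x := by
  have hinj : Function.Injective (fun x => K (cl x) x) := by
    intro x y e
    simp only at e
    have h1 : cl x = cl y := by rw [← h x, ← h y, e]
    rw [h1] at e
    exact (K (cl y)).injective e
  exact ⟨Equiv.ofBijective _ (Finite.injective_iff_bijective.mp hinj), fun x => rfl⟩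

/-- Sylow: two `p`-elements of `H` can be conjugated into a common `p`-subgroup. -/
theorem sylow_conj {G : Type*} [Group G] [Finite G] (H : Subgroup G) (p : ℕ) (hp : p.Prime)
    {x y : G} (hx : x ∈ H) (hy : y ∈ H) {n m : ℕ} (ex : x ^ p ^ n = 1) (ey : y ^ p ^ m = 1) :
    ∃ h ∈ H, ∃ P : Subgroup G, P ≤ H ∧ IsPGroup p P ∧ x ∈ P ∧ h * y * h⁻¹ ∈ P := by
  have := Fact.mk hp
  have key : ∀ (w : H) (k : ℕ), w ^ p ^ k = 1 → ∃ Q : Sylow p H, w ∈ Q := by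
    intro w k hw
    have hP : IsPGroup p (Subgroup.zpowers w) := by
      have h1 : orderOf w ∣ p ^ k := orderOf_dvd_of_pow_eq_one hw
      obtain ⟨l, -, hl⟩ := (Nat.dvd_prime_pow hp).mp h1
      exact IsPGroup.of_card (n := l) (by rw [Nat.card_zpowers, hl])
    obtain ⟨Q, hQ⟩ := hP.exists_le_sylow
    exact ⟨Q, hQ (Subgroup.mem_zpowers w)⟩
  obtain ⟨Q1, h1⟩ := key ⟨x, hx⟩ n (by ext; simpa using ex)
  obtain ⟨Q2, h2⟩ := key ⟨y, hy⟩ m (by ext; simpa using ey)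
  obtain ⟨g, hg⟩ := MulAction.exists_smul_eq H Q2 Q1
  refine ⟨g, g.2, (Q1 : Subgroup H).map H.subtype, ?_, Q1.isPGroup'.map _, ?_, ?_⟩
  · rintro _ ⟨w, -, rfl⟩; exact w.2
  · exact ⟨⟨x, hx⟩, h1, rfl⟩
  · refine ⟨g * ⟨y, hy⟩ * g⁻¹, ?_, rfl⟩
    have : MulAut.conj g • (⟨y, hy⟩ : H) ∈ MulAut.conj g • (Q2 : Subgroup H) :=
      Subgroup.smul_mem_pointwise_smul _ _ _ h2
    rw [← hg, Sylow.smul_def]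
    exact this

end basics
end D6
namespace D6
open Equiv Equiv.Perm
open scoped Pointwise

section blocks
variable {Ω : Type*}

/-- Set of orbits of `c`. -/
abbrev Blk (c : Perm Ω) := Quotient (SameCycle.setoid c)

/-- class of a point -/
def bk (c : Perm Ω) (x : Ω) : Blk c := Quotient.mk _ x

theorem bk_eq {c : Perm Ω} {x y : Ω} : bk c x = bk c y ↔ c.SameCycle x y := Quotient.eq

theorem sc_zpow (c : Perm Ω) (i : ℤ) (x : Ω) : c.SameCycle x ((c ^ i) x) := ⟨i, rfl⟩

/-- Action on blocks. -/
def toBlk (c : Perm Ω) : autG (c.SameCycle) →* Perm (Blk c) where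
  toFun g :=
    { toFun := Quotient.map g.1 (fun x y h => (g.2 x y).2 h)
      invFun := Quotient.map (g⁻¹).1 (fun x y h => ((g⁻¹).2 x y).2 h)
      left_inv := by
        rintro ⟨x⟩
        show bk c _ = bk c x
        exact congrArg _ (invap g.1 x)
      right_inv := by
        rintro ⟨x⟩
        show bk c _ = bk c x
        exact congrArg _ (apinv g.1 x) }
  map_one' := by
    ext q
    obtain ⟨x, rfl⟩ := Quotient.exists_rep q
    rfl
  map_mul' := by
    intro a b
    ext q
    obtain ⟨x, rfl⟩ := Quotient.exists_rep q
    rfl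

theorem toBlk_bk (c : Perm Ω) (g : autG (c.SameCycle)) (x : Ω) :
    toBlk c g (bk c x) = bk c (g.1 x) := rfl

theorem bk_ind {c : Perm Ω} (q : Blk c) : ∃ x, bk c x = q := Quotient.exists_rep q

theorem autG_self {c : Perm Ω} (g : Perm Ω) (h : ∀ x, c.SameCycle x (g x)) :
    g ∈ autG c.SameCycle := by
  intro x y
  constructor
  · intro h1; exact (h x).trans (h1.trans (h y).symm)
  · intro h1; exact (h x).symm.trans (h1.trans (h y))

theorem autG_norm {c g : Perm Ω} (k k' : ℤ) (h : g * c = c ^ k * g) (h' : g⁻¹ * c = c ^ k' * g⁻¹) :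
    g ∈ autG c.SameCycle := by
  have key : ∀ (g : Perm Ω) (k : ℤ), g * c = c ^ k * g → ∀ x y, c.SameCycle x y →
      c.SameCycle (g x) (g y) := by
    rintro g k h x _ ⟨i, rfl⟩
    have h1 : SemiconjBy g c (c ^ k) := h
    have h2 := (h1.zpow_right i).eq
    rw [← Perm.mul_apply, h2, ← zpow_mul]
    exact sc_zpow _ _ _
  intro x y
  constructor
  · intro h1
    have := key _ _ h' _ _ h1
    rwa [invap, invap] at this
  · exact key g k h x y

theorem autG_comm {c g : Perm Ω} (h : Commute g c) : g ∈ autG c.SameCycle := by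
  refine autG_norm 1 1 ?_ ?_
  · rw [zpow_one]; exact h.eq
  · rw [zpow_one]; exact h.inv_left.eq

namespace Dih
variable {p : ℕ} {c z s : Perm Ω}

theorem c_aut (_h : Dih p c z s) : c ∈ autG c.SameCycle := autG_comm (Commute.refl c)
theorem z_aut (h : Dih p c z s) : z ∈ autG c.SameCycle := autG_comm h.cz.symm
theorem s_aut (h : Dih p c z s) : s ∈ autG c.SameCycle := by
  refine autG_norm (-1) (-1) ?_ ?_
  · rw [zpow_neg_one]; exact h.sc
  · rw [zpow_neg_one, h.s_inv]; exact h.sc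

theorem blk (h : Dih p c z s) {d : Perm Ω} (hd : ∀ x y, d.SameCycle x y ↔ c.SameCycle x y)
    (hz : z ∈ autG d.SameCycle)
    (hs : s ∈ autG d.SameCycle) :
    Dih 1 (1 : Perm (Blk d)) (toBlk d ⟨z, hz⟩) (toBlk d ⟨s, hs⟩) where
  hc := by simp
  hz := by
    rw [← map_pow]
    have : (⟨z, hz⟩ : autG d.SameCycle) ^ 3 = 1 := by ext1; simpa using h.hz
    rw [this, map_one]
  hs := by
    rw [← map_mul]
    have : (⟨s, hs⟩ : autG d.SameCycle) * ⟨s, hs⟩ = 1 := by ext1; simpa using h.hs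
    rw [this, map_one]
  cz := Commute.one_left _
  sc := by simp
  sz := by
    rw [← map_mul, ← map_inv, ← map_mul]
    congr 1
    ext1
    simpa using h.sz
  cov := by
    intro o y
    obtain ⟨o, rfl⟩ := bk_ind o
    obtain ⟨y, rfl⟩ := bk_ind y
    rcases h.cov o y with ⟨i, j, e⟩ | ⟨i, j, e⟩
    · left; refine ⟨0, j, ?_⟩
      rw [← map_zpow, one_zpow, Perm.one_apply, toBlk_bk, bk_eq, hd]
      rw [e]
      exact (sc_zpow _ _ _).symm
    · right; refine ⟨0, j, ?_⟩
      rw [← map_zpow, one_zpow, Perm.one_apply, toBlk_bk, toBlk_bk, bk_eq, hd]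
      rw [e]
      exact (sc_zpow _ _ _).symm
  free1 := by
    intro i j x e
    obtain ⟨x, rfl⟩ := bk_ind x
    rw [← map_zpow, one_zpow, Perm.one_apply, toBlk_bk, bk_eq, hd] at e
    obtain ⟨k, hk⟩ := e
    exact ⟨by simp, (h.free1 k j x hk).2⟩
  free2 := by
    intro i j x e
    obtain ⟨x, rfl⟩ := bk_ind x
    rw [← map_zpow, one_zpow, Perm.one_apply, toBlk_bk, toBlk_bk, bk_eq, hd] at e
    obtain ⟨k, hk⟩ := e
    exact h.free2 k j x hk

theorem card_blk (h : Dih p c z s) (o : Ω) : Nat.card (Blk c) = 6 := by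
  let f : Fin 3 × Bool → Blk c := fun q =>
    bk c ((z ^ (q.1.val : ℤ)) (if q.2 then s o else o))
  have hf : Function.Bijective f := by
    constructor
    · rintro ⟨j, b⟩ ⟨j', b'⟩ e
      obtain ⟨k, hk⟩ := bk_eq.mp e
      have hj := j.2
      have hj' := j'.2
      simp only at hk
      have aux : ∀ x : Ω, (c ^ k) ((z ^ (j.val : ℤ)) x) = (z ^ (j'.val : ℤ)) x → j = j' := by
        intro x hx
        have h2 := (h.free1 k ((j.val : ℤ) - j'.val) x (by
          rw [sub_eq_neg_add, ← zadd, ← h.zc, hx, zadd]; simp)).2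
        ext; omega
      cases b <;> cases b' <;> simp only [if_true, if_false, Bool.false_eq_true] at hk
      · rw [aux _ hk]
      · exfalso
        refine h.sside (x := o) k (-(j'.val : ℤ) + j.val) ?_
        rw [← zadd, ← h.zc, hk, zadd]; simp
      · exfalso
        refine h.free2 k (-(j'.val : ℤ) + j.val) o ?_
        rw [← zadd, ← h.zc, hk, zadd]; simp
      · rw [aux _ hk]
    · intro q
      obtain ⟨y, rfl⟩ := bk_ind q
      have aux : ∀ j : ℤ, ∃ j' : Fin 3, z ^ (j'.val : ℤ) = z ^ j := by
        intro j
        refine ⟨⟨(j % 3).toNat, by omega⟩, zpow_eq_of_dvd h.hz ?_⟩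
        simp only
        omega
      rcases h.cov o y with ⟨i, j, e⟩ | ⟨i, j, e⟩
      · obtain ⟨j', hj⟩ := aux j
        refine ⟨(j', false), bk_eq.mpr ⟨i, ?_⟩⟩
        simp only [Bool.false_eq_true, if_false]
        rw [hj, e]
      · obtain ⟨j', hj⟩ := aux j
        refine ⟨(j', true), bk_eq.mpr ⟨i, ?_⟩⟩
        simp only [if_true]
        rw [hj, e]
  rw [← Nat.card_congr (Equiv.ofBijective f hf)]
  simp

theorem c_free (h : Dih p c z s) (i : ℤ) (x : Ω) (e : (c ^ i) x = x) : (p : ℤ) ∣ i :=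
  (h.free1 i 0 x (by simpa using e)).1

end Dih

/-- In a p-group all of whose elements preserve the c-orbit of x, all elements act on it as
powers of c. -/
theorem L1 [Finite Ω] {p : ℕ} (hp : p.Prime) {P : Subgroup (Perm Ω)} (hP : IsPGroup p P)
    {c : Perm Ω} (hc : c ∈ P) (hcp : c ^ p = 1) {x : Ω} (hfree : ∀ i : ℤ, (c ^ i) x = x → (p : ℤ) ∣ i)
    (hx : ∀ g ∈ P, c.SameCycle x (g x)) {g : Perm Ω} (hg : g ∈ P) :
    ∃ k : ℤ, ∀ i : ℤ, g ((c ^ i) x) = (c ^ (k + i)) x := by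
  have := Fact.mk hp
  obtain ⟨n, hn⟩ := (IsPGroup.iff_card).mp hP
  have horb : (MulAction.orbit P x).ncard = p := by
    have : MulAction.orbit P x = (fun i : ℕ => (c ^ (i : ℤ)) x) '' (Finset.range p : Set ℕ) := by
      ext y
      constructor
      · rintro ⟨g, rfl⟩
        obtain ⟨i, hi⟩ := hx g.1 g.2
        have hp0 : (0 : ℤ) < p := by exact_mod_cast hp.pos
        have h1 := Int.emod_nonneg i hp0.ne'
        have h2 := Int.emod_lt_of_pos i hp0
        refine ⟨(i % p).toNat, ?_, ?_⟩
        · simp; omega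
        · show (c ^ (((i % p).toNat : ℕ) : ℤ)) x = g.1 x
          rw [← hi, zpow_eq_of_dvd hcp (j := i)]
          rw [Int.toNat_of_nonneg h1]
          exact (Int.mod_modEq i p).symm.dvd
      · rintro ⟨i, -, rfl⟩
        exact ⟨⟨c ^ (i : ℤ), zpow_mem hc _⟩, rfl⟩
    rw [this, Set.InjOn.ncard_image]
    · simp
    · intro a ha b hb e
      simp only [Finset.coe_range, Set.mem_Iio] at ha hb
      have e' : (c ^ (-(b : ℤ) + a)) x = x := by
        rw [← zadd]
        simp only at e
        rw [e, zadd]; simp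
      have := hfree _ e'
      have h2 : (a : ℤ) = b := by
        obtain ⟨t, ht⟩ := this
        have : t = 0 := by
          by_contra h0
          rcases lt_or_gt_of_ne h0 with h | h <;> nlinarith
        subst this; linarith
      exact_mod_cast h2
  have hn0 : n ≠ 0 := by
    rintro rfl
    have h1 : (MulAction.stabilizer P x).index = p := by rw [MulAction.index_stabilizer, horb]
    have := Subgroup.index_dvd_card (MulAction.stabilizer P x)
    rw [h1, hn] at this
    simp at this
    exact hp.one_lt.ne' this
  have hnorm : (MulAction.stabilizer P x).Normal := by
    apply Subgroup.normal_of_index_eq_minFac_card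
    rw [MulAction.index_stabilizer, horb, hn, hp.pow_minFac hn0]
  obtain ⟨k, hk⟩ := hx g hg
  refine ⟨k, fun i => ?_⟩
  let C : P := ⟨c, hc⟩
  let g' : P := ⟨g, hg⟩
  have h1 : C ^ (-k) * g' ∈ MulAction.stabilizer P x := by
    rw [MulAction.mem_stabilizer_iff]
    show (c ^ (-k)) (g x) = x
    rw [← hk, zadd]; simp
  have h2 := hnorm.conj_mem _ h1 (C ^ (-i))
  rw [MulAction.mem_stabilizer_iff] at h2
  have h3 : (c ^ (-i)) ((c ^ (-k)) (g (((c ^ (-i))⁻¹ : Perm Ω) x))) = x := h2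
  rw [← zpow_neg, neg_neg, zadd] at h3
  have h4 := congrArg (c ^ (k + i)) h3
  rw [zadd] at h4
  simpa using h4

end blocks
end D6
namespace D6
open Equiv Equiv.Perm
open scoped Pointwise

section nonuniform
variable {Ω : Type*}

/-- nonuniform pairs of blocks -/
def NU (Γ : Ω → Ω → Prop) (c : Perm Ω) (x y : Ω) : Prop :=
  ∃ y' y'', c.SameCycle y y' ∧ c.SameCycle y y'' ∧ Γ x y' ∧ ¬ Γ x y''

theorem NU.map {Γ : Ω → Ω → Prop} {c g : Perm Ω} (hg : g ∈ autG Γ) (hg' : g ∈ autG c.SameCycle)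
    {x y : Ω} (h : NU Γ c x y) : NU Γ c (g x) (g y) := by
  obtain ⟨y', y'', h1, h2, h3, h4⟩ := h
  exact ⟨g y', g y'', (hg' _ _).2 h1, (hg' _ _).2 h2, (hg _ _).2 h3, fun h => h4 ((hg _ _).1 h)⟩

theorem NU.right {Γ : Ω → Ω → Prop} {c : Perm Ω} {x y w : Ω} (h : NU Γ c x y)
    (hw : c.SameCycle y w) : NU Γ c x w := by
  obtain ⟨y', y'', h1, h2, h3, h4⟩ := h
  exact ⟨y', y'', hw.symm.trans h1, hw.symm.trans h2, h3, h4⟩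

theorem NU.left {Γ : Ω → Ω → Prop} {c : Perm Ω} (hc : c ∈ autG Γ) {x y w : Ω} (h : NU Γ c x y)
    (hw : c.SameCycle x w) : NU Γ c w y := by
  obtain ⟨i, rfl⟩ := hw
  have h1 := h.map (zpow_mem hc i) (zpow_mem (autG_comm (Commute.refl c)) i)
  exact h1.right (sc_zpow _ _ _).symm

theorem NU.lr {Γ : Ω → Ω → Prop} {c : Perm Ω} (hc : c ∈ autG Γ) {x y x' y' : Ω} (h : NU Γ c x y)
    (hw : c.SameCycle x x') (hy : c.SameCycle y y') : NU Γ c x' y' := (h.left hc hw).right hy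

theorem not_NU {Γ : Ω → Ω → Prop} {c : Perm Ω} (hc : c ∈ autG Γ) {x y x' y' : Ω} (h : ¬ NU Γ c x y)
    (hw : c.SameCycle x x') (hy : c.SameCycle y y') : Γ x' y' ↔ Γ x y := by
  obtain ⟨i, rfl⟩ := hw
  have h1 := zpow_mem hc (-i) ((c ^ i) x) y'
  rw [← h1]
  have : (c ^ (-i)) ((c ^ i) x) = x := by rw [zadd]; simp
  rw [this]
  have h2 : c.SameCycle y ((c ^ (-i)) y') := hy.trans (sc_zpow _ _ _)
  by_contra hne
  apply h
  by_cases h3 : Γ x y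
  · exact ⟨y, _, SameCycle.refl _ _, h2, h3, fun h => hne (by tauto)⟩
  · exact ⟨_, y, h2, SameCycle.refl _ _, by tauto, h3⟩

theorem zpow_solve {p : ℕ} (hp : p.Prime) {d : ℤ} (hd : ¬ (p : ℤ) ∣ d) (t : ℤ) :
    ∃ m : ℤ, (p : ℤ) ∣ m * d - t := by
  have h1 : IsCoprime (p : ℤ) d := by
    rw [Prime.coprime_iff_not_dvd (Nat.prime_iff_prime_int.mp hp)]; exact hd
  obtain ⟨a, b, hab⟩ := h1
  refine ⟨t * b, ⟨-(t * a), ?_⟩⟩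
  linear_combination t * hab

theorem L3 {Γ : Ω → Ω → Prop} {p : ℕ} (hp : p.Prime) {c g : Perm Ω} (hc : c ∈ autG Γ)
    (hcp : c ^ p = 1) (hg : g ∈ autG Γ) {x y : Ω} {a b : ℤ} (hx : g x = (c ^ a) x)
    (hy : ∀ w, c.SameCycle y w → g w = (c ^ b) w) (h : NU Γ c x y) : (p : ℤ) ∣ b - a := by
  by_contra hd
  have step : ∀ w, c.SameCycle y w → (Γ x w ↔ Γ x ((c ^ (b - a)) w)) := by
    intro w hw
    rw [← hg x w, hx, hy w hw, ← zpow_mem hc (-a) ((c ^ a) x) _, zadd, zadd, sub_eq_neg_add]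
    simp
  have step2 : ∀ n : ℕ, ∀ w, c.SameCycle y w → (Γ x w ↔ Γ x ((c ^ (n * (b - a))) w)) := by
    intro n
    induction n with
    | zero => intro w hw; simp
    | succ n ih =>
      intro w hw
      rw [step w hw, ih _ (hw.trans (sc_zpow _ _ _)), zadd]
      have : (n : ℤ) * (b - a) + (b - a) = ((n + 1 : ℕ) : ℤ) * (b - a) := by push_cast; ring
      rw [this]
  obtain ⟨y', y'', h1, h2, h3, h4⟩ := h
  obtain ⟨t, ht⟩ := h1.symm.trans h2
  obtain ⟨m, hm⟩ := zpow_solve hp hd t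
  apply h4
  have hp0 : (0 : ℤ) < p := by exact_mod_cast hp.pos
  have h5 := Int.emod_nonneg m hp0.ne'
  have h6 := (step2 (m % p).toNat y' h1).1 h3
  rw [Int.toNat_of_nonneg h5, zpow_eq_of_dvd hcp (j := t), ht] at h6
  · exact h6
  · have : (p : ℤ) ∣ m - m % p := Int.dvd_self_sub_emod
    have := (hm.sub (this.mul_right (b - a)))
    have e : m % ↑p * (b - a) - t = m * (b - a) - t - (m - m % ↑p) * (b - a) := by
      ring
    rw [e]; exact this

end nonuniform

section sides
variable {Ω : Type*}

theorem comm3 [Finite Ω] {c : Perm Ω} (hcard : Nat.card (Blk c) = 6) {Q : Subgroup (Perm Ω)}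
    (hQ : IsPGroup 3 Q) (hle : Q ≤ autG c.SameCycle) {x y : Perm Ω} (hx : x ∈ Q) (hy : y ∈ Q)
    (w : Ω) : c.SameCycle (x (y w)) (y (x w)) := by
  have := Fact.mk Nat.prime_three
  let f : Q →* Perm (Blk c) := (toBlk c).comp (Subgroup.inclusion hle)
  have h1 : IsPGroup 3 f.range := hQ.of_surjective f.rangeRestrict f.rangeRestrict_surjective
  obtain ⟨n, hn⟩ := IsPGroup.iff_card.mp h1
  have h2 : Nat.card f.range ∣ Nat.card (Perm (Blk c)) := Subgroup.card_subgroup_dvd_card _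
  rw [hn, Nat.card_perm, hcard] at h2
  have hn2 : n ≤ 2 := by
    by_contra h
    have : 3 ^ 3 ∣ 3 ^ n := pow_dvd_pow 3 (by omega)
    have := this.trans h2
    revert this; decide
  have hcomm : ∀ a b : f.range, a * b = b * a := by
    rcases (by omega : n = 0 ∨ n = 1 ∨ n = 2) with rfl | rfl | rfl
    · have : Subsingleton f.range := (Nat.card_eq_one_iff_unique.mp (by simpa using hn)).1
      intro a b; exact Subsingleton.elim _ _
    · have : IsCyclic f.range := isCyclic_of_prime_card (p := 3) (by simpa using hn)
      intro a b
      exact (IsCyclic.commGroup (α := f.range)).mul_comm a b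
    · intro a b
      exact (IsPGroup.commGroupOfCardEqPrimeSq hn).mul_comm a b
  have h3 := congrArg Subtype.val (hcomm ⟨f ⟨x, hx⟩, ⟨_, rfl⟩⟩ ⟨f ⟨y, hy⟩, ⟨_, rfl⟩⟩)
  have h4 := congrArg (fun g : Perm (Blk c) => g (bk c w)) h3
  exact bk_eq.mp h4

/-- sides -/
def Sd (c z : Perm Ω) (x y : Ω) : Prop := ∃ i j : ℤ, y = (c ^ i) ((z ^ j) x)

namespace Dih
variable {p : ℕ} {c z s : Perm Ω}

theorem sd_refl (x : Ω) : Sd c z x x := ⟨0, 0, by simp⟩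

theorem sd_symm (h : Dih p c z s) {x y : Ω} : Sd c z x y → Sd c z y x := by
  rintro ⟨i, j, rfl⟩
  refine ⟨-i, -j, ?_⟩
  rw [h.zc, zadd, zadd]; simp

theorem sd_trans (h : Dih p c z s) {x y w : Ω} : Sd c z x y → Sd c z y w → Sd c z x w := by
  rintro ⟨i, j, rfl⟩ ⟨i', j', rfl⟩
  refine ⟨i' + i, j' + j, ?_⟩
  rw [h.zc, zadd, zadd]

theorem sd_two (h : Dih p c z s) {o x y : Ω} (hx : ¬ Sd c z o x) (hy : ¬ Sd c z o y) :
    Sd c z x y := by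
  have aux : ∀ x, ¬ Sd c z o x → Sd c z (s o) x := by
    intro x hx
    rcases h.cov o x with hh | hh
    · exact absurd hh hx
    · exact hh
  exact h.sd_trans (h.sd_symm (aux x hx)) (aux y hy)

theorem sd_s (h : Dih p c z s) (x : Ω) : ¬ Sd c z x (s x) := by
  rintro ⟨i, j, e⟩
  exact h.sside i j e

theorem sd_mem3 (h : Dih p c z s) {g : Perm Ω} (hg : g ∈ autG (Sd c z)) (h3 : g ^ 3 = 1) (x : Ω) :
    Sd c z x (g x) := by
  by_contra h1
  have h2 : ¬ Sd c z x (g (g x)) := by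
    intro h2
    have h4 : Sd c z (g x) (g (g (g x))) := (hg _ _).2 h2
    have : g (g (g x)) = x := by
      have := congrArg (fun f : Perm Ω => f x) h3
      simpa [pow_succ] using this
    rw [this] at h4
    exact h1 (h.sd_symm h4)
  have h5 := h.sd_two h1 h2
  exact h1 ((hg _ _).1 h5)

/-- two generators of order 3 commuting with each other and with c agree up to inversion on each
side. -/
theorem side_lemma (h1 : Dih p c z s) {z2 s2 : Perm Ω} (h2 : Dih p c z2 s2)
    (hp : IsCoprime (p : ℤ) 3)
    (hcomm : Commute z z2) (o : Ω) :
    ∃ z', (z' = z2 ∨ z' = z2⁻¹) ∧ (z' = z ∨ ((∀ x, Sd c z o x → z' x = z x) ∧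
      ∀ x, ¬ Sd c z o x → z' x = z⁻¹ x)) := by
  have hcm : ∀ (i j : ℤ) x, z2 ((c ^ i) ((z ^ j) x)) = (c ^ i) ((z ^ j) (z2 x)) := by
    intro i j x
    have e1 : z2 * (c ^ i * z ^ j) = (c ^ i * z ^ j) * z2 :=
      ((h2.cz.symm.zpow_right i).mul_right (hcomm.symm.zpow_right j)).eq
    exact congrArg (fun f : Perm Ω => f x) e1
  have haut : z2 ∈ autG (Sd c z) := by
    intro x y
    constructor
    · rintro ⟨i, j, e⟩
      refine ⟨i, j, z2.injective ?_⟩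
      rw [e, hcm]
    · rintro ⟨i, j, rfl⟩
      exact ⟨i, j, hcm _ _ _⟩
  have pt : ∀ x, (∀ y, Sd c z x y → z2 y = z y) ∨ (∀ y, Sd c z x y → z2 y = z⁻¹ y) := by
    intro x
    obtain ⟨i, j, e⟩ := h1.sd_mem3 haut h2.hz x
    have e3 : z2 (z2 (z2 x)) = x := by
      have := congrArg (fun f : Perm Ω => f x) h2.hz
      simpa [pow_succ] using this
    rw [e, hcm, e, hcm, hcm, e, h1.zc, h1.zc, zadd, zadd, h1.zc, zadd, zadd] at e3
    obtain ⟨hd1, -⟩ := h1.free1 _ _ _ e3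
    have hd2 : (p : ℤ) ∣ i := by
      have : (p : ℤ) ∣ 3 * i := by convert hd1 using 1; ring
      exact hp.dvd_of_dvd_mul_left this
    have hci : c ^ i = 1 := by
      have := zpow_eq_of_dvd h1.hc (i := i) (j := 0) (by simpa using hd2)
      simpa using this
    rw [hci, Perm.one_apply] at e
    have hj : ¬ (3 : ℤ) ∣ j := by
      intro hj
      have hz0 : z ^ j = 1 := by
        have := zpow_eq_of_dvd h1.hz (i := j) (j := 0) (by simpa using hj)
        simpa using this
      rw [hz0, Perm.one_apply] at e
      have := (h2.free1 0 1 x (by simpa using e)).2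
      omega
    rcases (by omega : (3 : ℤ) ∣ j - 1 ∨ (3 : ℤ) ∣ j - (-1)) with h | h
    · left
      rintro _ ⟨a, b, rfl⟩
      rw [zpow_eq_of_dvd h1.hz h, zpow_one] at e
      have e1 := h1.zc a 1
      simp only [zpow_one] at e1
      rw [hcm, e, e1]
      congr 1
      show (z ^ b * z) x = (z * z ^ b) x
      rw [← zpow_add_one, ← zpow_one_add, add_comm]
    · right
      rintro _ ⟨a, b, rfl⟩
      rw [zpow_eq_of_dvd h1.hz h, zpow_neg_one] at e
      have e1 := h1.zc a (-1)
      simp only [zpow_neg_one] at e1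
      rw [hcm, e, e1]
      congr 1
      show (z ^ b * z⁻¹) x = (z⁻¹ * z ^ b) x
      rw [← zpow_neg_one, ← zpow_add, ← zpow_add, add_comm]
  have inv1 : ∀ x, (∀ y, Sd c z x y → z2 y = z y) → (∀ y, Sd c z x y → z2⁻¹ y = z⁻¹ y) := by
    intro x hx y hy
    rw [Perm.inv_eq_iff_eq, hx, apinv]
    exact h1.sd_trans hy ⟨0, -1, by simp⟩
  have inv2 : ∀ x, (∀ y, Sd c z x y → z2 y = z⁻¹ y) → (∀ y, Sd c z x y → z2⁻¹ y = z y) := by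
    intro x hx y hy
    rw [Perm.inv_eq_iff_eq, hx, invap]
    exact h1.sd_trans hy ⟨0, 1, by simp⟩
  have off : ∀ x, ¬ Sd c z o x → Sd c z (s o) x := fun x hx => h1.sd_two (h1.sd_s o) hx
  rcases pt o with ho | ho <;> rcases pt (s o) with hs | hs
  · refine ⟨z2, Or.inl rfl, Or.inl ?_⟩
    ext x
    by_cases hx : Sd c z o x
    · exact ho x hx
    · exact hs x (off x hx)
  · exact ⟨z2, Or.inl rfl, Or.inr ⟨ho, fun x hx => hs x (off x hx)⟩⟩
  · refine ⟨z2⁻¹, Or.inr rfl, Or.inr ⟨inv2 o ho, fun x hx => inv1 _ hs x (off x hx)⟩⟩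
  · refine ⟨z2⁻¹, Or.inr rfl, Or.inl ?_⟩
    ext x
    by_cases hx : Sd c z o x
    · exact inv2 o ho x hx
    · exact inv2 _ hs x (off x hx)

theorem finish (h1 : Dih p c z s) {s2 : Perm Ω} (h2 : Dih p c z s2) (o : Ω) :
    ∃ i j : ℤ, s2 = c ^ i * z ^ j * s := by
  rcases h1.cov o (s2 o) with ⟨i, j, e⟩ | ⟨i, j, e⟩
  · exact absurd e (h2.sside i j)
  · refine ⟨i, j, ?_⟩
    have key : ∀ x, s2 x = (c ^ i) ((z ^ j) (s x)) → ∀ a b : ℤ, s2 ((c ^ a) ((z ^ b) x)) =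
        (c ^ i) ((z ^ j) (s ((c ^ a) ((z ^ b) x)))) := by
      intro x hx a b
      rw [h2.s_c, h2.s_z, h1.s_c, h1.s_z, hx, h1.zc, h1.zc, zadd, zadd, zadd, zadd,
        add_comm, add_comm (-b)]
    ext y
    show s2 y = (c ^ i) ((z ^ j) (s y))
    rcases h1.cov o y with ⟨a, b, rfl⟩ | ⟨a, b, rfl⟩
    · exact key o e a b
    · apply key
      have e2 : s o = (c ^ (-i)) ((z ^ (-j)) (s2 o)) := by
        rw [e, h1.zc, zadd, zadd]; simp
      rw [h1.s_s]
      conv_lhs => rw [e2]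
      rw [h2.s_c, h2.s_z, h2.s_s]; simp

end Dih
end sides
end D6
namespace D6
open Equiv Equiv.Perm
open scoped Pointwise
section partI
variable {Ω : Type*} {Γ : Ω → Ω → Prop} {R : Subgroup (Perm Ω)} {p : ℕ} {c z s z2 s2 : Perm Ω}

theorem partI_eq (h1 : Dih p c z s) (h2 : Dih p c z s2) (hcR : c ∈ R) (hzR : z ∈ R) (hsR : s ∈ R)
    (o : Ω) : Good Γ R c z s2 := by
  obtain ⟨i, j, e⟩ := h1.finish h2 o
  refine ⟨1, one_mem _, by simpa, by simpa, ?_⟩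
  simp only [one_mul, inv_one, mul_one]
  rw [e]
  exact mul_mem (mul_mem (zpow_mem hcR _) (zpow_mem hzR _)) hsR

theorem partI_conj (h1 : Dih p c z s) (h2 : Dih p c z2 s2) (hcR : c ∈ R) (hzR : z ∈ R)
    (hsR : s ∈ R) (o : Ω) {φ : Perm Ω} (hφ : φ ∈ autG Γ) (hφc : φ * c * φ⁻¹ = c)
    (hφz : φ * z2 * φ⁻¹ = z) : Good Γ R c z2 s2 := by
  apply Good.of_conj hφ
  have := h2.conj φ
  rw [hφc, hφz] at this ⊢
  exact partI_eq h1 this hcR hzR hsR o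

theorem Dih.side_swap (h1 : Dih p c z s) (h2 : Dih p c z2 s2) (o : Ω)
    (hA : ∀ x, Sd c z o x → z2 x = z x) (hB : ∀ x, ¬ Sd c z o x → z2 x = z⁻¹ x) :
    (∀ (i : ℤ) x, Sd c z o ((c ^ i) x) ↔ Sd c z o x) ∧
    (∀ (i : ℤ) x, Sd c z o ((z ^ i) x) ↔ Sd c z o x) ∧
    (∀ x, Sd c z o x → ¬ Sd c z o (s2 x)) ∧ (∀ x, ¬ Sd c z o x → Sd c z o (s2 x)) ∧
    (∀ x, Sd c z o x → ¬ Sd c z o (s x)) ∧ (∀ x, ¬ Sd c z o x → Sd c z o (s x)) ∧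
    (∀ (j : ℤ) x, s2 ((z ^ j) x) = (z ^ j) (s2 x)) := by
  -- basic facts about sides
  have sdc : ∀ (i : ℤ) x, Sd c z o ((c ^ i) x) ↔ Sd c z o x := by
    intro i x
    constructor
    · intro h; exact h1.sd_trans h (h1.sd_symm ⟨i, 0, by simp⟩)
    · intro h; exact h1.sd_trans h ⟨i, 0, by simp⟩
  have sdz : ∀ (i : ℤ) x, Sd c z o ((z ^ i) x) ↔ Sd c z o x := by
    intro i x
    constructor
    · intro h; exact h1.sd_trans h (h1.sd_symm ⟨0, i, by simp⟩)
    · intro h; exact h1.sd_trans h ⟨0, i, by simp⟩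
  have zA : ∀ (x : Ω), Sd c z o x → ∀ j : ℤ, (z2 ^ j) x = (z ^ j) x := by
    intro x hx j
    induction j with
    | zero => simp
    | succ n ih =>
      rw [add_comm, ← zadd, ih, ← zadd, zpow_one, zpow_one, hA]; rwa [sdz]
    | pred n ih =>
      have e1 : (-(n : ℤ) - 1) = -1 + -n := by ring
      rw [e1, ← zadd, ih, ← zadd, zpow_neg_one, zpow_neg_one, Perm.inv_eq_iff_eq, hA, apinv]
      rw [← zpow_neg_one, sdz, sdz]; exact hx
  have zB : ∀ (x : Ω), ¬ Sd c z o x → ∀ j : ℤ, (z2 ^ j) x = (z ^ (-j)) x := by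
    intro x hx j
    induction j with
    | zero => simp
    | succ n ih =>
      have e1 : (-((n : ℤ) + 1)) = -1 + -n := by ring
      rw [add_comm, ← zadd, ih, add_comm, e1, ← zadd, zpow_one, hB, zpow_neg_one]; rwa [sdz]
    | pred n ih =>
      have e1 : (-(n : ℤ) - 1) = -1 + -n := by ring
      have e2 : -(-1 + -(n : ℤ)) = 1 + n := by ring
      rw [e1, ← zadd, ih, e2, ← zadd, zpow_neg_one, zpow_one, neg_neg, Perm.inv_eq_iff_eq, hB, invap]
      have e3 := sdz 1 ((z ^ (n : ℤ)) x)
      rw [zpow_one] at e3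
      rw [e3, sdz]; exact hx
  have s2A : ∀ x, Sd c z o x → ¬ Sd c z o (s2 x) := by
    intro x hx hx2
    obtain ⟨i, j, e⟩ := h1.sd_trans (h1.sd_symm hx) hx2
    rw [← zA x hx] at e
    exact h2.sside i j e
  have s2B : ∀ x, ¬ Sd c z o x → Sd c z o (s2 x) := by
    intro x hx
    by_contra hx2
    obtain ⟨i, j, e⟩ := h1.sd_two hx hx2
    rw [← neg_neg j, ← zB x hx] at e
    exact h2.sside i _ e
  have s1A : ∀ x, Sd c z o x → ¬ Sd c z o (s x) := by
    intro x hx hx2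
    exact h1.sd_s x (h1.sd_trans (h1.sd_symm hx) hx2)
  have s1B : ∀ x, ¬ Sd c z o x → Sd c z o (s x) := by
    intro x hx
    by_contra hx2
    exact h1.sd_s x (h1.sd_two hx hx2)
  have s2z : ∀ (j : ℤ) x, s2 ((z ^ j) x) = (z ^ j) (s2 x) := by
    intro j x
    by_cases hx : Sd c z o x
    · rw [← zA x hx, h2.s_z, zB _ (s2A x hx), neg_neg]
    · have := zB x hx (-j)
      rw [neg_neg] at this
      rw [← this, h2.s_z, neg_neg, zA _ (s2B x hx)]
  exact ⟨sdc, sdz, s2A, s2B, s1A, s1B, s2z⟩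

theorem partI_inv [Finite Ω] (h1 : Dih p c z s) (h2 : Dih p c z2 s2) (hcR : c ∈ R) (hzR : z ∈ R)
    (hsR : s ∈ R) (o : Ω) (hc : c ∈ autG Γ) (hz : z ∈ autG Γ) (hs : s ∈ autG Γ)
    (hz2 : z2 ∈ autG Γ) (hs2 : s2 ∈ autG Γ)
    (hA : ∀ x, Sd c z o x → z2 x = z x) (hB : ∀ x, ¬ Sd c z o x → z2 x = z⁻¹ x) :
    Good Γ R c z2 s2 := by
  classical
  obtain ⟨sdc, sdz, s2A, s2B, s1A, s1B, s2z⟩ := h1.side_swap h2 o hA hB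
  obtain ⟨t, l, hn⟩ : Sd c z o (s2 (s o)) := s2B _ (s1A _ (Dih.sd_refl o))
  -- the map
  let n : Perm Ω := c ^ (-t) * s2 * s
  have ndef : ∀ x, n x = (c ^ (-t)) (s2 (s x)) := fun x => rfl
  have nG : n ∈ autG Γ := mul_mem (mul_mem (zpow_mem hc _) hs2) hs
  have nc : ∀ (i : ℤ) x, n ((c ^ i) x) = (c ^ i) (n x) := by
    intro i x
    rw [ndef, ndef, h1.s_c, h2.s_c, neg_neg, zadd, zadd, add_comm]
  have nz : ∀ (i : ℤ) x, n ((z ^ i) x) = (z ^ (-i)) (n x) := by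
    intro i x
    rw [ndef, ndef, h1.s_z, s2z, h1.zc]
  have no : n o = (z ^ l) o := by
    rw [ndef, hn, zadd]; simp
  have nSd : ∀ x, Sd c z o (n x) ↔ Sd c z o x := by
    intro x
    rw [ndef, sdc]
    by_cases hx : Sd c z o x
    · simp only [hx, iff_true]; exact s2B _ (s1A x hx)
    · simp only [hx, iff_false]; exact s2A _ (s1B x hx)
  obtain ⟨φ, hφ⟩ := exists_glue (fun x => decide (Sd c z o x)) (fun b => if b then 1 else n) (by
    intro x
    by_cases hx : Sd c z o x
    · simp [hx]
    · simp [hx, nSd])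
  have φA : ∀ x, Sd c z o x → φ x = x := by
    intro x hx; rw [hφ]; simp [hx]
  have φB : ∀ x, ¬ Sd c z o x → φ x = n x := by
    intro x hx; rw [hφ]; simp [hx]
  let w : Perm Ω := z * z2
  have wG : w ∈ autG Γ := mul_mem hz hz2
  have zadd1 : ∀ x, (z ^ (2 : ℤ)) x = z (z x) := by
    intro x; rfl
  have wA : ∀ x, Sd c z o x → ∀ k : ℕ, (w ^ k) x = (z ^ (2 * k : ℤ)) x := by
    intro x hx k
    induction k with
    | zero => simp
    | succ k ih =>
      rw [pow_succ', Perm.mul_apply, ih]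
      show z (z2 _) = _
      rw [hA _ ((sdz _ _).2 hx), ← zadd1, zadd]
      congr 2
      push_cast; ring
  have wB : ∀ x, ¬ Sd c z o x → ∀ k : ℕ, (w ^ k) x = x := by
    intro x hx k
    induction k with
    | zero => simp
    | succ k ih =>
      rw [pow_succ', Perm.mul_apply, ih]
      show z (z2 _) = _
      rw [hB _ hx, apinv]
  have nx : ∀ x, Sd c z o x → ∃ k : ℕ, (w ^ k) x = n x := by
    rintro _ ⟨i, j, rfl⟩
    have hx : Sd c z o ((c ^ i) ((z ^ j) o)) := ⟨i, j, rfl⟩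
    refine ⟨((2 * (l - 2 * j)) % 3).toNat, ?_⟩
    rw [wA _ hx, nc, nz, no, h1.zc, zadd, zadd]
    congr 2
    apply zpow_eq_of_dvd h1.hz
    push_cast
    omega
  have φG : φ ∈ autG Γ := by
    intro x y
    by_cases hx : Sd c z o x <;> by_cases hy : Sd c z o y
    · rw [φA x hx, φA y hy]
    · rw [φA x hx, φB y hy]
      obtain ⟨k, hk⟩ := nx x hx
      rw [← pow_mem wG k, hk, wB (n y) (by rwa [nSd])]
      exact nG _ _
    · rw [φB x hx, φA y hy]
      obtain ⟨k, hk⟩ := nx y hy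
      rw [← pow_mem wG k, hk, wB (n x) (by rwa [nSd])]
      exact nG _ _
    · rw [φB x hx, φB y hy]; exact nG _ _
  refine partI_conj h1 h2 hcR hzR hsR o φG ?_ ?_
  · rw [mul_inv_eq_iff_eq_mul]
    ext x
    have e1 := sdc 1 x
    have e2 := nc 1 x
    rw [zpow_one] at e1 e2
    show φ (c x) = c (φ x)
    by_cases hx : Sd c z o x
    · rw [φA x hx, φA _ (e1.2 hx)]
    · rw [φB x hx, φB _ (by rwa [e1]), e2]
  · rw [mul_inv_eq_iff_eq_mul]
    ext x
    show φ (z2 x) = z (φ x)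
    by_cases hx : Sd c z o x
    · have e1 := sdz 1 x
      rw [zpow_one] at e1
      rw [hA x hx, φA x hx, φA _ (e1.2 hx)]
    · have e1 := sdz (-1) x
      have e2 := nz (-1) x
      rw [zpow_neg_one] at e1 e2
      rw [neg_neg, zpow_one] at e2
      rw [hB x hx, φB x hx, φB _ (by rwa [e1]), e2]

theorem partI [Finite Ω] (hp : p.Prime) (hp3 : 3 < p) (h1 : Dih p c z s) (h2 : Dih p c z2 s2)
    (hcR : c ∈ R) (hzR : z ∈ R)
    (hsR : s ∈ R) (o : Ω) (hc : c ∈ autG Γ) (hz : z ∈ autG Γ) (hs : s ∈ autG Γ)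
    (hz2 : z2 ∈ autG Γ) (hs2 : s2 ∈ autG Γ) : Good Γ R c z2 s2 := by
  have hcop : p.Coprime 3 := (Nat.coprime_primes hp Nat.prime_three).mpr (by omega)
  have hcop' : IsCoprime (p : ℤ) 3 := by exact_mod_cast Nat.isCoprime_iff_coprime.mpr hcop
  let H := autG Γ ⊓ Subgroup.centralizer {c}
  have memH : ∀ g, g ∈ H ↔ g ∈ autG Γ ∧ Commute g c := by
    intro g
    rw [Subgroup.mem_inf, Subgroup.mem_centralizer_singleton_iff]
    rfl
  obtain ⟨h, hh, Q, hQH, hQ, hzQ, hzQ2⟩ := sylow_conj H 3 Nat.prime_three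
    (x := z) (y := z2) (n := 1) (m := 1) ((memH _).2 ⟨hz, h1.cz.symm⟩) ((memH _).2 ⟨hz2, h2.cz.symm⟩)
    (by simpa using h1.hz) (by simpa using h2.hz)
  obtain ⟨hhG, hhc⟩ := (memH _).1 hh
  apply Good.of_conj hhG
  have h2' := h2.conj h
  have ec : h * c * h⁻¹ = c := by rw [hhc.eq]; simp
  have hz2' : h * z2 * h⁻¹ ∈ autG Γ := mul_mem (mul_mem hhG hz2) (inv_mem hhG)
  have hs2' : h * s2 * h⁻¹ ∈ autG Γ := mul_mem (mul_mem hhG hs2) (inv_mem hhG)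
  rw [ec] at h2' ⊢
  generalize h * z2 * h⁻¹ = z2' at *
  generalize h * s2 * h⁻¹ = s2' at *
  clear h2 hz2 hs2 hh ec hhG hhc h
  have hcomm : Commute z z2' := by
    let m := z * z2' * (z2' * z)⁻¹
    have hmQ : m ∈ Q := mul_mem (mul_mem hzQ hzQ2) (inv_mem (mul_mem hzQ2 hzQ))
    have hmc : Commute m c := ((memH _).1 (hQH hmQ)).2
    have hmb : ∀ w, c.SameCycle w (m w) := by
      intro w
      have := comm3 (h1.card_blk o) hQ (fun g hg => autG_comm ((memH _).1 (hQH hg)).2) hzQ hzQ2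
        ((z2' * z)⁻¹ w)
      have e : z2' (z ((z2' * z)⁻¹ w)) = w := apinv (z2' * z) w
      rw [e] at this
      exact this.symm
    have hmp : m ^ p = 1 := by
      ext w
      obtain ⟨i, hi⟩ := hmb w
      have : ∀ k : ℕ, (m ^ k) w = (c ^ (k * i : ℤ)) w := by
        intro k
        induction k with
        | zero => simp
        | succ k ih =>
          rw [pow_succ', Perm.mul_apply, ih]
          have e := congrArg (fun f : Perm Ω => f w) (hmc.zpow_right (k * i)).eq
          simp only [Perm.mul_apply] at e
          rw [e, ← hi, zadd]
          congr 2
          push_cast; ring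
      rw [this, zpow_mul, zpow_natCast, h1.hc]; simp
    obtain ⟨k, hk⟩ := hQ ⟨m, hmQ⟩
    have hk' : m ^ 3 ^ k = 1 := by
      have := congrArg Subtype.val hk
      simpa using this
    have hm1 : m = 1 := by
      rw [← orderOf_eq_one_iff]
      exact Nat.eq_one_of_dvd_coprimes (Nat.Coprime.pow_right k hcop)
        (orderOf_dvd_of_pow_eq_one hmp) (orderOf_dvd_of_pow_eq_one hk')
    exact mul_inv_eq_one.mp hm1
  obtain ⟨z', hz', hcase⟩ := h1.side_lemma h2' hcop' hcomm o
  suffices hgood : Good Γ R c z' s2' by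
    rcases hz' with rfl | rfl
    · exact hgood
    · exact hgood.of_zinv
  have h2'' : Dih p c z' s2' := by
    rcases hz' with rfl | rfl
    · exact h2'
    · exact h2'.zinv
  have hz'' : z' ∈ autG Γ := by
    rcases hz' with rfl | rfl
    · exact hz2'
    · exact inv_mem hz2'
  rcases hcase with rfl | ⟨hA, hB⟩
  · exact partI_eq h1 h2'' hcR hzR hsR o
  · exact partI_inv h1 h2'' hcR hzR hsR o hc hz hs hz'' hs2' hA hB

end partI
end D6
namespace D6
open Equiv Equiv.Perm
open scoped Pointwise
section partII
variable {Ω : Type*}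

/-- permutations commuting with c and preserving its orbits -/
def TT (c : Perm Ω) : Subgroup (Perm Ω) where
  carrier := {g | Commute g c ∧ ∀ x, c.SameCycle x (g x)}
  mul_mem' := by
    rintro a b ⟨h1, h2⟩ ⟨h3, h4⟩
    exact ⟨h1.mul_left h3, fun x => (h4 x).trans (h2 (b x))⟩
  one_mem' := ⟨Commute.one_left _, fun x => SameCycle.refl _ _⟩
  inv_mem' := by
    rintro a ⟨h1, h2⟩
    refine ⟨h1.inv_left, fun x => ?_⟩
    have := h2 (a⁻¹ x)
    rw [apinv] at this
    exact this.symm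

theorem mem_TT {c g : Perm Ω} : g ∈ TT c ↔ Commute g c ∧ ∀ x, c.SameCycle x (g x) := Iff.rfl

theorem self_TT (c : Perm Ω) : c ∈ TT c := ⟨Commute.refl c, fun x => ⟨1, by simp⟩⟩

theorem TT_pt {c g : Perm Ω} (hg : g ∈ TT c) (x : Ω) :
    ∃ a : ℤ, ∀ y, c.SameCycle x y → g y = (c ^ a) y := by
  obtain ⟨a, ha⟩ := hg.2 x
  refine ⟨a, ?_⟩
  rintro _ ⟨i, rfl⟩
  have e := congrArg (fun f : Perm Ω => f x) (hg.1.zpow_right i).eq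
  simp only [Perm.mul_apply] at e
  rw [e, ← ha, zadd, zadd, add_comm]

theorem TT_comm {c g g' : Perm Ω} (hg : g ∈ TT c) (hg' : g' ∈ TT c) : Commute g g' := by
  ext x
  obtain ⟨a, ha⟩ := TT_pt hg x
  obtain ⟨b, hb⟩ := TT_pt hg' x
  rw [Perm.mul_apply, Perm.mul_apply, ha _ (hg'.2 x), hb _ (hg.2 x), hb x (SameCycle.refl _ _),
    ha x (SameCycle.refl _ _), zadd, zadd, add_comm]

variable {p : ℕ} {c1 z1 s1 c2 z2 s2 : Perm Ω}

theorem pw_pow {c g : Perm Ω} {x : Ω} {a : ℤ}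
    (ha : ∀ y, c.SameCycle x y → g y = (c ^ a) y) (k : ℤ) :
    ∀ y, c.SameCycle x y → (g ^ k) y = (c ^ (a * k)) y := by
  intro y hy
  induction k with
  | zero => simp
  | succ n ih =>
    rw [add_comm, ← zadd, ih, zpow_one, ha _ (hy.trans (sc_zpow _ _ _)), zadd]
    congr 2; ring
  | pred n ih =>
    have e1 : (-(n : ℤ) - 1) = -1 + -n := by ring
    rw [e1, ← zadd, ih, zpow_neg_one, Perm.inv_eq_iff_eq, ha _ (hy.trans (sc_zpow _ _ _)), zadd]
    congr 2; ring

theorem same_cyc (hp : p.Prime) (h1 : Dih p c1 z1 s1) (h2 : Dih p c2 z2 s2) (ht : c2 ∈ TT c1)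
    (x y : Ω) :
    c2.SameCycle x y ↔ c1.SameCycle x y := by
  constructor
  · rintro ⟨i, rfl⟩
    exact (zpow_mem ht i).2 x
  · rintro ⟨i, rfl⟩
    obtain ⟨a, ha⟩ := TT_pt ht x
    have hd : ¬ (p : ℤ) ∣ a := by
      intro hd
      have e : c2 x = x := by
        rw [ha x (SameCycle.refl _ _), zpow_eq_of_dvd h1.hc (i := a) (j := 0) (by simpa using hd)]
        simp
      have := h2.c_free 1 x (by simpa using e)
      have h5 := Int.eq_one_of_dvd_one (by positivity) this
      exact hp.one_lt.ne' (by exact_mod_cast h5)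
    obtain ⟨m, hm⟩ := zpow_solve hp hd i
    refine ⟨m, ?_⟩
    rw [pw_pow ha m x (SameCycle.refl _ _)]
    rw [zpow_eq_of_dvd h1.hc (j := i)]
    rwa [mul_comm]

theorem TT_eq (hs : ∀ x y, c2.SameCycle x y ↔ c1.SameCycle x y) (ht : c2 ∈ TT c1) :
    TT c2 = TT c1 := by
  have ht' : c1 ∈ TT c2 := ⟨ht.1.symm, fun x => (hs _ _).2 ((self_TT c1).2 x)⟩
  ext g
  constructor
  · intro hg
    exact ⟨TT_comm hg ht', fun x => (hs _ _).1 (hg.2 x)⟩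
  · intro hg
    exact ⟨TT_comm hg ht, fun x => (hs _ _).2 (hg.2 x)⟩

theorem norm_of {c g : Perm Ω} (hg : g ∈ autG c.SameCycle)
    (h : g * c * g⁻¹ = c ∨ g * c * g⁻¹ = c⁻¹) : g ∈ Subgroup.normalizer (TT c : Set (Perm Ω)) := by
  have key : ∀ g : Perm Ω, g ∈ autG c.SameCycle → (g * c * g⁻¹ = c ∨ g * c * g⁻¹ = c⁻¹) →
      ∀ t ∈ TT c, g * t * g⁻¹ ∈ TT c := by
    intro g hg h t ht
    constructor
    · have h1 : Commute (g * t * g⁻¹) (g * c * g⁻¹) := by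
        have := ht.1.eq
        show g * t * g⁻¹ * (g * c * g⁻¹) = g * c * g⁻¹ * (g * t * g⁻¹)
        calc _ = g * (t * c) * g⁻¹ := by group
          _ = _ := by rw [this]; group
      rcases h with h | h <;> rw [h] at h1
      · exact h1
      · exact Commute.inv_right_iff.mp h1
    · intro x
      have := (hg _ _).2 (ht.2 (g⁻¹ x))
      rw [apinv] at this
      exact this
  rw [Subgroup.mem_normalizer_iff]
  intro t
  refine ⟨key g hg h t, fun ht => ?_⟩
  have h' : g⁻¹ * c * g⁻¹⁻¹ = c ∨ g⁻¹ * c * g⁻¹⁻¹ = c⁻¹ := by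
    rcases h with h | h
    · left; conv_lhs => rw [← h]
      group
    · right; rw [eq_inv_iff_mul_eq_one] at h ⊢
      calc _ = g⁻¹ * (c * (g * c * g⁻¹)) * g := by group
        _ = g⁻¹ * (c * (g * c * g⁻¹ * c) * c⁻¹) * g := by group
        _ = _ := by rw [h]; group
  have := key g⁻¹ (inv_mem hg) h' _ ht
  convert this using 1; group

theorem Dih.z_norm (h : Dih p c1 z1 s1) : z1 ∈ Subgroup.normalizer (TT c1 : Set (Perm Ω)) := by
  refine norm_of h.z_aut (Or.inl ?_)
  rw [← h.cz.eq]; simp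

theorem Dih.s_norm (h : Dih p c1 z1 s1) : s1 ∈ Subgroup.normalizer (TT c1 : Set (Perm Ω)) := by
  refine norm_of h.s_aut (Or.inr ?_)
  rw [h.sc]; simp

theorem norm_aut {c g : Perm Ω} (hg : g ∈ Subgroup.normalizer (TT c : Set (Perm Ω))) :
    g ∈ autG c.SameCycle := by
  have key : ∀ g ∈ Subgroup.normalizer (TT c : Set (Perm Ω)), ∀ x y, c.SameCycle x y →
      c.SameCycle (g x) (g y) := by
    rintro g hg x _ ⟨i, rfl⟩
    have := ((Subgroup.mem_normalizer_iff.mp hg _).1 (zpow_mem (self_TT c) i)).2 (g x)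
    simpa using this
  intro x y
  refine ⟨fun h => ?_, key g hg x y⟩
  have := key _ (inv_mem hg) _ _ h
  rwa [invap, invap] at this

variable {Γ : Ω → Ω → Prop} {R : Subgroup (Perm Ω)}

/-- all hypotheses for the first triple -/
structure Base (Γ : Ω → Ω → Prop) (R : Subgroup (Perm Ω)) (p : ℕ) (c z s : Perm Ω) : Prop where
  d : Dih p c z s
  hp : p.Prime
  hp3 : 3 < p
  cG : c ∈ autG Γ
  zG : z ∈ autG Γ
  sG : s ∈ autG Γ
  cR : c ∈ R
  zR : z ∈ R
  sR : s ∈ R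

/-- hypotheses for the second triple -/
structure Snd (Γ : Ω → Ω → Prop) (p : ℕ) (c z s : Perm Ω) : Prop where
  d : Dih p c z s
  cG : c ∈ autG Γ
  zG : z ∈ autG Γ
  sG : s ∈ autG Γ

theorem Snd.conj (h : Snd Γ p c2 z2 s2) {g : Perm Ω} (hg : g ∈ autG Γ) :
    Snd Γ p (g * c2 * g⁻¹) (g * z2 * g⁻¹) (g * s2 * g⁻¹) :=
  ⟨h.d.conj g, mul_mem (mul_mem hg h.cG) (inv_mem hg), mul_mem (mul_mem hg h.zG) (inv_mem hg),
    mul_mem (mul_mem hg h.sG) (inv_mem hg)⟩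

theorem cpow_good [Finite Ω] (h1 : Base Γ R p c1 z1 s1) (h2 : Snd Γ p c2 z2 s2) (o : Ω) {a : ℤ}
    (ha : c2 = c1 ^ a) : Good Γ R c2 z2 s2 := by
  have hd : ¬ (p : ℤ) ∣ a := by
    intro hd
    have e : c2 = 1 := by
      rw [ha, zpow_eq_of_dvd h1.d.hc (i := a) (j := 0) (by simpa using hd)]
      simp
    have := h2.d.c_free 1 o (by rw [e]; simp)
    have h5 := Int.eq_one_of_dvd_one (by positivity) this
    exact h1.hp.one_lt.ne' (by exact_mod_cast h5)
  obtain ⟨m, hm⟩ := zpow_solve h1.hp hd 1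
  have e : c2 ^ m = c1 := by
    rw [ha, ← zpow_mul, mul_comm, zpow_eq_of_dvd h1.d.hc hm, zpow_one]
  have h2' := h2.d.cpow h1.hp m a (by rw [e, ha])
  rw [e] at h2'
  exact (partI h1.hp h1.hp3 h1.d h2' h1.cR h1.zR h1.sR o h1.cG h1.zG h1.sG h2.zG h2.sG).of_cpow a ha

/-- Final step: the block actions of the two triples coincide. -/
theorem partIIb [Finite Ω] (h1 : Base Γ R p c1 z1 s1) (h2 : Snd Γ p c2 z2 s2) (o : Ω)
    (ht : c2 ∈ TT c1) (hzz : ∀ x, c1.SameCycle (z2 x) (z1 x))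
    (hss : ∀ x, c1.SameCycle (s2 x) (s1 x)) : Good Γ R c2 z2 s2 := by
  classical
  have hsame := same_cyc h1.hp h1.d h2.d ht
  have hTT := TT_eq hsame ht
  -- groups
  let H := autG Γ ⊓ Subgroup.normalizer (TT c1 : Set (Perm Ω))
  have z1H : z1 ∈ H := ⟨h1.zG, h1.d.z_norm⟩
  have s1H : s1 ∈ H := ⟨h1.sG, h1.d.s_norm⟩
  have z2H : z2 ∈ H := ⟨h2.zG, by rw [← hTT]; exact h2.d.z_norm⟩
  have s2H : s2 ∈ H := ⟨h2.sG, by rw [← hTT]; exact h2.d.s_norm⟩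
  have z1A := norm_aut z1H.2
  have z2A := norm_aut z2H.2
  have s1A := norm_aut s1H.2
  have s2A := norm_aut s2H.2
  have hzp : ∀ (j : ℤ), toBlk c1 ⟨z2, z2A⟩ ^ j = toBlk c1 ⟨z1, z1A⟩ ^ j := by
    intro j
    have : toBlk c1 ⟨z2, z2A⟩ = toBlk c1 ⟨z1, z1A⟩ := by
      ext q
      obtain ⟨x, rfl⟩ := bk_ind q
      exact bk_eq.mpr (hzz x)
    rw [this]
  have hzj : ∀ (j : ℤ) x, c1.SameCycle ((z2 ^ j) x) ((z1 ^ j) x) := by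
    intro j x
    have := hzp j
    rw [← map_zpow, ← map_zpow] at this
    exact bk_eq.mp (congrArg (fun f : Perm (Blk c1) => f (bk c1 x)) this)
  obtain ⟨a, ha⟩ := TT_pt ht o
  -- equivalence relation
  let st : Setoid Ω := Relation.EqvGen.setoid (fun x y => NU Γ c1 x y ∨ c1.SameCycle x y)
  have st_sc : ∀ x y, c1.SameCycle x y → st.r x y :=
    fun x y h => Relation.EqvGen.rel _ _ (Or.inr h)
  have st_map : ∀ g ∈ H, ∀ x y, st.r x y → st.r (g x) (g y) := by
    intro g hg x y h
    induction h with
    | rel x y h =>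
      rcases h with h | h
      · exact Relation.EqvGen.rel _ _ (Or.inl (h.map hg.1 (norm_aut hg.2)))
      · exact st_sc _ _ ((norm_aut hg.2 _ _).2 h)
    | refl x => exact st.iseqv.refl _
    | symm x y _ ih => exact st.iseqv.symm ih
    | trans x y w _ _ ih1 ih2 => exact st.iseqv.trans ih1 ih2
  have st_a : ∀ x y, st.r x y → ∀ b : ℤ, ((∀ w, c1.SameCycle x w → c2 w = (c1 ^ b) w) ↔
      (∀ w, c1.SameCycle y w → c2 w = (c1 ^ b) w)) := by
    intro x y h
    induction h with
    | rel x y h =>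
      intro b
      rcases h with h | h
      · obtain ⟨ax, hax⟩ := TT_pt ht x
        obtain ⟨ay, hay⟩ := TT_pt ht y
        have hd := L3 h1.hp h1.cG h1.d.hc h2.cG (hax x (SameCycle.refl _ _)) hay h
        have e := zpow_eq_of_dvd h1.d.hc hd
        have aux : ∀ (x : Ω) (ax : ℤ), (∀ w, c1.SameCycle x w → c2 w = (c1 ^ ax) w) →
            ((∀ w, c1.SameCycle x w → c2 w = (c1 ^ b) w) ↔ c1 ^ b = c1 ^ ax) := by
          intro x ax hax
          constructor
          · intro hb
            have e1 := hb x (SameCycle.refl _ _)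
            rw [hax x (SameCycle.refl _ _)] at e1
            refine zpow_eq_of_dvd h1.d.hc (h1.d.c_free _ x ?_)
            rw [sub_eq_neg_add, ← zadd, ← e1, zadd]; simp
          · intro hb
            rw [hb]; exact hax
        rw [aux x ax hax, aux y ay hay, e]
      · constructor
        · intro hh w hw; exact hh w (h.trans hw)
        · intro hh w hw; exact hh w (h.symm.trans hw)
    | refl x => intro b; rfl
    | symm x y _ ih => intro b; exact (ih b).symm
    | trans x y w _ _ ih1 ih2 => intro b; exact (ih1 b).trans (ih2 b)
  -- the local maps
  have loc : ∀ r : Ω, ∃ n : Perm Ω, n ∈ H ∧ (∀ x, c1.SameCycle x (n x)) ∧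
      ∀ x, st.r r x → n (c2 x) = (c1 ^ a) (n x) := by
    intro r
    rcases h1.d.cov o r with ⟨i, j, e⟩ | ⟨i, j, e⟩
    · refine ⟨z1 ^ j * (z2 ^ j)⁻¹, mul_mem (zpow_mem z1H _) (inv_mem (zpow_mem z2H _)), ?_, ?_⟩
      · intro x
        have := hzj j ((z2 ^ j)⁻¹ x)
        rw [apinv] at this
        exact this
      · intro x hx
        have k1 : st.r o ((z2 ^ j)⁻¹ x) := by
          have t1 : st.r ((z2 ^ j)⁻¹ r) ((z2 ^ j)⁻¹ x) := st_map _ (inv_mem (zpow_mem z2H _)) _ _ hx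
          refine st.iseqv.trans (st_sc _ _ ?_) t1
          have t2 : c1.SameCycle ((z2 ^ j) o) r := (hzj j o).trans ⟨i, e.symm⟩
          have := (inv_mem (zpow_mem z2A j) _ _).2 t2
          rwa [invap] at this
        have k2 := (st_a _ _ k1 a).1 ha _ (SameCycle.refl _ _)
        have k3 := h2.d.zc 1 (-j) x
        rw [zpow_one, zpow_neg] at k3
        rw [Perm.mul_apply, Perm.mul_apply, k3, k2, h1.d.zc]
    · refine ⟨z1 ^ j * s1 * (z2 ^ j * s2)⁻¹, mul_mem (mul_mem (zpow_mem z1H _) s1H)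
        (inv_mem (mul_mem (zpow_mem z2H _) s2H)), ?_, ?_⟩
      · intro x
        have := hzj j (s2 ((z2 ^ j * s2)⁻¹ x))
        have t2 := (zpow_mem z1A j _ _).2 (hss ((z2 ^ j * s2)⁻¹ x))
        have t3 := this.trans t2
        have t4 : (z2 ^ j) (s2 ((z2 ^ j * s2)⁻¹ x)) = x := apinv (z2 ^ j * s2) x
        rw [t4] at t3
        exact t3
      · intro x hx
        have k1 : st.r o ((z2 ^ j * s2)⁻¹ x) := by
          have t1 : st.r ((z2 ^ j * s2)⁻¹ r) ((z2 ^ j * s2)⁻¹ x) :=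
            st_map _ (inv_mem (mul_mem (zpow_mem z2H _) s2H)) _ _ hx
          refine st.iseqv.trans (st_sc _ _ ?_) t1
          have t2 : c1.SameCycle ((z2 ^ j * s2) o) r :=
            ((hzj j (s2 o)).trans ((zpow_mem z1A j _ _).2 (hss o))).trans ⟨i, e.symm⟩
          have := (inv_mem (mul_mem (zpow_mem z2A j) s2A) _ _).2 t2
          rwa [invap] at this
        have k2 := pw_pow ((st_a _ _ k1 a).1 ha) (-1) _ (SameCycle.refl _ _)
        have k3 : (z2 ^ j * s2)⁻¹ (c2 x) = (c2 ^ (-1 : ℤ)) ((z2 ^ j * s2)⁻¹ x) := by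
          rw [Perm.inv_eq_iff_eq]
          rw [Perm.mul_apply, h2.d.s_c, h2.d.zc, neg_neg, zpow_one]
          congr 1
          exact (apinv (z2 ^ j * s2) x).symm
        rw [Perm.mul_apply, Perm.mul_apply _ _ x, k3, k2, Perm.mul_apply, Perm.mul_apply,
          h1.d.s_c, h1.d.zc]
        congr 2; ring
  choose n nH nS nc using loc
  have out_r : ∀ x, st.r (Quotient.out (Quotient.mk st x)) x := fun x => Quotient.exact (Quotient.out_eq _)
  obtain ⟨φ, hφ⟩ := exists_glue (fun x => Quotient.mk st x) (fun q => n (Quotient.out q)) (by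
    intro x
    exact Quotient.sound (st_sc _ _ (nS _ x).symm))
  have φS : ∀ x, c1.SameCycle x (φ x) := by
    intro x; rw [hφ]; exact nS _ _
  have φG : φ ∈ autG Γ := by
    intro x y
    by_cases hxy : Quotient.mk st x = Quotient.mk st y
    · rw [hφ, hφ, hxy]; exact (nH _).1 _ _
    · apply not_NU h1.cG _ (φS x) (φS y)
      intro hN
      exact hxy (Quotient.sound (Relation.EqvGen.rel _ _ (Or.inl hN)))
  have φc : φ * c2 * φ⁻¹ = c1 ^ a := by
    rw [mul_inv_eq_iff_eq_mul]
    ext x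
    show φ (c2 x) = (c1 ^ a) (φ x)
    have : Quotient.mk st (c2 x) = Quotient.mk st x := Quotient.sound (st_sc _ _ (ht.2 x).symm)
    rw [hφ, hφ, this]
    exact nc _ _ (out_r x)
  exact Good.of_conj φG (cpow_good h1 (h2.conj φG) o φc)

theorem partII_eqz [Finite Ω] (h1 : Base Γ R p c1 z1 s1) (h2 : Snd Γ p c2 z2 s2) (o : Ω)
    (ht : c2 ∈ TT c1) (hzz : ∀ x, c1.SameCycle (z2 x) (z1 x)) : Good Γ R c2 z2 s2 := by
  have hsame := same_cyc h1.hp h1.d h2.d ht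
  have hTT := TT_eq hsame ht
  have z2A : z2 ∈ autG c1.SameCycle := norm_aut (by rw [← hTT]; exact h2.d.z_norm)
  have s2A : s2 ∈ autG c1.SameCycle := norm_aut (by rw [← hTT]; exact h2.d.s_norm)
  have B1 := h1.d.blk (d := c1) (fun _ _ => Iff.rfl) h1.d.z_aut h1.d.s_aut
  have B2 := h2.d.blk (d := c1) (fun x y => (hsame x y).symm) z2A s2A
  have ez : toBlk c1 ⟨z2, z2A⟩ = toBlk c1 ⟨z1, h1.d.z_aut⟩ := by
    ext q
    obtain ⟨x, rfl⟩ := bk_ind q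
    exact bk_eq.mpr (hzz x)
  rw [ez] at B2
  obtain ⟨i, j, e⟩ := B1.finish B2 (bk c1 o)
  apply Good.of_szmul (-j)
  refine partIIb h1 ⟨h2.d.szmul (-j), h2.cG, h2.zG, mul_mem (zpow_mem h2.zG _) h2.sG⟩ o ht hzz ?_
  intro x
  have e' : toBlk c1 ((⟨z2, z2A⟩ : autG c1.SameCycle) ^ (-j) * ⟨s2, s2A⟩) =
      toBlk c1 ⟨s1, h1.d.s_aut⟩ := by
    rw [map_mul, map_zpow, e, one_zpow, one_mul, ← ez, ← mul_assoc, ← zpow_add]; simp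
  exact bk_eq.mp (congrArg (fun f : Perm (Blk c1) => f (bk c1 x)) e')

end partII
end D6
namespace D6
open Equiv Equiv.Perm
open scoped Pointwise
section partII2
variable {Ω : Type*} {p : ℕ} {c1 z1 s1 c2 z2 s2 : Perm Ω} {Γ : Ω → Ω → Prop}
  {R : Subgroup (Perm Ω)}

theorem Dih.sd_blk (h1 : Dih p c1 z1 s1) (o x : Ω) :
    Sd 1 (toBlk c1 ⟨z1, h1.z_aut⟩) (bk c1 o) (bk c1 x) ↔ Sd c1 z1 o x := by
  constructor
  · rintro ⟨i, j, e⟩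
    rw [one_zpow, Perm.one_apply, ← map_zpow] at e
    obtain ⟨k, hk⟩ := bk_eq.mp e.symm
    exact ⟨k, j, hk.symm⟩
  · rintro ⟨i, j, e⟩
    refine ⟨0, j, ?_⟩
    rw [one_zpow, Perm.one_apply, ← map_zpow]
    symm
    exact bk_eq.mpr ⟨i, e.symm⟩

theorem NU_exp [Finite Ω] (h1 : Base Γ R p c1 z1 s1) (hc2 : c2 ∈ autG Γ) (ht : c2 ∈ TT c1)
    {x y : Ω}
    (h : NU Γ c1 x y ∨ NU Γ c1 y x) {a : ℤ} (ha : ∀ w, c1.SameCycle x w → c2 w = (c1 ^ a) w) :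
    ∀ w, c1.SameCycle y w → c2 w = (c1 ^ a) w := by
  obtain ⟨b, hb⟩ := TT_pt ht y
  have e : c1 ^ a = c1 ^ b := by
    rcases h with h | h
    · exact (zpow_eq_of_dvd h1.d.hc
        (L3 h1.hp h1.cG h1.d.hc hc2 (ha x (SameCycle.refl _ _)) hb h)).symm
    · exact (zpow_eq_of_dvd h1.d.hc
        (L3 h1.hp h1.cG h1.d.hc hc2 (hb y (SameCycle.refl _ _)) ha h))
  rw [e]; exact hb

theorem partII_inv [Finite Ω] (h1 : Base Γ R p c1 z1 s1) (h2 : Snd Γ p c2 z2 s2) (o : Ω)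
    (ht : c2 ∈ TT c1) (hA : ∀ x, Sd c1 z1 o x → c1.SameCycle (z2 x) (z1 x))
    (hB : ∀ x, ¬ Sd c1 z1 o x → c1.SameCycle (z2 x) (z1⁻¹ x)) : Good Γ R c2 z2 s2 := by
  classical
  have hsame := same_cyc h1.hp h1.d h2.d ht
  have hTT := TT_eq hsame ht
  let H := autG Γ ⊓ Subgroup.normalizer (TT c1 : Set (Perm Ω))
  have z1H : z1 ∈ H := ⟨h1.zG, h1.d.z_norm⟩
  have s1H : s1 ∈ H := ⟨h1.sG, h1.d.s_norm⟩
  have z2H : z2 ∈ H := ⟨h2.zG, by rw [← hTT]; exact h2.d.z_norm⟩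
  have s2H : s2 ∈ H := ⟨h2.sG, by rw [← hTT]; exact h2.d.s_norm⟩
  have z1A := norm_aut z1H.2
  have z2A := norm_aut z2H.2
  have s2A := norm_aut s2H.2
  have B1 := h1.d.blk (d := c1) (fun _ _ => Iff.rfl) h1.d.z_aut h1.d.s_aut
  have B2 := h2.d.blk (d := c1) (fun x y => (hsame x y).symm) z2A s2A
  obtain ⟨-, -, bs2A, bs2B, bs1A, bs1B, bs2z⟩ := B1.side_swap B2 (bk c1 o)
    (by
      intro q hq
      obtain ⟨x, rfl⟩ := bk_ind q
      exact bk_eq.mpr (hA x ((h1.d.sd_blk o x).1 hq)))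
    (by
      intro q hq
      obtain ⟨x, rfl⟩ := bk_ind q
      rw [← map_inv]
      exact bk_eq.mpr (hB x (fun h => hq ((h1.d.sd_blk o x).2 h))))
  let A := fun x => Sd c1 z1 o x
  have Adef : ∀ x, Sd 1 (toBlk c1 ⟨z1, h1.d.z_aut⟩) (bk c1 o) (bk c1 x) ↔ A x := h1.d.sd_blk o
  have s2S : ∀ x, A (s2 x) ↔ ¬ A x := by
    intro x
    constructor
    · intro h hx; exact bs2A (bk c1 x) ((Adef x).2 hx) ((Adef (s2 x)).2 h)
    · intro h; exact (Adef (s2 x)).1 (bs2B (bk c1 x) (fun hx => h ((Adef x).1 hx)))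
  have s1S : ∀ x, A (s1 x) ↔ ¬ A x := by
    intro x
    constructor
    · intro h hx; exact bs1A (bk c1 x) ((Adef x).2 hx) ((Adef (s1 x)).2 h)
    · intro h; exact (Adef (s1 x)).1 (bs1B (bk c1 x) (fun hx => h ((Adef x).1 hx)))
  have s2z : ∀ x, c1.SameCycle (s2 (z1 x)) (z1 (s2 x)) := by
    intro x
    have := bs2z 1 (bk c1 x)
    rw [zpow_one] at this
    exact bk_eq.mp this
  have A_sc : ∀ x y, c1.SameCycle x y → (A x ↔ A y) := by
    intro x y h
    rw [← Adef, ← Adef, bk_eq.mpr h]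
  have Az : ∀ (i : ℤ) x, A ((z1 ^ i) x) ↔ A x := by
    intro i x
    constructor
    · intro h; exact h1.d.sd_trans h (h1.d.sd_symm ⟨0, i, by simp⟩)
    · intro h; exact h1.d.sd_trans h ⟨0, i, by simp⟩
  have z2S : ∀ x, A (z2 x) ↔ A x := by
    intro x
    by_cases hx : A x
    · rw [A_sc _ _ (hA x hx)]; simpa using Az 1 x
    · rw [A_sc _ _ (hB x hx)]; simpa using Az (-1) x
  have z2iA : ∀ x, A x → c1.SameCycle (z2⁻¹ x) (z1⁻¹ x) := by
    intro x hx
    have e1 := hA (z1⁻¹ x) (by have := Az (-1) x; rw [zpow_neg_one] at this; exact this.2 hx)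
    have := (inv_mem z2A _ _).2 e1
    rw [invap, apinv] at this
    exact this.symm
  have z2iB : ∀ x, ¬ A x → c1.SameCycle (z2⁻¹ x) (z1 x) := by
    intro x hx
    have e1 := hB (z1 x) (by have := Az 1 x; rw [zpow_one] at this; exact fun h => hx (this.1 h))
    have := (inv_mem z2A _ _).2 e1
    rw [invap, invap] at this
    exact this.symm
  -- moving elements
  have zz : ∀ x, (z1 ^ (2 : ℤ)) x = z1 (z1 x) := fun x => rfl
  have pw : ∀ (w : Perm Ω), w ∈ autG c1.SameCycle → ∀ B : Ω → Prop, (∀ (i : ℤ) x, B ((z1 ^ i) x) ↔ B x) →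
      (∀ x, B x → c1.SameCycle (w x) ((z1 ^ (2 : ℤ)) x)) → ∀ k : ℕ, ∀ x, B x →
      c1.SameCycle ((w ^ k) x) ((z1 ^ (2 * k : ℤ)) x) := by
    intro w hw B hBz hB2 k x hx
    induction k with
    | zero => simpa using SameCycle.refl _ _
    | succ k ih =>
      rw [pow_succ', Perm.mul_apply]
      refine ((hw _ _).2 ih).trans ?_
      refine (hB2 _ ((hBz _ _).2 hx)).trans ?_
      rw [zadd]
      have : (2 : ℤ) + 2 * k = 2 * ((k + 1 : ℕ) : ℤ) := by push_cast; ring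
      rw [this]
  have pw1 : ∀ (w : Perm Ω), w ∈ autG c1.SameCycle → ∀ B : Ω → Prop,
      (∀ x, B x → c1.SameCycle (w x) x) → ∀ k : ℕ, ∀ x, B x →
      c1.SameCycle ((w ^ k) x) x := by
    intro w hw B hB2 k x hx
    induction k with
    | zero => simpa using SameCycle.refl _ _
    | succ k ih =>
      rw [pow_succ', Perm.mul_apply]
      exact ((hw _ _).2 ih).trans (hB2 _ hx)
  have kk : ∀ x x', Sd c1 z1 x x' → ∃ k : ℕ, c1.SameCycle ((z1 ^ (2 * k : ℤ)) x) x' := by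
    rintro x _ ⟨i, j, rfl⟩
    refine ⟨(2 * j % 3).toNat, ?_⟩
    have : z1 ^ (2 * ((2 * j % 3).toNat : ℤ)) = z1 ^ j := by
      apply zpow_eq_of_dvd h1.d.hz
      push_cast
      omega
    rw [this]
    exact sc_zpow _ _ _
  have moveA : ∀ x x', A x → A x' → ∃ g ∈ H, c1.SameCycle (g x) x' ∧
      ∀ y, ¬ A y → c1.SameCycle (g y) y := by
    intro x x' hx hx'
    obtain ⟨k, hk⟩ := kk x x' (h1.d.sd_trans (h1.d.sd_symm hx) hx')
    refine ⟨(z1 * z2) ^ k, pow_mem (mul_mem z1H z2H) k, ?_, ?_⟩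
    · refine (pw (z1 * z2) (mul_mem z1A z2A) A Az ?_ k x hx).trans hk
      intro x hx
      rw [zz]
      exact (z1A _ _).2 (hA x hx)
    · intro y hy
      refine pw1 (z1 * z2) (mul_mem z1A z2A) (fun y => ¬ A y) ?_ k y hy
      intro y hy
      have := (z1A _ _).2 (hB y hy)
      rwa [apinv] at this
  have moveB : ∀ x x', ¬ A x → ¬ A x' → ∃ g ∈ H, c1.SameCycle (g x) x' ∧
      ∀ y, A y → c1.SameCycle (g y) y := by
    intro x x' hx hx'
    obtain ⟨k, hk⟩ := kk x x' (h1.d.sd_two hx hx')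
    refine ⟨(z1 * z2⁻¹) ^ k, pow_mem (mul_mem z1H (inv_mem z2H)) k, ?_, ?_⟩
    · refine (pw (z1 * z2⁻¹) (mul_mem z1A (inv_mem z2A)) (fun x => ¬ A x)
        (fun i x => not_congr (Az i x)) ?_ k x hx).trans hk
      intro x hx
      rw [zz]
      exact (z1A _ _).2 (z2iB x hx)
    · intro y hy
      refine pw1 (z1 * z2⁻¹) (mul_mem z1A (inv_mem z2A)) A ?_ k y hy
      intro y hy
      have := (z1A _ _).2 (z2iA y hy)
      rwa [apinv] at this
  have N2map : ∀ g ∈ H, ∀ x y x' y', (NU Γ c1 x y ∨ NU Γ c1 y x) → c1.SameCycle (g x) x' →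
      c1.SameCycle (g y) y' → (NU Γ c1 x' y' ∨ NU Γ c1 y' x') := by
    intro g hg x y x' y' h hx hy
    rcases h with h | h
    · exact Or.inl ((h.map hg.1 (norm_aut hg.2)).lr h1.cG hx hy)
    · exact Or.inr ((h.map hg.1 (norm_aut hg.2)).lr h1.cG hy hx)
  by_cases hN : ∃ x y, A x ∧ ¬ A y ∧ (NU Γ c1 x y ∨ NU Γ c1 y x)
  · obtain ⟨x, y, hx, hy, hxy⟩ := hN
    obtain ⟨a, ha⟩ := TT_pt ht x
    have hay := NU_exp h1 h2.cG ht hxy ha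
    refine cpow_good h1 h2 o (a := a) ?_
    ext v
    by_cases hv : A v
    · obtain ⟨g, hg, g1, g2⟩ := moveA x v hx hv
      have := N2map g hg x y v y hxy g1 (g2 y hy)
      exact NU_exp h1 h2.cG ht this.symm hay v (SameCycle.refl _ _)
    · obtain ⟨g, hg, g1, g2⟩ := moveB y v hy hv
      have := N2map g hg x y x v hxy (g2 x hx) g1
      exact NU_exp h1 h2.cG ht this ha v (SameCycle.refl _ _)
  · have hN' : ∀ x y, A x → ¬ A y → ¬ NU Γ c1 x y ∧ ¬ NU Γ c1 y x := by
      intro x y hx hy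
      constructor
      · intro h; exact hN ⟨x, y, hx, hy, Or.inl h⟩
      · intro h; exact hN ⟨x, y, hx, hy, Or.inr h⟩
    let n := s2 * s1
    have nH : n ∈ H := mul_mem s2H s1H
    have nA := norm_aut nH.2
    have nS : ∀ x, A (n x) ↔ A x := by
      intro x
      show A (s2 (s1 x)) ↔ A x
      rw [s2S, s1S, not_not]
    obtain ⟨φ, hφ⟩ := exists_glue (fun x => decide (A x)) (fun b => if b then 1 else n) (by
      intro x
      by_cases hx : A x
      · simp [hx]
      · simp [hx, nS])
    have φA : ∀ x, A x → φ x = x := by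
      intro x hx; rw [hφ]; simp [hx]
    have φB : ∀ x, ¬ A x → φ x = n x := by
      intro x hx; rw [hφ]; simp [hx]
    have φS : ∀ x, A (φ x) ↔ A x := by
      intro x
      by_cases hx : A x
      · rw [φA x hx]
      · rw [φB x hx, nS]
    have φG : φ ∈ autG Γ := by
      intro x y
      by_cases hx : A x <;> by_cases hy : A y
      · rw [φA x hx, φA y hy]
      · rw [φA x hx, φB y hy]
        obtain ⟨g, hg, g1, g2⟩ := moveA (n x) x ((nS x).2 hx) hx
        rw [← nH.1 x y, ← hg.1 (n x) (n y)]
        exact (not_NU h1.cG (hN' _ _ hx (fun h => hy ((nS y).1 h))).1 g1.symm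
          (g2 _ (fun h => hy ((nS y).1 h))).symm).symm
      · rw [φB x hx, φA y hy]
        obtain ⟨g, hg, g1, g2⟩ := moveA (n y) y ((nS y).2 hy) hy
        rw [← nH.1 x y, ← hg.1 (n x) (n y)]
        exact (not_NU h1.cG (hN' _ _ hy (fun h => hx ((nS x).1 h))).2
          (g2 _ (fun h => hx ((nS x).1 h))).symm g1.symm).symm
      · rw [φB x hx, φB y hy]; exact nH.1 _ _
    apply Good.of_conj φG
    have hcA : ∀ x, A (c1 x) ↔ A x := fun x => (A_sc _ _ ((self_TT c1).2 x)).symm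
    have hcA2 : ∀ x, A (c2 x) ↔ A x := fun x => (A_sc _ _ (ht.2 x)).symm
    have φiS : ∀ x, A (φ⁻¹ x) ↔ A x := by
      intro x; rw [← φS, apinv]
    have t2 : n * c2 * n⁻¹ ∈ TT c1 := (Subgroup.mem_normalizer_iff.mp nH.2 _).1 ht
    have eA : ∀ x, A x → (φ * c2 * φ⁻¹) x = c2 x := by
      intro x hx
      have e1 : φ⁻¹ x = x := by rw [Perm.inv_eq_iff_eq, φA x hx]
      rw [Perm.mul_apply, Perm.mul_apply, e1, φA _ ((hcA2 x).2 hx)]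
    have eB : ∀ x, ¬ A x → (φ * c2 * φ⁻¹) x = (n * c2 * n⁻¹) x := by
      intro x hx
      have hnx : ¬ A (n⁻¹ x) := by rw [← nS, apinv]; exact hx
      have e1 : φ⁻¹ x = n⁻¹ x := by rw [Perm.inv_eq_iff_eq, φB _ hnx, apinv]
      rw [Perm.mul_apply, Perm.mul_apply, e1, φB _ (by rwa [hcA2])]; rfl
    refine partII_eqz h1 (h2.conj φG) o ⟨?_, ?_⟩ ?_
    · ext x
      show (φ * c2 * φ⁻¹) (c1 x) = c1 ((φ * c2 * φ⁻¹) x)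
      by_cases hx : A x
      · rw [eA x hx, eA _ ((hcA x).2 hx)]
        exact congrArg (fun f : Perm Ω => f x) ht.1.eq
      · rw [eB x hx, eB _ (by rwa [hcA])]
        exact congrArg (fun f : Perm Ω => f x) t2.1.eq
    · intro x
      by_cases hx : A x
      · rw [eA x hx]; exact ht.2 x
      · rw [eB x hx]; exact t2.2 x
    · intro x
      obtain ⟨y, rfl⟩ : ∃ y, φ y = x := ⟨φ⁻¹ x, apinv _ _⟩
      rw [Perm.mul_apply, Perm.mul_apply, invap]
      by_cases hy : A y
      · rw [φA y hy, φA _ ((z2S y).2 hy)]; exact hA y hy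
      · rw [φB y hy, φB _ (by rwa [z2S])]
        refine ((nA _ _).2 (hB y hy)).trans ?_
        show c1.SameCycle (s2 (s1 (z1⁻¹ y))) (z1 (s2 (s1 y)))
        have := h1.d.s_z (-1) y
        rw [zpow_neg_one, neg_neg, zpow_one] at this
        rw [this]
        exact s2z _

theorem partII [Finite Ω] (h1 : Base Γ R p c1 z1 s1) (h2 : Snd Γ p c2 z2 s2) (o : Ω)
    (ht : c2 ∈ TT c1) : Good Γ R c2 z2 s2 := by
  have hsame := same_cyc h1.hp h1.d h2.d ht
  have hTT := TT_eq hsame ht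
  let H := autG Γ ⊓ Subgroup.normalizer (TT c1 : Set (Perm Ω))
  have z1H : z1 ∈ H := ⟨h1.zG, h1.d.z_norm⟩
  have z2H : z2 ∈ H := ⟨h2.zG, by rw [← hTT]; exact h2.d.z_norm⟩
  obtain ⟨h, hh, Q, hQH, hQ, hzQ, hzQ2⟩ := sylow_conj H 3 Nat.prime_three
    (x := z1) (y := z2) (n := 1) (m := 1) z1H z2H
    (by simpa using h1.d.hz) (by simpa using h2.d.hz)
  apply Good.of_conj hh.1
  have h2' := h2.conj hh.1
  have ht' : h * c2 * h⁻¹ ∈ TT c1 := (Subgroup.mem_normalizer_iff.mp hh.2 _).1 ht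
  clear hsame hTT z2H
  generalize h * c2 * h⁻¹ = c2' at *
  generalize h * z2 * h⁻¹ = z2' at *
  generalize h * s2 * h⁻¹ = s2' at *
  have hsame := same_cyc h1.hp h1.d h2'.d ht'
  have hTT := TT_eq hsame ht'
  have z2A : z2' ∈ autG c1.SameCycle := norm_aut (by rw [← hTT]; exact h2'.d.z_norm)
  have s2A : s2' ∈ autG c1.SameCycle := norm_aut (by rw [← hTT]; exact h2'.d.s_norm)
  have B1 := h1.d.blk (d := c1) (fun _ _ => Iff.rfl) h1.d.z_aut h1.d.s_aut
  have B2 := h2'.d.blk (d := c1) (fun x y => (hsame x y).symm) z2A s2A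
  have hcomm : Commute (toBlk c1 ⟨z1, h1.d.z_aut⟩) (toBlk c1 ⟨z2', z2A⟩) := by
    ext q
    obtain ⟨x, rfl⟩ := bk_ind q
    exact bk_eq.mpr (comm3 (h1.d.card_blk o) hQ (fun g hg => norm_aut (hQH hg).2) hzQ hzQ2 x)
  obtain ⟨z', hz', hcase⟩ := B1.side_lemma B2 (by simpa using isCoprime_one_left) hcomm (bk c1 o)
  obtain ⟨z3, hz3, z3A, e3⟩ : ∃ z3, (z3 = z2' ∨ z3 = z2'⁻¹) ∧ ∃ h : z3 ∈ autG c1.SameCycle,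
      z' = toBlk c1 ⟨z3, h⟩ := by
    rcases hz' with rfl | rfl
    · exact ⟨z2', Or.inl rfl, z2A, rfl⟩
    · exact ⟨z2'⁻¹, Or.inr rfl, inv_mem z2A, by rw [← map_inv]; rfl⟩
  suffices hgood : Good Γ R c2' z3 s2' by
    rcases hz3 with rfl | rfl
    · exact hgood
    · exact hgood.of_zinv
  have h3 : Snd Γ p c2' z3 s2' := by
    rcases hz3 with rfl | rfl
    · exact h2'
    · exact ⟨h2'.d.zinv, h2'.cG, inv_mem h2'.zG, h2'.sG⟩
  subst e3
  rcases hcase with hc | ⟨hA, hB⟩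
  · refine partII_eqz h1 h3 o ht' ?_
    intro x
    exact bk_eq.mp (congrArg (fun f : Perm (Blk c1) => f (bk c1 x)) hc)
  · refine partII_inv h1 h3 o ht' ?_ ?_
    · intro x hx
      exact bk_eq.mp (hA (bk c1 x) ((h1.d.sd_blk o x).2 hx))
    · intro x hx
      have := hB (bk c1 x) (fun h => hx ((h1.d.sd_blk o x).1 h))
      rw [← map_inv] at this
      exact bk_eq.mp this

end partII2
end D6
namespace D6
open Equiv Equiv.Perm
open scoped Pointwise

section sylow
variable {Ω : Type*} {p : ℕ} {c1 z1 s1 c2 z2 s2 : Perm Ω} {Γ : Ω → Ω → Prop}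
  {R : Subgroup (Perm Ω)}

theorem Dih.TT_of_pgroup [Finite Ω] (hp : p.Prime) (h1 : Dih p c1 z1 s1)
    {P : Subgroup (Perm Ω)} (hP : IsPGroup p P) (c1P : c1 ∈ P) (c2P : c2 ∈ P)
    (hfix : ∀ g ∈ P, ∀ x, c1.SameCycle x (g x)) : c2 ∈ TT c1 := by
  refine ⟨?_, hfix _ c2P⟩
  ext x
  obtain ⟨k, hk⟩ := L1 hp hP c1P h1.hc (x := x) (fun i => h1.c_free i x)
    (fun g hg => hfix g hg x) c2P
  have e0 := hk 0
  have e1 := hk 1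
  simp only [zpow_zero, zpow_one, Perm.one_apply, add_zero] at e0 e1
  show c2 (c1 x) = c1 (c2 x)
  rw [e1, e0, add_comm, zpow_add, zpow_one]; rfl

/-- Permutations preserving every orbit of `c`. -/
def Kr (c : Perm Ω) : Subgroup (Perm Ω) where
  carrier := {g | ∀ x, c.SameCycle x (g x)}
  mul_mem' := by
    intro a b ha hb x
    exact (hb x).trans (ha (b x))
  one_mem' := fun x => SameCycle.refl _ _
  inv_mem' := by
    intro a ha x
    have := ha (a⁻¹ x)
    rw [apinv] at this
    exact this.symm

theorem mem_Kr {c g : Perm Ω} : g ∈ Kr c ↔ ∀ x, c.SameCycle x (g x) := Iff.rfl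

theorem self_Kr (c : Perm Ω) : c ∈ Kr c := (self_TT c).2

theorem same_good [Finite Ω] (h1 : Base Γ R p c1 z1 s1) (h2 : Snd Γ p c2 z2 s2) (o : Ω)
    (hs : ∀ x, c1.SameCycle x (c2 x)) : Good Γ R c2 z2 s2 := by
  obtain ⟨h, hh, P, hPH, hP, hcP, hcP2⟩ := sylow_conj (autG Γ ⊓ Kr c1) p h1.hp
    (x := c1) (y := c2) (n := 1) (m := 1) ⟨h1.cG, self_Kr c1⟩ ⟨h2.cG, hs⟩
    (by simpa using h1.d.hc) (by simpa using h2.d.hc)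
  apply Good.of_conj hh.1
  exact partII h1 (h2.conj hh.1) o
    (h1.d.TT_of_pgroup h1.hp hP hcP hcP2 (fun g hg => (hPH hg).2))

theorem mover [Finite Ω] (hp : p.Prime) {c : Perm Ω} (hcp : c ^ p = 1)
    {P : Subgroup (Perm Ω)} (hP : IsPGroup p P) (cP : c ∈ P)
    (hmv : ¬ P ≤ Kr c) : ∃ q ∈ P, q ∈ autG c.SameCycle ∧ q ∉ Kr c ∧
      ((∀ g ∈ P, g ∈ Kr c → ∃ k : ℤ, g = c ^ k) → Commute q c) := by
  have := Fact.mk hp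
  let K : Subgroup P := (Kr c).subgroupOf P
  have hK : K < ⊤ := by
    rw [lt_top_iff_ne_top]
    intro e
    apply hmv
    exact Subgroup.subgroupOf_eq_top.mp e
  have := hP.isNilpotent
  have hn := Group.normalizerCondition_of_isNilpotent (G := P) K hK
  obtain ⟨q, hq, hqK⟩ := SetLike.exists_of_lt hn
  have hqn := Subgroup.mem_normalizer_iff.mp hq
  have hcj : ∀ g ∈ P, g ∈ Kr c → q.1 * g * (q.1)⁻¹ ∈ Kr c := by
    intro g hg hgK
    have := (hqn ⟨g, hg⟩).1 (Subgroup.mem_subgroupOf.mpr hgK)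
    exact Subgroup.mem_subgroupOf.mp this
  have hcj' : ∀ g ∈ P, g ∈ Kr c → (q.1)⁻¹ * g * (q.1) ∈ Kr c := by
    intro g hg hgK
    have := (Subgroup.mem_normalizer_iff.mp (inv_mem hq) ⟨g, hg⟩).1 (Subgroup.mem_subgroupOf.mpr hgK)
    rw [inv_inv] at this
    exact Subgroup.mem_subgroupOf.mp this
  refine ⟨q.1, q.2, ?_, ?_, ?_⟩
  · intro x y
    constructor
    · rintro ⟨i, hi⟩
      have h2 := hcj' (c ^ i) (zpow_mem cP i) (zpow_mem (self_Kr c) i) x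
      rw [Perm.mul_apply, Perm.mul_apply, hi, invap] at h2
      exact h2
    · rintro ⟨i, rfl⟩
      have h2 := hcj (c ^ i) (zpow_mem cP i) (zpow_mem (self_Kr c) i) (q.1 x)
      rw [Perm.mul_apply, Perm.mul_apply, invap] at h2
      exact h2
  · intro h; exact hqK (Subgroup.mem_subgroupOf.mpr h)
  · intro hall
    obtain ⟨a, ha⟩ := hall _ (mul_mem (mul_mem q.2 cP) (inv_mem q.2)) (hcj c cP (self_Kr c))
    have hsc : SemiconjBy q.1 c (c ^ a) := by
      show q.1 * c = c ^ a * q.1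
      rw [← ha]; group
    have hpw : ∀ n : ℕ, SemiconjBy (q.1 ^ n) c (c ^ (a ^ n)) := by
      intro n
      induction n with
      | zero => simp
      | succ n ih =>
        have h1 := hsc.zpow_right (a ^ n)
        rw [← zpow_mul] at h1
        rw [pow_succ', pow_succ']
        exact h1.mul_left ih
    obtain ⟨n, hn⟩ := hP q
    have hq1 : q.1 ^ p ^ n = 1 := by
      have := congrArg Subtype.val hn
      simpa using this
    have h3 := hpw (p ^ n)
    rw [hq1] at h3
    have h4 : c = c ^ (a ^ p ^ n) := by
      have := h3.eq
      simpa using this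
    have h5 : (p : ℤ) ∣ a ^ p ^ n - a := by
      rw [← (ZMod.intCast_zmod_eq_zero_iff_dvd _ p)]
      push_cast
      rw [ZMod.pow_card_pow, sub_self]
    rw [zpow_eq_of_dvd hcp h5] at h4
    rw [← h4] at hsc
    exact hsc

/-- A p-element moving blocks forces p = 5, and acts as a 5-cycle on the blocks. -/
theorem five_of_move [Finite Ω] {c : Perm Ω} (hp : p.Prime) (hp3 : 3 < p)
    (hcard : Nat.card (Blk c) = 6) {q : Perm Ω}
    {n : ℕ} (hq : q ^ p ^ n = 1) (hqA : q ∈ autG c.SameCycle) (hqK : q ∉ Kr c) :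
    p = 5 ∧ ∃ x0, c.SameCycle x0 (q x0) ∧
      (∀ x, ¬ c.SameCycle x0 x → ¬ c.SameCycle x (q x)) ∧
      (∀ x, c.SameCycle x ((q ^ 5) x)) ∧
      ∀ x y, ¬ c.SameCycle x0 x → ¬ c.SameCycle x0 y → ∃ i : ℕ, i < 5 ∧ c.SameCycle ((q ^ i) x) y := by
  classical
  have := Fact.mk hp
  have : Finite (Blk c) := Nat.finite_of_card_ne_zero (by omega)
  have : Fintype (Blk c) := Fintype.ofFinite _
  have hc6 : Fintype.card (Blk c) = 6 := by rw [← Nat.card_eq_fintype_card]; exact hcard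
  set π := toBlk c ⟨q, hqA⟩ with hπ
  have hπ1 : π ≠ 1 := by
    intro e
    apply hqK
    intro x
    have : π (bk c x) = bk c x := by rw [e]; rfl
    rw [hπ, toBlk_bk, bk_eq] at this
    exact this.symm
  have hπn : π ^ p ^ n = 1 := by
    rw [hπ, ← map_pow]
    have : (⟨q, hqA⟩ : autG c.SameCycle) ^ p ^ n = 1 := by ext1; simpa using hq
    rw [this, map_one]
  have hd1 : orderOf π ∣ p ^ n := orderOf_dvd_of_pow_eq_one hπn
  have hd2 : orderOf π ∣ 720 := by
    have := orderOf_dvd_card (x := π)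
    rw [Fintype.card_perm, hc6] at this
    exact this
  obtain ⟨k, hk, hk'⟩ := (Nat.dvd_prime_pow hp).mp hd1
  have hk0 : k ≠ 0 := by
    rintro rfl
    rw [pow_zero, orderOf_eq_one_iff] at hk'
    exact hπ1 hk'
  have hpd : p ∣ 720 := (dvd_pow_self p hk0).trans (hk' ▸ hd2)
  have hp5 : p = 5 := by
    have h1 : p ∣ 2 ^ 4 * (3 ^ 2 * 5) := hpd
    rcases hp.dvd_mul.mp h1 with h | h
    · have := (Nat.prime_dvd_prime_iff_eq hp Nat.prime_two).mp (hp.dvd_of_dvd_pow h); omega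
    · rcases hp.dvd_mul.mp h with h | h
      · have := (Nat.prime_dvd_prime_iff_eq hp Nat.prime_three).mp (hp.dvd_of_dvd_pow h); omega
      · exact (Nat.prime_dvd_prime_iff_eq hp (by norm_num)).mp h
  subst hp5
  have hk1 : k = 1 := by
    by_contra hne
    have h2 : 2 ≤ k := by omega
    have : 5 ^ 2 ∣ 720 := (pow_dvd_pow 5 h2).trans (hk' ▸ hd2)
    omega
  have ho : orderOf π = 5 := by rw [hk', hk1]; norm_num
  have hcyc : π.IsCycle := isCycle_of_prime_order (by rw [ho]; norm_num)
    (by rw [ho]; have := Finset.card_le_univ π.support; omega)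
  have hsup : π.support.card = 5 := by rw [← hcyc.orderOf, ho]
  have hcomp : (π.supportᶜ).card = 1 := by rw [Finset.card_compl, hsup, hc6]
  obtain ⟨b0, hb0⟩ := Finset.card_eq_one.mp hcomp
  have hfx : ∀ b, π b = b ↔ b = b0 := by
    intro b
    have : b ∈ π.supportᶜ ↔ b = b0 := by rw [hb0]; simp
    rw [← this]; simp
  obtain ⟨x0, rfl⟩ := bk_ind b0
  have hqb : ∀ i : ℕ, ∀ x, (π ^ i) (bk c x) = bk c ((q ^ i) x) := by
    intro i x
    rw [hπ, ← map_pow]; rfl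
  refine ⟨rfl, x0, ?_, ?_, ?_, ?_⟩
  · have := (hfx _).2 rfl
    have e : π (bk c x0) = bk c (q x0) := rfl
    rw [e, bk_eq] at this; exact this.symm
  · intro x hx h
    apply hx
    have : π (bk c x) = bk c x := bk_eq.mpr h.symm
    exact (bk_eq.mp ((hfx _).1 this)).symm
  · intro x
    have := hqb 5 x
    rw [← ho, pow_orderOf_eq_one, ho] at this
    exact bk_eq.mp this
  · intro x y hx hy
    have h1 : π (bk c x) ≠ bk c x := fun h => hx (bk_eq.mp ((hfx _).1 h)).symm
    have h2 : π (bk c y) ≠ bk c y := fun h => hy (bk_eq.mp ((hfx _).1 h)).symm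
    obtain ⟨i, hi⟩ := (hcyc.sameCycle h1 h2).exists_pow_eq'
    refine ⟨i, ?_, ?_⟩
    · rw [← ho]; exact hi.1
    · rw [← bk_eq, ← hqb]; exact hi.2

end sylow
end D6
namespace D6
open Equiv Equiv.Perm
open scoped Pointwise

section grid
variable {Ω : Type*} {c z s : Perm Ω} {Γ : Ω → Ω → Prop}

theorem exists_off {p : ℕ} (h : Dih p c z s) :
    ∃ off : Ω → ZMod p, ∀ (i : ℤ) x, off ((c ^ i) x) = off x + i := by
  choose rp hrp using (bk_ind (c := c))
  have h1 : ∀ x, ∃ i : ℤ, (c ^ i) (rp (bk c x)) = x := fun x => bk_eq.mp (hrp (bk c x))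
  choose f hf using h1
  refine ⟨fun x => (f x : ZMod p), fun i x => ?_⟩
  have e : bk c ((c ^ i) x) = bk c x := bk_eq.mpr (sc_zpow c i x).symm
  have h2 := hf ((c ^ i) x)
  rw [e] at h2
  have h3 : (c ^ (f ((c ^ i) x) - (f x + i))) x = x := by
    have : (c ^ (f ((c ^ i) x) - (f x + i))) ((c ^ (f x)) (rp (bk c x)))
        = (c ^ (-i)) ((c ^ (f ((c ^ i) x))) (rp (bk c x))) := by
      rw [zadd, zadd]; congr 2; ring
    rw [hf x, h2, zadd] at this
    simpa using this
  have h4 := h.c_free _ _ h3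
  rw [← ZMod.intCast_zmod_eq_zero_iff_dvd] at h4
  push_cast at h4
  exact sub_eq_zero.mp h4

/-- A representative of each block. -/
noncomputable def rp (b : Blk c) : Ω := (bk_ind b).choose

theorem bk_rp (b : Blk c) : bk c (rp b) = b := (bk_ind b).choose_spec

variable {off : Ω → ZMod 5}

theorem comm_ap {g : Perm Ω} (hg : Commute g c) (i : ℤ) (x : Ω) : g ((c ^ i) x) = (c ^ i) (g x) :=
  congrArg (fun f : Perm Ω => f x) (hg.zpow_right i).eq

theorem dl_sc (hoff : ∀ (i : ℤ) x, off ((c ^ i) x) = off x + i) {g : Perm Ω} (hg : Commute g c)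
    {x y : Ω} (h : c.SameCycle x y) : off (g x) - off x = off (g y) - off y := by
  obtain ⟨i, rfl⟩ := h
  rw [comm_ap hg, hoff, hoff]; ring

/-- Total displacement. -/
noncomputable def dt (c : Perm Ω) [Fintype (Blk c)] (off : Ω → ZMod 5) (g : Perm Ω) : ZMod 5 :=
  ∑ b : Blk c, (off (g (rp b)) - off (rp b))

theorem kernel_c {p : ℕ} (hp : p.Prime) (h : Dih p c z s) (o : Ω) (hcG : c ∈ autG Γ)
    (hN : ∀ x y, ¬ c.SameCycle x y → NU Γ c x y)
    {g : Perm Ω} (hg : g ∈ autG Γ) (hgT : g ∈ TT c) : ∃ j : ℤ, g = c ^ j := by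
  obtain ⟨a, ha⟩ := TT_pt hgT o
  refine ⟨a, ?_⟩
  ext y
  by_cases hy : c.SameCycle o y
  · exact ha y hy
  · obtain ⟨b, hb⟩ := TT_pt hgT y
    have := L3 hp hcG h.hc hg (ha o (SameCycle.refl _ _)) hb (hN o y hy)
    rw [hb y (SameCycle.refl _ _), zpow_eq_of_dvd h.hc this]

theorem comm_pow {g : Perm Ω} (hg : Commute g c) {x : Ω} {k : ℤ} (e : g x = (c ^ k) x) (m : ℕ) :
    (g ^ m) x = (c ^ (k * m)) x := by
  induction m with
  | zero => simp
  | succ m ih =>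
    rw [pow_succ', Perm.mul_apply, ih, comm_ap hg, e, zadd]
    congr 2; push_cast; ring

variable [Fintype (Blk c)]

theorem dt_mul (hoff : ∀ (i : ℤ) x, off ((c ^ i) x) = off x + i) {g k : Perm Ω}
    (hg : Commute g c) (hk : Commute k c) : dt c off (g * k) = dt c off g + dt c off k := by
  have e1 : dt c off (g * k) = ∑ b : Blk c, (off (g (k (rp b))) - off (k (rp b))) + dt c off k := by
    rw [dt, dt, ← Finset.sum_add_distrib]
    refine Finset.sum_congr rfl fun b _ => ?_
    rw [Perm.mul_apply]; ring
  rw [e1]; congr 1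
  rw [dt]
  refine Fintype.sum_equiv (toBlk c ⟨k, autG_comm hk⟩) _ _ fun b => ?_
  refine dl_sc hoff hg ?_
  rw [← bk_eq, bk_rp]
  have : bk c (k (rp b)) = toBlk c ⟨k, autG_comm hk⟩ (bk c (rp b)) := rfl
  rw [this, bk_rp]

theorem dt_one : dt c off 1 = 0 := by simp [dt]

theorem dt_cpow (hcard : Nat.card (Blk c) = 6)
    (hoff : ∀ (i : ℤ) x, off ((c ^ i) x) = off x + i) (i : ℤ) : dt c off (c ^ i) = i := by
  have : dt c off (c ^ i) = ∑ b : Blk c, (i : ZMod 5) := by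
    refine Finset.sum_congr rfl fun b _ => ?_
    rw [hoff]; ring
  rw [this, Finset.sum_const, Finset.card_univ, ← Nat.card_eq_fintype_card, hcard, nsmul_eq_mul]
  have : ((6 : ℕ) : ZMod 5) = 1 := by decide
  rw [this, one_mul]

/-- The complement of `⟨c⟩` in its centralizer. -/
noncomputable def NN (Γ : Ω → Ω → Prop) (hoff : ∀ (i : ℤ) x, off ((c ^ i) x) = off x + i) :
    Subgroup (Perm Ω) where
  carrier := {g | g ∈ autG Γ ∧ Commute g c ∧ dt c off g = 0}
  mul_mem' := by
    rintro a b ⟨ha, ha', ha''⟩ ⟨hb, hb', hb''⟩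
    exact ⟨mul_mem ha hb, ha'.mul_left hb', by rw [dt_mul hoff ha' hb', ha'', hb'', add_zero]⟩
  one_mem' := ⟨one_mem _, Commute.one_left c, dt_one⟩
  inv_mem' := by
    rintro a ⟨ha, ha', ha''⟩
    refine ⟨inv_mem ha, ha'.inv_left, ?_⟩
    have := dt_mul hoff ha' ha'.inv_left
    rw [mul_inv_cancel, dt_one, ha'', zero_add] at this
    exact this.symm

theorem mem_NN {hoff : ∀ (i : ℤ) x, off ((c ^ i) x) = off x + i} {g : Perm Ω} :
    g ∈ NN Γ hoff ↔ g ∈ autG Γ ∧ Commute g c ∧ dt c off g = 0 := Iff.rfl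

theorem NN_fix [Finite Ω] (h : Dih 5 c z s) (hcG : c ∈ autG Γ)
    (hN : ∀ x y, ¬ c.SameCycle x y → NU Γ c x y)
    (hoff : ∀ (i : ℤ) x, off ((c ^ i) x) = off x + i) {n : Perm Ω} (hn : n ∈ NN Γ hoff) {x : Ω}
    {k : ℤ} (e : n x = (c ^ k) x) : (5 : ℤ) ∣ k := by
  have p5 : Nat.Prime 5 := by norm_num
  have hcard := h.card_blk x
  obtain ⟨a, m, hm, hN'⟩ := Nat.exists_eq_pow_mul_and_not_dvd (orderOf_pos n).ne' 5 (by norm_num)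
  have hw : n ^ m ∈ NN Γ hoff := pow_mem hn m
  have hwx := comm_pow hn.2.1 e m
  have hw5 : (n ^ m) ^ 5 ^ a = 1 := by
    rw [← pow_mul, mul_comm, ← hN', pow_orderOf_eq_one]
  suffices hs : (5 : ℤ) ∣ k * m by
    rcases (Nat.prime_iff_prime_int.mp p5).dvd_or_dvd hs with h1 | h1
    · exact_mod_cast h1
    · exact absurd (by exact_mod_cast h1) hm
  generalize n ^ m = w at *
  generalize k * m = l at *
  clear e hn hN' hm
  have kill : ∀ j : ℤ, (j : ZMod 5) = 0 → (5 : ℤ) ∣ j := by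
    intro j hj
    have := (ZMod.intCast_zmod_eq_zero_iff_dvd j 5).mp hj
    exact_mod_cast this
  by_cases hK : w ∈ Kr c
  · obtain ⟨j, rfl⟩ := kernel_c p5 h x hcG hN hw.1 ⟨hw.2.1, hK⟩
    have h1 := hw.2.2
    rw [dt_cpow hcard hoff] at h1
    have h2 : (c ^ (l - j)) x = x := by
      have : (c ^ (l - j)) x = (c ^ (-j)) ((c ^ l) x) := by rw [zadd]; congr 2; ring
      rw [this, ← hwx, zadd]; simp
    have h3 := h.c_free _ _ h2
    have h4 := kill j h1
    have := dvd_add h3 h4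
    simpa using this
  · obtain ⟨-, x0, h1, h2, h3, h4⟩ := five_of_move p5 (by norm_num) hcard hw5 (autG_comm hw.2.1) hK
    have hx0 : c.SameCycle x0 x := by
      by_contra hne
      exact h2 x hne ⟨l, hwx.symm⟩
    obtain ⟨j, hj⟩ := kernel_c p5 h x hcG hN (pow_mem hw 5).1 ⟨(pow_mem hw 5).2.1, h3⟩
    have h5 : w ^ 5 = 1 := by
      have e1 := comm_pow hw.2.1 hwx 5
      have e2 : c ^ (l * ((5 : ℕ) : ℤ)) = c ^ (0 : ℤ) :=
        zpow_eq_of_dvd h.hc ⟨l, by push_cast; ring⟩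
      rw [e2, hj] at e1
      have e3 := h.c_free j x (by simpa using e1)
      rw [hj, zpow_eq_of_dvd h.hc (j := 0) (by simpa using e3), zpow_zero]
    obtain ⟨x1, hx1⟩ : ∃ x1, ¬ c.SameCycle x1 (w x1) := by
      by_contra hne
      push Not at hne
      exact hK hne
    have hx01 : ¬ c.SameCycle x0 x1 := by
      intro h6
      apply hx1
      exact h6.symm.trans (h1.trans (((autG_comm hw.2.1) _ _).2 h6))
    classical
    let f : ℕ → Blk c := fun i => bk c ((w ^ i) x1)
    have hun : (Finset.univ : Finset (Blk c)) = insert (bk c x0) ((Finset.range 5).image f) := by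
      symm; rw [Finset.eq_univ_iff_forall]
      intro b
      obtain ⟨y, rfl⟩ := bk_ind b
      by_cases hy : c.SameCycle x0 y
      · rw [← bk_eq] at hy; rw [hy]; exact Finset.mem_insert_self _ _
      · obtain ⟨i, hi, hi'⟩ := h4 x1 y hx01 hy
        refine Finset.mem_insert_of_mem (Finset.mem_image.mpr ⟨i, Finset.mem_range.mpr hi, ?_⟩)
        exact bk_eq.mpr hi'
    have hc6 : (Finset.univ : Finset (Blk c)).card = 6 := by
      rw [Finset.card_univ, ← Nat.card_eq_fintype_card]; exact hcard
    have hle := Finset.card_image_le (s := Finset.range 5) (f := f)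
    rw [Finset.card_range] at hle
    have hnot : bk c x0 ∉ (Finset.range 5).image f := by
      intro hmem
      rw [Finset.insert_eq_of_mem hmem] at hun
      rw [hun] at hc6; omega
    have hinj : Set.InjOn f (Finset.range 5) := by
      rw [← Finset.card_image_iff, Finset.card_range]
      rw [hun, Finset.card_insert_of_notMem hnot] at hc6; omega
    have hdt := hw.2.2
    rw [dt, hun, Finset.sum_insert hnot, Finset.sum_image hinj] at hdt
    have e2 : ∀ i ∈ Finset.range 5, (off (w (rp (f i))) - off (rp (f i)))
        = off ((w ^ (i + 1)) x1) - off ((w ^ i) x1) := by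
      intro i _
      rw [pow_succ', Perm.mul_apply]
      refine dl_sc hoff hw.2.1 ?_
      rw [← bk_eq, bk_rp]
    rw [Finset.sum_congr rfl e2, Finset.sum_range_sub (fun i => off ((w ^ i) x1)), h5] at hdt
    have e3 : off (w (rp (bk c x0))) - off (rp (bk c x0)) = off (w x) - off x := by
      refine dl_sc hoff hw.2.1 ?_
      rw [← bk_eq, bk_rp, bk_eq]; exact hx0
    rw [e3, hwx, hoff] at hdt
    apply kill
    simpa using hdt

end grid
end D6
namespace D6
open Equiv Equiv.Perm
open scoped Pointwise

section grid2
variable {Ω : Type*} {c z s : Perm Ω} {Γ : Ω → Ω → Prop}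

/-- Grid structure. -/
structure Grid (Γ : Ω → Ω → Prop) (c : Perm Ω) (row : Ω → ZMod 5) (I J : Set (ZMod 5)) : Prop where
  rc : ∀ (k : ℤ) x, row ((c ^ k) x) = row x + k
  off : ∀ x y, ¬ c.SameCycle x y → (Γ x y ↔ row y - row x ∈ I)
  on : ∀ x (k : ℤ), Γ x ((c ^ k) x) ↔ (k : ZMod 5) ∈ J
  I1 : ∃ a, a ∈ I
  I2 : ∃ a, a ∉ I

/-- The element q fixes exactly the block of x0 and cycles through the others. -/
structure Five (c q : Perm Ω) (x0 : Ω) : Prop where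
  aut : q ∈ autG c.SameCycle
  f1 : c.SameCycle x0 (q x0)
  f2 : ∀ x, ¬ c.SameCycle x0 x → ¬ c.SameCycle x (q x)
  f3 : ∀ x y, ¬ c.SameCycle x0 x → ¬ c.SameCycle x0 y → ∃ i : ℕ, i < 5 ∧ c.SameCycle ((q ^ i) x) y

theorem Five.mulc {q : Perm Ω} {x0 : Ω} (h : Five c q x0) (hc : Commute q c) (k : ℤ) :
    Five c (q * c ^ k) x0 := by
  have e : ∀ x, (q * c ^ k) x = (c ^ k) (q x) := fun x => comm_ap hc k x
  have e2 : ∀ (i : ℕ) x, ((q * c ^ k) ^ i) x = (c ^ (k * i)) ((q ^ i) x) := by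
    intro i x
    rw [(hc.zpow_right k).mul_pow, ← zpow_natCast (c ^ k), ← zpow_mul, Perm.mul_apply,
      comm_ap (hc.pow_left i)]
  refine ⟨mul_mem h.aut (zpow_mem (autG_comm (Commute.refl c)) k), ?_, ?_, ?_⟩
  · rw [e]; exact h.f1.trans (sc_zpow _ _ _)
  · intro x hx; rw [e]; intro h1
    exact h.f2 x hx (h1.trans (sc_zpow _ _ _).symm)
  · intro x y hx hy
    obtain ⟨i, hi, h1⟩ := h.f3 x y hx hy
    refine ⟨i, hi, ?_⟩
    rw [e2]; exact (sc_zpow _ _ _).symm.trans h1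

theorem Dih.z_ns {p : ℕ} (h : Dih p c z s) (x : Ω) : ¬ c.SameCycle x (z x) := by
  rintro ⟨i, hi⟩
  have : (c ^ (-i)) ((z ^ (1 : ℤ)) x) = x := by
    rw [zpow_one, ← hi, zadd]; simp
  have := (h.free1 _ _ _ this).2
  omega

theorem mk_grid [Finite Ω] (h : Dih 5 c z s) (hcG : c ∈ autG Γ) (hzG : z ∈ autG Γ)
    (hN : ∀ x y, ¬ c.SameCycle x y → NU Γ c x y) {q : Perm Ω} (hqG : q ∈ autG Γ)
    (hqc : Commute q c) {x0 : Ω} (hq : Five c q x0) :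
    ∃ row I J, Grid Γ c row I J ∧ ∃ k : ℤ, (q * c ^ k) x0 = x0 := by
  classical
  have hcard := h.card_blk x0
  have : Finite (Blk c) := Nat.finite_of_card_ne_zero (by omega)
  have : Fintype (Blk c) := Fintype.ofFinite _
  obtain ⟨off, hoff⟩ := exists_off h
  have cc : ∀ k : ℤ, Commute (c ^ k) c := fun k => (Commute.refl c).zpow_left k
  have hzN : z ∈ NN Γ hoff := by
    refine ⟨hzG, h.cz.symm, ?_⟩
    have e1 := dt_mul hoff (h.cz.symm.mul_left h.cz.symm) h.cz.symm
    rw [dt_mul hoff h.cz.symm h.cz.symm] at e1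
    have e2 : z * z * z = 1 := by rw [← h.hz, pow_succ, pow_two]
    rw [e2, dt_one] at e1
    generalize dt c off z = t at e1
    revert t; decide
  obtain ⟨k0, hk0⟩ : ∃ k : ℤ, q * c ^ k ∈ NN Γ hoff := by
    refine ⟨-((dt c off q).val : ℤ), mul_mem hqG (zpow_mem hcG _), hqc.mul_left (cc _), ?_⟩
    rw [dt_mul hoff hqc (cc _), dt_cpow hcard hoff]
    push_cast
    rw [ZMod.natCast_zmod_val, add_neg_cancel]
  have hq' := hq.mulc hqc k0
  generalize hqe : q * c ^ k0 = q' at *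
  clear hqc hq hqG
  have fixN : ∀ n ∈ NN Γ hoff, ∀ x, c.SameCycle x (n x) → n x = x := by
    rintro n hn x ⟨k, hk⟩
    have h1 := NN_fix h hcG hN hoff hn hk.symm
    rw [← hk, zpow_eq_of_dvd h.hc (j := 0) (by simpa using h1)]; simp
  have hqx0 : q' x0 = x0 := fixN _ hk0 _ hq'.f1
  have tr : ∀ y, ∃ g ∈ NN Γ hoff, ∃ k : ℤ, (c ^ k) (g x0) = y := by
    intro y
    by_cases hy : c.SameCycle x0 y
    · obtain ⟨k, hk⟩ := hy
      exact ⟨1, one_mem _, k, hk⟩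
    · obtain ⟨i, -, k, hk⟩ := hq'.f3 (z x0) y (h.z_ns x0) hy
      exact ⟨q' ^ i * z, mul_mem (pow_mem hk0 i) hzN, k, hk⟩
  choose g hg r hr using tr
  have hrow : ∀ n ∈ NN Γ hoff, ∀ k : ℤ, (r ((c ^ k) (n x0)) : ZMod 5) = k := by
    intro n hn k
    have e := hr ((c ^ k) (n x0))
    generalize r ((c ^ k) (n x0)) = k' at e ⊢
    have hg' := hg ((c ^ k) (n x0))
    generalize g ((c ^ k) (n x0)) = g' at e hg'
    have e2 : (n⁻¹ * g') x0 = (c ^ (k - k')) x0 := by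
      rw [Perm.mul_apply, Perm.inv_eq_iff_eq, comm_ap hn.2.1]
      have : g' x0 = (c ^ (-k')) ((c ^ k') (g' x0)) := by rw [zadd]; simp
      rw [this, e, zadd]; congr 2; ring
    have h1 := NN_fix h hcG hN hoff (mul_mem (inv_mem hn) hg') e2
    have h2 := (ZMod.intCast_zmod_eq_zero_iff_dvd (k - k') 5).mpr (by exact_mod_cast h1)
    push_cast at h2
    exact (sub_eq_zero.mp h2).symm
  let row : Ω → ZMod 5 := fun x => (r x : ZMod 5)
  have rc : ∀ (k : ℤ) x, row ((c ^ k) x) = row x + k := by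
    intro k x
    show (r ((c ^ k) x) : ZMod 5) = r x + k
    have : (c ^ k) x = (c ^ (k + r x)) ((g x) x0) := by rw [← zadd, hr]
    rw [this, hrow _ (hg x)]; push_cast; ring
  have rn : ∀ n ∈ NN Γ hoff, ∀ x, row (n x) = row x := by
    intro n hn x
    show (r (n x) : ZMod 5) = r x
    have : n x = (c ^ (r x)) ((n * g x) x0) := by
      rw [Perm.mul_apply, ← comm_ap hn.2.1, hr]
    rw [this, hrow _ (mul_mem hn (hg x))]
  have cG : ∀ k : ℤ, c ^ k ∈ autG Γ := fun k => zpow_mem hcG k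
  have cpe : ∀ k k' : ℤ, (k : ZMod 5) = k' → c ^ k = c ^ k' := by
    intro k k' e
    refine zpow_eq_of_dvd h.hc ?_
    rw [← ZMod.intCast_zmod_eq_zero_iff_dvd]
    push_cast; rw [e, sub_self]
  have row0 : row x0 = 0 := by
    have := hrow 1 (one_mem _) 0
    simpa using this
  refine ⟨row, {t | ∃ k : ℤ, (k : ZMod 5) = t ∧ Γ x0 ((c ^ k) (z x0))},
    {t | ∃ k : ℤ, (k : ZMod 5) = t ∧ Γ x0 ((c ^ k) x0)}, ⟨rc, ?_, ?_, ?_, ?_⟩, k0, ?_⟩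
  · intro x y hxy
    have main : ∀ y, ¬ c.SameCycle x0 y →
        (Γ x0 y ↔ ∃ k : ℤ, (k : ZMod 5) = row y ∧ Γ x0 ((c ^ k) (z x0))) := by
      intro y hy
      obtain ⟨i, -, k, rfl⟩ := hq'.f3 (z x0) y (h.z_ns x0) hy
      have hqi : q' ^ i ∈ NN Γ hoff := pow_mem hk0 i
      have e1 : (q' ^ i) x0 = x0 := by
        clear hqi hy
        induction i with
        | zero => rfl
        | succ i ih => rw [pow_succ, Perm.mul_apply, hqx0, ih]
      have e2 : row ((c ^ k) ((q' ^ i) (z x0))) = k := by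
        rw [rc, rn _ hqi, rn _ hzN, row0, zero_add]
      have e3 : Γ x0 ((c ^ k) ((q' ^ i) (z x0))) ↔ Γ x0 ((c ^ k) (z x0)) := by
        rw [← hqi.1 x0 ((c ^ k) (z x0)), e1, comm_ap hqi.2.1]
      rw [e2, e3]
      constructor
      · intro h1; exact ⟨k, rfl, h1⟩
      · rintro ⟨k', e, h1⟩; rwa [cpe k' k e] at h1
    have hxx := hr x
    have hwG : c ^ (r x) * g x ∈ autG Γ := mul_mem (cG _) (hg x).1
    have hwA : c ^ (r x) * g x ∈ autG c.SameCycle :=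
      autG_comm ((cc _).mul_left (hg x).2.1)
    obtain ⟨y', rfl⟩ : ∃ y', (c ^ (r x) * g x) y' = y := ⟨_, apinv _ _⟩
    have e1 : row ((c ^ (r x) * g x) y') - row x = row y' := by
      rw [Perm.mul_apply, rc, rn _ (hg x)]
      show row y' + row x - row x = row y'
      ring
    rw [e1]
    have hxy' : ¬ c.SameCycle x0 y' := by
      intro h1; apply hxy
      have := (hwA _ _).2 h1
      rwa [Perm.mul_apply, hxx] at this
    have e2 := hwG x0 y'
    rw [Perm.mul_apply, hxx] at e2
    rw [e2, main y' hxy']; rfl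
  · intro x k
    have hxx := hr x
    have hwG : c ^ (r x) * g x ∈ autG Γ := mul_mem (cG _) (hg x).1
    have e2 := hwG x0 ((c ^ k) x0)
    have e3 : (c ^ (r x) * g x) ((c ^ k) x0) = (c ^ k) ((c ^ (r x) * g x) x0) :=
      comm_ap ((cc _).mul_left (hg x).2.1) _ _
    rw [e3, Perm.mul_apply, hxx] at e2
    rw [e2]
    constructor
    · intro h1; exact ⟨k, rfl, h1⟩
    · rintro ⟨k', e, h1⟩; rwa [cpe k' k e] at h1
  · obtain ⟨w, w', hw, hw', h1, h2⟩ := hN x0 (z x0) (h.z_ns x0)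
    obtain ⟨k, rfl⟩ := hw
    exact ⟨k, k, rfl, h1⟩
  · obtain ⟨w, w', hw, hw', h1, h2⟩ := hN x0 (z x0) (h.z_ns x0)
    obtain ⟨k, rfl⟩ := hw'
    refine ⟨k, ?_⟩
    rintro ⟨k', e, h3⟩
    rw [cpe k' k e] at h3
    exact h2 h3
  · rw [hqe]; exact hqx0

end grid2
end D6
namespace D6
open Equiv Equiv.Perm
open scoped Pointwise

section grid3
variable {Ω : Type*} {c z s c1 z1 s1 c2 z2 s2 : Perm Ω} {Γ : Ω → Ω → Prop}
  {R : Subgroup (Perm Ω)}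

theorem pfix [Finite Ω] (h : Dih 5 c z s) {P : Subgroup (Perm Ω)} (hP : IsPGroup 5 P)
    (cP : c ∈ P) {q : Perm Ω} (hqP : q ∈ P) {x0 : Ω} (hq : Five c q x0) :
    ∀ g ∈ P, c.SameCycle x0 (g x0) := by
  intro g hg
  by_contra hne
  have : Fact (Nat.Prime 5) := ⟨by norm_num⟩
  have horb : MulAction.orbit P x0 = Set.univ := by
    rw [Set.eq_univ_iff_forall]
    intro y
    by_cases hy : c.SameCycle x0 y
    · obtain ⟨k, rfl⟩ := hy
      exact ⟨⟨c ^ k, zpow_mem cP k⟩, rfl⟩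
    · obtain ⟨i, -, k, rfl⟩ := hq.f3 _ y hne hy
      exact ⟨⟨c ^ k * (q ^ i * g), mul_mem (zpow_mem cP k) (mul_mem (pow_mem hqP i) hg)⟩, rfl⟩
  obtain ⟨n, hn⟩ := hP.card_orbit x0
  rw [horb, Nat.card_univ] at hn
  classical
  have : Fintype Ω := Fintype.ofFinite _
  have : Fact (Nat.Prime 2) := ⟨Nat.prime_two⟩
  let f : Function.End Ω := fun x => s x
  have hf2 : f ^ 2 ^ 1 = 1 := by
    funext x
    exact congrArg (fun f : Perm Ω => f x) h.hs
  have h2 := Equiv.Perm.card_fixedPoints_modEq (p := 2) (n := 1) hf2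
  have h3 : Fintype.card (Function.fixedPoints f) = 0 := by
    rw [Fintype.card_eq_zero_iff]
    constructor
    rintro ⟨x, hx⟩
    have hx' : s x = x := hx
    exact h.free2 0 0 x (by simpa using hx')
  rw [h3, ← Nat.card_eq_fintype_card, hn] at h2
  have h4 : 2 ∣ 5 ^ n := (Nat.modEq_zero_iff_dvd).mp h2
  have := Nat.prime_two.dvd_of_dvd_pow h4
  omega

theorem I_shift {I : Set (ZMod 5)} (h1 : ∃ a, a ∈ I) (h2 : ∃ a, a ∉ I) {u : ZMod 5}
    (h : ∀ t, t ∈ I ↔ t + u ∈ I) : u = 0 := by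
  by_contra hu
  obtain ⟨a, ha⟩ := h1
  obtain ⟨b, hb⟩ := h2
  have hn : ∀ n : ℕ, a + n * u ∈ I := by
    intro n
    induction n with
    | zero => simpa using ha
    | succ n ih =>
      have := (h _).1 ih
      push_cast
      have e : a + ((n : ZMod 5) + 1) * u = a + n * u + u := by ring
      rw [e]; exact this
  apply hb
  have hex : ∀ a b u : ZMod 5, u ≠ 0 → ∃ n : Fin 5, b = a + ((n : ℕ) : ZMod 5) * u := by decide
  obtain ⟨n, hn'⟩ := hex a b u hu
  rw [hn']; exact hn n

theorem cast5 {k k' : ℤ} (e : (k : ZMod 5) = k') : ((5 : ℕ) : ℤ) ∣ k - k' := by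
  rw [← ZMod.intCast_zmod_eq_zero_iff_dvd]
  push_cast; rw [e, sub_self]

theorem row_P [Finite Ω] (h : Dih 5 c z s) {row I J} (hG : Grid Γ c row I J)
    {P : Subgroup (Perm Ω)} (hP : IsPGroup 5 P) (hPG : P ≤ autG Γ)
    (cP : c ∈ P) {x0 : Ω} (hx0 : ∀ g ∈ P, c.SameCycle x0 (g x0)) {g : Perm Ω} (hg : g ∈ P) {k : ℤ}
    (hk : g x0 = (c ^ k) x0) : ∀ y, row (g y) = row y + k := by
  have p5 : Nat.Prime 5 := by norm_num
  obtain ⟨k', hk'⟩ := L1 p5 hP cP h.hc (fun i => h.c_free i x0) hx0 hg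
  have e0 : g x0 = (c ^ k') x0 := by simpa using hk' 0
  have ekk : (k' : ZMod 5) = k := by
    have := congrArg row (e0.symm.trans hk)
    rw [hG.rc, hG.rc] at this
    exact add_left_cancel this
  intro y
  rw [← ekk]
  by_cases hy : c.SameCycle x0 y
  · obtain ⟨i, rfl⟩ := hy
    rw [hk', hG.rc, hG.rc]; push_cast; ring
  · have hgy : ∀ i : ℤ, ¬ c.SameCycle (g ((c ^ i) x0)) (g y) := by
      rintro i ⟨j, hj⟩
      apply hy
      have h1 := hx0 _ (mul_mem (inv_mem hg) (mul_mem (zpow_mem cP j) (mul_mem hg (zpow_mem cP i))))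
      simp only [Perm.mul_apply] at h1
      rw [hj, invap] at h1
      exact h1
    have hy' : ∀ i : ℤ, ¬ c.SameCycle ((c ^ i) x0) y := fun i h1 =>
      hy ((sc_zpow c i x0).trans h1)
    have hu : row (g y) - row y - k' = 0 := by
      refine I_shift hG.I1 hG.I2 fun t => ?_
      obtain ⟨i, hi⟩ : ∃ i : ℤ, (i : ZMod 5) = row y - row x0 - t :=
        ⟨_, ZMod.intCast_zmod_cast _⟩
      have e1 := hG.off _ _ (hy' i)
      have e2 := hG.off _ _ (hgy i)
      rw [hPG hg, e1, hk', hG.rc, hG.rc] at e2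
      push_cast at e2
      rw [hi] at e2
      have e3 : row y - (row x0 + (row y - row x0 - t)) = t := by ring
      have e4 : row (g y) - (row x0 + (k' + (row y - row x0 - t))) = t + (row (g y) - row y - k') := by
        ring
      rwa [e3, e4] at e2
    linear_combination hu

theorem combine [Finite Ω] (h1 : Base Γ R 5 c1 z1 s1) (h2 : Snd Γ 5 c2 z2 s2)
    {row1 row2 : Ω → ZMod 5} {I1 J1 I2 J2 : Set (ZMod 5)}
    (hG1 : Grid Γ c1 row1 I1 J1) (hG2 : Grid Γ c2 row2 I2 J2)
    {P : Subgroup (Perm Ω)} (hP : IsPGroup 5 P) (hPG : P ≤ autG Γ)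
    (cP : c1 ∈ P) (cP2 : c2 ∈ P) {x0 : Ω} (hx1 : ∀ g ∈ P, c1.SameCycle x0 (g x0))
    (hx2 : ∀ g ∈ P, c2.SameCycle x0 (g x0)) (hc12 : c2 x0 = c1 x0)
    {q : Perm Ω} (hqP : q ∈ P) (hq : Five c1 q x0) (hqx : q x0 = x0) : Good Γ R c2 z2 s2 := by
  have A1 : ∀ g ∈ P, ∀ k : ℤ, g x0 = (c1 ^ k) x0 → ∀ y, row1 (g y) = row1 y + k :=
    fun g hg k hk => row_P h1.d hG1 hP hPG cP hx1 hg hk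
  have A2 : ∀ g ∈ P, ∀ k : ℤ, g x0 = (c2 ^ k) x0 → ∀ y, row2 (g y) = row2 y + k :=
    fun g hg k hk => row_P h2.d hG2 hP hPG cP2 hx2 hg hk
  have c2r : ∀ y, row1 (c2 y) = row1 y + 1 := by
    simpa using A1 c2 cP2 1 (by simpa using hc12)
  have c1r : ∀ y, row2 (c1 y) = row2 y + 1 := by
    simpa using A2 c1 cP 1 (by simpa using hc12.symm)
  have qr1 : ∀ y, row1 (q y) = row1 y := by simpa using A1 q hqP 0 (by simpa using hqx)
  have qr2 : ∀ y, row2 (q y) = row2 y := by simpa using A2 q hqP 0 (by simpa using hqx)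
  have c1rz : ∀ (k : ℤ) y, row2 ((c1 ^ k) y) = row2 y + k := by
    intro k
    induction k with
    | zero => intro y; simp
    | succ k ih =>
      intro y
      rw [add_comm, zpow_add, zpow_one, Perm.mul_apply, c1r, ih]; push_cast; ring
    | pred k ih =>
      intro y
      have e := c1r ((c1 ^ (-(k : ℤ) - 1)) y)
      rw [← Perm.mul_apply, ← zpow_one_add] at e
      have e' : (1 + (-(k : ℤ) - 1)) = -(k : ℤ) := by ring
      rw [e', ih] at e
      push_cast at e ⊢
      linear_combination -e
  have qp1 : ∀ (i : ℕ) y, row1 ((q ^ i) y) = row1 y := by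
    intro i y
    induction i with
    | zero => rfl
    | succ i ih => rw [pow_succ', Perm.mul_apply, qr1, ih]
  have qp2 : ∀ (i : ℕ) y, row2 ((q ^ i) y) = row2 y := by
    intro i y
    induction i with
    | zero => rfl
    | succ i ih => rw [pow_succ', Perm.mul_apply, qr2, ih]
  -- the difference is constant outside the block of x0
  have fO : ∀ y y', ¬ c1.SameCycle x0 y → ¬ c1.SameCycle x0 y' →
      row2 y - row1 y = row2 y' - row1 y' := by
    intro y y' hy hy'
    obtain ⟨i, -, k, rfl⟩ := hq.f3 y y' hy hy'
    rw [c1rz, hG1.rc, qp1, qp2]; ring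
  set x1 := z1 x0 with hx1d
  have hx01 : ¬ c1.SameCycle x0 x1 := h1.d.z_ns x0
  have cst : ∀ t : ZMod 5, ∃ i : ℤ, (i : ZMod 5) = t := fun t => ⟨_, ZMod.intCast_zmod_cast t⟩
  have nsc : ∀ (i : ℤ), ¬ c1.SameCycle x0 ((c1 ^ i) x1) := fun i h =>
    hx01 (h.trans (sc_zpow c1 i x1).symm)
  have nsc2 : ∀ y, ¬ c1.SameCycle x0 y → ¬ c2.SameCycle x0 y := by
    rintro y hy ⟨k, rfl⟩
    exact hy (hx1 _ (zpow_mem cP2 k))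
  have E1 : ∀ t, t ∈ I1 ↔ t ∈ I2 := by
    intro t
    obtain ⟨i, hi⟩ := cst t
    set y := (c1 ^ i) x1 with hy
    have hy0 := nsc i
    rw [← hy] at hy0
    have hqy : ¬ c1.SameCycle x0 (q y) := by
      intro h
      apply hy0
      have := (inv_mem hq.aut x0 y).1 ?_
      · exact this
      · have h3 : c1.SameCycle (q x0) (q y) := by rw [hqx]; exact h
        have h4 := (hq.aut x0 y).1 h3
        exact (inv_mem hq.aut x0 y).2 h4
    have hqy' : ¬ c1.SameCycle x0 (q⁻¹ y) := by
      intro h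
      apply hy0
      have := (hq.aut x0 (q⁻¹ y)).2 h
      rwa [hqx, apinv] at this
    have n1 : ¬ c1.SameCycle x1 (q y) := fun h =>
      hq.f2 y hy0 ((sc_zpow c1 i x1).symm.trans h)
    have n2 : ¬ c1.SameCycle x1 (q⁻¹ y) := fun h => by
      have := hq.f2 (q⁻¹ y) hqy'
      rw [apinv] at this
      exact this (h.symm.trans (sc_zpow c1 i x1))
    have qi1 : row1 (q⁻¹ y) = row1 y := by
      have := qr1 (q⁻¹ y); rw [apinv] at this; exact this.symm
    have qi2 : row2 (q⁻¹ y) = row2 y := by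
      have := qr2 (q⁻¹ y); rw [apinv] at this; exact this.symm
    have ry1 : row1 y - row1 x1 = t := by rw [hy, hG1.rc, hi]; ring
    have ry2 : row2 y - row2 x1 = t := by rw [hy, c1rz, hi]; ring
    by_cases m1 : c2.SameCycle x1 (q y)
    · by_cases m2 : c2.SameCycle x1 (q⁻¹ y)
      · exfalso
        obtain ⟨k, hk⟩ := m1.symm.trans m2
        have hr := congrArg row2 hk
        rw [hG2.rc, qr2, qi2] at hr
        have hk0 : (k : ZMod 5) = 0 := by linear_combination hr
        have : c2 ^ k = c2 ^ (0 : ℤ) := zpow_eq_of_dvd h2.d.hc (cast5 (by simpa using hk0))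
        rw [this, zpow_zero, Perm.one_apply] at hk
        have hq2 : (q ^ 2) y = y := by
          rw [pow_two, Perm.mul_apply, hk, apinv]
        obtain ⟨n, hn⟩ := hP ⟨q, hqP⟩
        have hn' : q ^ 5 ^ n = 1 := by
          have := congrArg Subtype.val hn
          simpa using this
        obtain ⟨j, hj⟩ : Odd (5 ^ n) := Odd.pow (by decide)
        rw [hj, pow_succ', pow_mul] at hn'
        have hqj : ∀ j : ℕ, ((q ^ 2) ^ j) y = y := by
          intro j
          induction j with
          | zero => rfl
          | succ j ih => rw [pow_succ, Perm.mul_apply, hq2, ih]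
        have h5 : (q * (q ^ 2) ^ j) y = y := by rw [hn']; rfl
        rw [Perm.mul_apply, hqj] at h5
        apply hq.f2 y hy0
        rw [h5]
      · have e1 := hG1.off _ _ n2
        have e2 := hG2.off _ _ m2
        rw [qi1, ry1] at e1
        rw [qi2, ry2] at e2
        rw [← e1, e2]
    · have e1 := hG1.off _ _ n1
      have e2 := hG2.off _ _ m1
      rw [qr1, ry1] at e1
      rw [qr2, ry2] at e2
      rw [← e1, e2]
  have hu : (row2 x1 - row1 x1) - (row2 x0 - row1 x0) = 0 := by
    refine I_shift hG1.I1 hG1.I2 fun t => ?_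
    obtain ⟨i, hi⟩ := cst (t - (row1 x1 - row1 x0))
    have e1 := hG1.off _ _ (nsc i)
    have e2 := hG2.off _ _ (nsc2 _ (nsc i))
    rw [e1, c1rz, hG1.rc, hi, ← E1] at e2
    convert e2 using 2 <;> ring
  have hf : ∀ y, row2 y = row1 y + (row2 x0 - row1 x0) := by
    intro y
    by_cases hy : c1.SameCycle x0 y
    · obtain ⟨i, rfl⟩ := hy
      rw [c1rz, hG1.rc]; ring
    · have := fO y x1 hy hx01
      linear_combination this + hu
  have rc2 : ∀ (k : ℤ) x, row1 ((c2 ^ k) x) = row1 x + k := by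
    intro k x
    have := hG2.rc k x
    rw [hf, hf x] at this
    linear_combination this
  have off2 : ∀ x y, ¬ c2.SameCycle x y → (Γ x y ↔ row1 y - row1 x ∈ I1) := by
    intro x y h
    rw [hG2.off x y h, ← E1, hf, hf x]
    have : row1 y + (row2 x0 - row1 x0) - (row1 x + (row2 x0 - row1 x0)) = row1 y - row1 x := by ring
    rw [this]
  by_cases hIJ : ∀ k : ZMod 5, k ≠ 0 → (k ∈ I1 ↔ k ∈ J1)
  · -- every row preserving permutation is an automorphism
    have hrowG : ∀ φ : Perm Ω, (∀ x, row1 (φ x) = row1 x) → φ ∈ autG Γ := by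
      intro φ hφ
      have key : ∀ x y, Γ x y ↔ (x = y ∧ (0 : ZMod 5) ∈ J1) ∨ (x ≠ y ∧ row1 y - row1 x ∈ I1) := by
        intro x y
        by_cases hxy : c1.SameCycle x y
        · obtain ⟨k, rfl⟩ := hxy
          rw [hG1.on]
          by_cases hk : (k : ZMod 5) = 0
          · have : c1 ^ k = c1 ^ (0 : ℤ) := zpow_eq_of_dvd h1.d.hc (cast5 (by simpa using hk))
            rw [this, hk]; simp
          · have hne : x ≠ (c1 ^ k) x := by
              intro e
              have := congrArg row1 e
              rw [hG1.rc] at this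
              exact hk (by linear_combination -this)
            rw [hG1.rc, ← hIJ _ hk]
            have : row1 x + k - row1 x = (k : ZMod 5) := by ring
            rw [this]
            tauto
        · have hne : x ≠ y := by rintro rfl; exact hxy (SameCycle.refl _ _)
          rw [hG1.off x y hxy]; tauto
      intro x y
      rw [key, key x y, hφ, hφ]
      simp
    obtain ⟨φ, hφ⟩ := exists_glue row1 (fun r => c1 ^ (r.val : ℤ) * c2 ^ (-(r.val : ℤ))) (by
      intro x
      rw [Perm.mul_apply, hG1.rc, rc2]; push_cast; ring)
    have hφr : ∀ x, row1 (φ x) = row1 x := by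
      intro x
      rw [hφ, Perm.mul_apply, hG1.rc, rc2]; push_cast; ring
    have hφG := hrowG φ hφr
    apply Good.of_conj hφG
    refine cpow_good h1 (h2.conj hφG) x0 (a := 1) ?_
    rw [zpow_one, mul_inv_eq_iff_eq_mul]
    ext y
    rw [Perm.mul_apply, Perm.mul_apply, hφ, hφ, c2r, Perm.mul_apply, Perm.mul_apply]
    have e0 : (((row1 y + 1).val : ℤ) : ZMod 5) = (((row1 y).val + 1 : ℤ) : ZMod 5) := by
      push_cast
      rw [ZMod.natCast_zmod_val, ZMod.natCast_zmod_val]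
    have e1 : c1 ^ ((row1 y + 1).val : ℤ) = c1 ^ ((row1 y).val + 1 : ℤ) :=
      zpow_eq_of_dvd h1.d.hc (cast5 e0)
    have e2 : c2 ^ (-((row1 y + 1).val : ℤ)) = c2 ^ (-((row1 y).val + 1 : ℤ)) := by
      rw [zpow_neg, zpow_neg, zpow_eq_of_dvd h2.d.hc (cast5 e0)]
    rw [e1, e2]
    have e3 : (c2 ^ (-((row1 y).val + 1 : ℤ))) (c2 y) = (c2 ^ (-((row1 y).val : ℤ))) y := by
      have := zadd c2 (-((row1 y).val + 1 : ℤ)) 1 y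
      rw [zpow_one] at this
      rw [this]; congr 2; ring
    rw [e3, add_comm, zpow_add, zpow_one, Perm.mul_apply]
  · push Not at hIJ
    obtain ⟨t, ht, hIJ⟩ := hIJ
    obtain ⟨k, hk⟩ := cst t
    have hkk : ∀ x, (c1 ^ k) x = (c2 ^ k) x := by
      intro x
      by_contra hne
      have hd : ¬ c2.SameCycle x ((c1 ^ k) x) := by
        rintro ⟨j, hj⟩
        apply hne
        have := congrArg row1 hj
        rw [rc2, hG1.rc] at this
        rw [← hj, zpow_eq_of_dvd h2.d.hc (cast5 (add_left_cancel this))]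
      have e1 := off2 _ _ hd
      rw [hG1.on, hG1.rc, hk] at e1
      have e2 : row1 x + t - row1 x = t := by ring
      rw [e2] at e1
      rcases hIJ with h | h <;> tauto
    have hkp : c1 ^ k = c2 ^ k := Equiv.ext hkk
    obtain ⟨m, hm⟩ := zpow_solve (p := 5) (by norm_num) (d := k) (by
      intro h
      apply ht
      rw [← hk, ZMod.intCast_zmod_eq_zero_iff_dvd]; exact h) 1
    refine cpow_good h1 h2 x0 (a := 1) ?_
    have e1 := zpow_eq_of_dvd h1.d.hc hm
    have e2 := zpow_eq_of_dvd h2.d.hc hm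
    rw [mul_comm, zpow_mul] at e1 e2
    rw [← e1, hkp, e2, zpow_one]

end grid3
end D6
namespace D6
open Equiv Equiv.Perm
open scoped Pointwise

section main
variable {Ω : Type*} {p : ℕ} {c z s c1 z1 s1 c2 z2 s2 : Perm Ω} {Γ : Ω → Ω → Prop}
  {R : Subgroup (Perm Ω)}

theorem Grid.cpow {row : Ω → ZMod 5} {I J : Set (ZMod 5)} (h : Grid Γ c row I J) (hc : c ^ 5 = 1)
    {m k : ℤ} (hmk : ((5 : ℕ) : ℤ) ∣ m * k - 1) :
    Grid Γ (c ^ m) (fun x => k * row x) {t | m * t ∈ I} {t | m * t ∈ J} := by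
  have e1 : (m : ZMod 5) * k = 1 := by
    have := (ZMod.intCast_zmod_eq_zero_iff_dvd (m * k - 1) 5).mpr hmk
    push_cast at this
    linear_combination this
  have e2 : c = (c ^ m) ^ k := by
    rw [← zpow_mul, zpow_eq_of_dvd hc hmk, zpow_one]
  refine ⟨?_, ?_, ?_, ?_, ?_⟩
  · intro j x
    show k * row (((c ^ m) ^ j) x) = k * row x + j
    rw [← zpow_mul, h.rc]; push_cast
    linear_combination (j : ZMod 5) * e1
  · intro x y hxy
    have : ¬ c.SameCycle x y := by
      rintro ⟨i, rfl⟩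
      apply hxy
      refine ⟨k * i, ?_⟩
      rw [zpow_mul, ← e2]
    rw [h.off x y this]
    show _ ↔ (m : ZMod 5) * (k * row y - k * row x) ∈ I
    have : (m : ZMod 5) * (k * row y - k * row x) = row y - row x := by
      linear_combination (row y - row x) * e1
    rw [this]
  · intro x j
    rw [← zpow_mul, h.on]
    show _ ↔ (m : ZMod 5) * j ∈ J
    push_cast; rfl
  · obtain ⟨a, ha⟩ := h.I1
    refine ⟨k * a, ?_⟩
    show (m : ZMod 5) * (k * a) ∈ I
    rw [← mul_assoc, e1, one_mul]; exact ha
  · obtain ⟨a, ha⟩ := h.I2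
    refine ⟨k * a, ?_⟩
    show ¬ (m : ZMod 5) * (k * a) ∈ I
    rw [← mul_assoc, e1, one_mul]; exact ha

theorem Five.powx {q : Perm Ω} {x0 : Ω} (h : Five c q x0) (i : ℕ) : c.SameCycle x0 ((q ^ i) x0) := by
  induction i with
  | zero => exact SameCycle.refl _ _
  | succ i ih =>
    rw [pow_succ', Perm.mul_apply]
    exact h.f1.trans ((h.aut _ _).2 ih)

theorem reg (h : Snd Γ p c z s) (x0 x : Ω) : ∃ g ∈ autG Γ, g ∈ autG c.SameCycle ∧ g x0 = x ∧
    ∃ e : ℤ, (e = 1 ∨ e = -1) ∧ ∀ (k : ℤ) y, g ((c ^ k) y) = (c ^ (e * k)) (g y) := by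
  have ca : ∀ i : ℤ, c ^ i ∈ autG c.SameCycle := fun i => zpow_mem h.d.c_aut i
  have za : ∀ i : ℤ, z ^ i ∈ autG c.SameCycle := fun i => zpow_mem h.d.z_aut i
  have cG : ∀ i : ℤ, c ^ i ∈ autG Γ := fun i => zpow_mem h.cG i
  have zG : ∀ i : ℤ, z ^ i ∈ autG Γ := fun i => zpow_mem h.zG i
  rcases h.d.cov x0 x with ⟨i, j, rfl⟩ | ⟨i, j, rfl⟩
  · refine ⟨c ^ i * z ^ j, mul_mem (cG i) (zG j), mul_mem (ca i) (za j), rfl, 1, Or.inl rfl, ?_⟩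
    intro k y
    rw [Perm.mul_apply, Perm.mul_apply, h.d.zc, zadd, zadd, one_mul, add_comm]
  · refine ⟨c ^ i * (z ^ j * s), mul_mem (cG i) (mul_mem (zG j) h.sG),
      mul_mem (ca i) (mul_mem (za j) h.d.s_aut), rfl, -1, Or.inr rfl, ?_⟩
    intro k y
    simp only [Perm.mul_apply]
    rw [h.d.s_c, h.d.zc, zadd, zadd, neg_one_mul, add_comm]

theorem NU_dich (h : Snd Γ 5 c z s) {q : Perm Ω} (hqG : q ∈ autG Γ) {x0 : Ω} (hq : Five c q x0) :
    (∀ x y, ¬ c.SameCycle x y → NU Γ c x y) ∨ (∀ x y, ¬ c.SameCycle x y → ¬ NU Γ c x y) := by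
  have key : ∀ x y, ¬ c.SameCycle x y → (NU Γ c x y ↔ NU Γ c x0 (z x0)) := by
    have k1 : ∀ y, ¬ c.SameCycle x0 y → (NU Γ c x0 y ↔ NU Γ c x0 (z x0)) := by
      intro y hy
      obtain ⟨i, -, hi⟩ := hq.f3 (z x0) y (h.d.z_ns x0) hy
      have qG : q ^ i ∈ autG Γ := pow_mem hqG i
      have qA : q ^ i ∈ autG c.SameCycle := pow_mem hq.aut i
      constructor
      · intro h1
        have h2 := h1.lr h.cG (hq.powx i) hi.symm
        have h3 := h2.map (inv_mem qG) (inv_mem qA)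
        rwa [invap, invap] at h3
      · intro h1
        exact (h1.map qG qA).lr h.cG (hq.powx i).symm hi
    intro x y hxy
    obtain ⟨g, gG, gA, rfl, -⟩ := reg h x0 x
    obtain ⟨y', rfl⟩ : ∃ y', g y' = y := ⟨_, apinv _ _⟩
    rw [gA] at hxy
    rw [← k1 y' hxy]
    constructor
    · intro h1
      have := h1.map (inv_mem gG) (inv_mem gA)
      rwa [invap, invap] at this
    · intro h1; exact h1.map gG gA
  by_cases h0 : NU Γ c x0 (z x0)
  · left; intro x y hxy; exact (key x y hxy).2 h0
  · right; intro x y hxy h1; exact h0 ((key x y hxy).1 h1)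

theorem Ucase [Finite Ω] (h : Snd Γ 5 c z s) (h2 : Snd Γ 5 c2 z2 s2) {q : Perm Ω}
    (hqG : q ∈ autG Γ) {x0 : Ω} (hq : Five c q x0)
    (hU : ∀ x y, ¬ c.SameCycle x y → ¬ NU Γ c x y) : (∀ g, g ∈ autG Γ) ∨ c2 ∈ Kr c := by
  have p5 : Nat.Prime 5 := by norm_num
  set v := Γ x0 (z x0) with hv
  have V0 : ∀ y, ¬ c.SameCycle x0 y → (Γ x0 y ↔ v) := by
    intro y hy
    obtain ⟨i, -, hi⟩ := hq.f3 (z x0) y (h.d.z_ns x0) hy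
    rw [hv, ← (pow_mem hqG i : q ^ i ∈ autG Γ) x0 (z x0)]
    exact (not_NU h.cG (hU x0 y hy) (hq.powx i) hi.symm).symm
  have V : ∀ x y, ¬ c.SameCycle x y → (Γ x y ↔ v) := by
    intro x y hxy
    obtain ⟨g, gG, gA, rfl, -⟩ := reg h x0 x
    obtain ⟨y', rfl⟩ : ∃ y', g y' = y := ⟨_, apinv _ _⟩
    rw [gA] at hxy
    rw [gG, V0 y' hxy]
  by_cases htr : ∀ k : ℤ, (c ^ k) x0 ≠ x0 → (Γ x0 ((c ^ k) x0) ↔ v)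
  · left
    have W : ∀ x y, x ≠ y → (Γ x y ↔ v) := by
      intro x y hxy
      obtain ⟨g, gG, gA, rfl, -⟩ := reg h x0 x
      obtain ⟨y', rfl⟩ : ∃ y', g y' = y := ⟨_, apinv _ _⟩
      rw [gG]
      have hne : x0 ≠ y' := fun e => hxy (by rw [e])
      by_cases hs : c.SameCycle x0 y'
      · obtain ⟨k, rfl⟩ := hs
        exact htr k hne.symm
      · exact V0 y' hs
    have D : ∀ x, Γ x x ↔ Γ x0 x0 := by
      intro x
      obtain ⟨g, gG, gA, rfl, -⟩ := reg h x0 x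
      exact gG x0 x0
    intro g x y
    by_cases hxy : x = y
    · subst hxy; rw [D, D x]
    · rw [W x y hxy, W _ _ (fun e => hxy (g.injective e))]
  · right
    push Not at htr
    obtain ⟨k0, hk0, hne⟩ := htr
    have hne' : ¬ (Γ x0 ((c ^ k0) x0) ↔ v) := by
      rcases hne with hh | hh <;> tauto
    have key : ∀ g ∈ autG Γ, ∀ x y, c.SameCycle x y → c.SameCycle (g x) (g y) := by
      rintro g hg x _ ⟨j, rfl⟩
      obtain ⟨d, hd5, hd⟩ : ∃ d : ℤ, ¬ ((5 : ℕ) : ℤ) ∣ d ∧ ¬ (Γ x ((c ^ d) x) ↔ v) := by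
        obtain ⟨w, wG, wA, rfl, e, he, hw⟩ := reg h x0 x
        refine ⟨e * k0, ?_, ?_⟩
        · intro hdv
          apply hk0
          have hdk : ((5 : ℕ) : ℤ) ∣ k0 := by
            rcases he with rfl | rfl
            · simpa using hdv
            · simpa using hdv
          rw [zpow_eq_of_dvd h.d.hc (j := 0) (by simpa using hdk)]; simp
        · rw [← hw, wG]; exact hne'
      have step : ∀ i : ℤ, c.SameCycle (g ((c ^ i) x)) (g ((c ^ (i + d)) x)) := by
        intro i
        by_contra hns
        apply hd
        rw [← V _ _ hns, hg, ← zadd, (zpow_mem h.cG i : c ^ i ∈ autG Γ)]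
      have stp : ∀ n : ℕ, c.SameCycle (g x) (g ((c ^ (n * d)) x)) := by
        intro n
        induction n with
        | zero => simpa using SameCycle.refl _ _
        | succ n ih =>
          refine ih.trans ?_
          have := step (n * d)
          have e : ((n + 1 : ℕ) : ℤ) * d = n * d + d := by push_cast; ring
          rw [e]; exact this
      obtain ⟨m, hm⟩ := zpow_solve p5 hd5 j
      have h0 : 0 ≤ m % 5 := Int.emod_nonneg _ (by norm_num)
      have e1 : c ^ (((m % 5).toNat : ℤ) * d) = c ^ j := by
        refine zpow_eq_of_dvd h.d.hc ?_
        rw [Int.toNat_of_nonneg h0]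
        have e2 : m % 5 = m - 5 * (m / 5) := by omega
        have e3 : m % 5 * d - j = (m * d - j) - ((5 : ℕ) : ℤ) * (m / 5 * d) := by
          rw [e2]; push_cast; ring
        rw [e3]
        exact dvd_sub hm (dvd_mul_right _ _)
      rw [← e1]; exact stp _
    have keyA : ∀ g ∈ autG Γ, g ∈ autG c.SameCycle := by
      intro g hg x y
      constructor
      · intro h1
        have := key _ (inv_mem hg) _ _ h1
        rwa [invap, invap] at this
      · exact key g hg x y
    by_contra hK
    have hcard := h.d.card_blk x0
    obtain ⟨-, y0, f1, f2, -, -⟩ := five_of_move (n := 1) p5 (by norm_num) hcard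
      (by simpa using h2.d.hc) (keyA _ h2.cG) hK
    have hz0 : c.SameCycle y0 (z2 y0) := by
      by_contra hns
      apply f2 _ hns
      have e : c2 (z2 y0) = z2 (c2 y0) := congrArg (fun f : Perm Ω => f y0) h2.d.cz.eq
      rw [e]
      exact key _ h2.zG _ _ f1
    have hc0 : ∀ i : ℕ, c.SameCycle y0 ((c2 ^ i) y0) := by
      intro i
      induction i with
      | zero => exact SameCycle.refl _ _
      | succ i ih =>
        rw [pow_succ', Perm.mul_apply]
        exact f1.trans (key _ h2.cG _ _ ih)
    have hzi : ∀ i : ℕ, c.SameCycle y0 ((z2 ^ i) y0) := by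
      intro i
      induction i with
      | zero => exact SameCycle.refl _ _
      | succ i ih =>
        rw [pow_succ', Perm.mul_apply]
        exact hz0.trans (key _ h2.zG _ _ ih)
    have hcz : ∀ ij : Fin 5 × Fin 3, ∃ k : ℤ, (c ^ k) y0 = (c2 ^ (ij.1 : ℕ)) ((z2 ^ (ij.2 : ℕ)) y0) :=
      fun ij => (hc0 ij.1).trans (key _ (pow_mem h2.cG _) _ _ (hzi ij.2))
    choose f hf using hcz
    have hinj : Function.Injective (fun ij => (f ij : ZMod 5)) := by
      rintro ⟨i, j⟩ ⟨i', j'⟩ e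
      simp only at e
      have e1 := zpow_eq_of_dvd h.d.hc (cast5 e)
      have e2 : (c2 ^ (i : ℕ)) ((z2 ^ (j : ℕ)) y0) = (c2 ^ (i' : ℕ)) ((z2 ^ (j' : ℕ)) y0) := by
        rw [← hf (i, j), ← hf (i', j'), e1]
      have e3 : (c2 ^ ((i : ℤ) - i')) ((z2 ^ ((j : ℤ) - j')) y0) = y0 := by
        have a1 : (c2 ^ ((i : ℤ) - i')) ((z2 ^ ((j : ℤ) - j')) y0)
            = (c2 ^ (-(i' : ℤ))) ((z2 ^ (-(j' : ℤ))) ((c2 ^ (i : ℤ)) ((z2 ^ (j : ℤ)) y0))) := by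
          rw [h2.d.zc, zadd, zadd]
          congr 2
          · congr 1; ring
          · congr 2; ring
        rw [a1, zpow_natCast, zpow_natCast, e2, ← zpow_natCast c2, ← zpow_natCast z2, h2.d.zc,
          zadd, zadd]
        simp
      obtain ⟨d1, d2⟩ := h2.d.free1 _ _ _ e3
      have := i.2; have := i'.2; have := j.2; have := j'.2
      ext <;> push_cast at * <;> omega
    have := Fintype.card_le_of_injective _ hinj
    simp [ZMod.card] at this

theorem Kr_symm (hp : p.Prime) (h1 : Dih p c1 z1 s1) (h2 : Dih p c2 z2 s2) (h : c1 ∈ Kr c2) :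
    c2 ∈ Kr c1 := by
  have : NeZero p := ⟨hp.ne_zero⟩
  intro x
  obtain ⟨off, hoff⟩ := exists_off h2
  let f : ZMod p → ZMod p := fun t => off ((c1 ^ (t.val : ℤ)) x)
  have hpw : ∀ i : ℤ, c2.SameCycle x ((c1 ^ i) x) := fun i => zpow_mem h i x
  have det : ∀ y, c2.SameCycle x y → ∀ y', c2.SameCycle x y' → off y = off y' → y = y' := by
    rintro _ ⟨i, rfl⟩ _ ⟨j, rfl⟩ e
    rw [hoff, hoff] at e
    have e1 := add_left_cancel e
    have : (p : ℤ) ∣ i - j := by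
      rw [← ZMod.intCast_zmod_eq_zero_iff_dvd]; push_cast; rw [e1, sub_self]
    rw [zpow_eq_of_dvd h2.hc this]
  have hf : Function.Injective f := by
    intro t t' e
    have e1 := det _ (hpw _) _ (hpw _) e
    have e2 : (c1 ^ ((t.val : ℤ) - t'.val)) x = x := by
      have : (c1 ^ ((t.val : ℤ) - t'.val)) x = (c1 ^ (-(t'.val : ℤ))) ((c1 ^ (t.val : ℤ)) x) := by
        rw [zadd]; congr 2; ring
      rw [this, e1, zadd]; simp
    have e3 := h1.c_free _ _ e2
    rw [← ZMod.intCast_zmod_eq_zero_iff_dvd] at e3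
    push_cast at e3
    rw [ZMod.natCast_zmod_val, ZMod.natCast_zmod_val] at e3
    exact sub_eq_zero.mp e3
  obtain ⟨t, ht⟩ := (Finite.injective_iff_surjective.mp hf) (off (c2 x))
  exact ⟨_, det _ (hpw _) _ (self_Kr c2 x) ht⟩

theorem triv_good [Finite Ω] (h1 : Base Γ R p c1 z1 s1) (h2 : Snd Γ p c2 z2 s2) (o : Ω)
    (hall : ∀ g, g ∈ autG Γ) : Good Γ R c2 z2 s2 := by
  classical
  have : Fintype Ω := Fintype.ofFinite _
  have key : ∀ c z s : Perm Ω, Dih p c z s → ∃ n, c.cycleType = Multiset.replicate (n + 1) p ∧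
      (n + 1) * p = Fintype.card Ω := by
    intro c z s h
    have hfix : ∀ x, c x ≠ x := by
      intro x hx
      have := h.c_free 1 x (by simpa using hx)
      have := Int.le_of_dvd one_pos this
      have := h1.hp3
      omega
    have ho : orderOf c = p := by
      have hd := orderOf_dvd_of_pow_eq_one h.hc
      rcases (Nat.dvd_prime h1.hp).mp hd with h3 | h3
      · rw [orderOf_eq_one_iff] at h3
        exact absurd (by rw [h3]; rfl) (hfix o)
      · exact h3
    obtain ⟨n, hn⟩ := cycleType_prime_order (σ := c) (by rw [ho]; exact h1.hp)
    rw [ho] at hn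
    refine ⟨n, hn, ?_⟩
    have hs := sum_cycleType c
    rw [hn, Multiset.sum_replicate, smul_eq_mul] at hs
    rw [hs, ← Finset.card_univ]
    congr 1
    rw [Finset.eq_univ_iff_forall]
    intro x; exact mem_support.mpr (hfix x)
  obtain ⟨n, hn, hn'⟩ := key _ _ _ h1.d
  obtain ⟨m, hm, hm'⟩ := key _ _ _ h2.d
  have : n + 1 = m + 1 := Nat.eq_of_mul_eq_mul_right h1.hp.pos (hn'.trans hm'.symm)
  have hconj : IsConj c2 c1 := by
    rw [isConj_iff_cycleType_eq, hn, hm, this]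
  obtain ⟨φ, hφ⟩ := isConj_iff.mp hconj
  apply Good.of_conj (hall φ)
  exact cpow_good h1 (h2.conj (hall φ)) o (a := 1) (by rw [hφ, zpow_one])

theorem main_good [Finite Ω] (h1 : Base Γ R p c1 z1 s1) (h2 : Snd Γ p c2 z2 s2) (o : Ω) :
    Good Γ R c2 z2 s2 := by
  obtain ⟨h, hh, P, hPG, hP, cP, cP2⟩ := sylow_conj (autG Γ) p h1.hp
    (x := c1) (y := c2) (n := 1) (m := 1) h1.cG h2.cG
    (by simpa using h1.d.hc) (by simpa using h2.d.hc)
  apply Good.of_conj hh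
  have h2' := h2.conj hh
  clear h2
  generalize h * c2 * h⁻¹ = c2' at *
  generalize h * z2 * h⁻¹ = z2' at *
  generalize h * s2 * h⁻¹ = s2' at *
  by_cases k1 : P ≤ Kr c1
  · exact same_good h1 h2' o (k1 cP2)
  by_cases k2 : P ≤ Kr c2'
  · exact same_good h1 h2' o (Kr_symm h1.hp h1.d h2'.d (k2 cP))
  obtain ⟨q1, q1P, q1A, q1K, q1c⟩ := mover h1.hp h1.d.hc hP cP k1
  obtain ⟨q2, q2P, q2A, q2K, q2c⟩ := mover h1.hp h2'.d.hc hP cP2 k2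
  have pel : ∀ q ∈ P, ∃ n, q ^ p ^ n = 1 := by
    intro q hq
    obtain ⟨n, hn⟩ := hP ⟨q, hq⟩
    exact ⟨n, by simpa using congrArg Subtype.val hn⟩
  obtain ⟨n1, hn1⟩ := pel q1 q1P
  obtain ⟨n2, hn2⟩ := pel q2 q2P
  obtain ⟨p5, x1, a1, a2, -, a4⟩ := five_of_move h1.hp h1.hp3 (h1.d.card_blk o) hn1 q1A q1K
  obtain ⟨-, x2, b1, b2, -, b4⟩ := five_of_move h1.hp h1.hp3 (h2'.d.card_blk o) hn2 q2A q2K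
  subst p5
  have F1 : Five c1 q1 x1 := ⟨q1A, a1, a2, a4⟩
  have F2 : Five c2' q2 x2 := ⟨q2A, b1, b2, b4⟩
  have h1' : Snd Γ 5 c1 z1 s1 := ⟨h1.d, h1.cG, h1.zG, h1.sG⟩
  rcases NU_dich h1' (hPG q1P) F1 with N1 | U1
  swap
  · rcases Ucase h1' h2' (hPG q1P) F1 U1 with h3 | h3
    · exact triv_good h1 h2' o h3
    · exact same_good h1 h2' o h3
  rcases NU_dich h2' (hPG q2P) F2 with N2 | U2
  swap
  · rcases Ucase h2' h1' (hPG q2P) F2 U2 with h3 | h3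
    · exact triv_good h1 h2' o h3
    · exact same_good h1 h2' o (Kr_symm h1.hp h1.d h2'.d h3)
  have ker : ∀ c z s : Perm Ω, Snd Γ 5 c z s → c ∈ P → (∀ x y, ¬ c.SameCycle x y → NU Γ c x y) →
      ∀ g ∈ P, g ∈ Kr c → ∃ k : ℤ, g = c ^ k := by
    intro c z s hS hcP hN g hg hgK
    refine kernel_c h1.hp hS.d o hS.cG hN (hPG hg) ?_
    refine hS.d.TT_of_pgroup h1.hp (P := P ⊓ Kr c) (hP.to_le inf_le_left) ⟨hcP, self_Kr c⟩
      ⟨hg, hgK⟩ (fun w hw => hw.2)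
  have q1c' := q1c (ker _ _ _ h1' cP N1)
  have q2c' := q2c (ker _ _ _ h2' cP2 N2)
  obtain ⟨row1, I1, J1, G1, k, hk⟩ := mk_grid h1.d h1.cG h1.zG N1 (hPG q1P) q1c' F1
  obtain ⟨row2, I2, J2, G2, -⟩ := mk_grid h2'.d h2'.cG h2'.zG N2 (hPG q2P) q2c' F2
  have fx1 := pfix h1.d hP cP q1P F1
  have fx2 := pfix h2'.d hP cP2 q2P F2
  -- the two special blocks agree
  have hx12 : c1.SameCycle x1 x2 := by
    by_contra hne
    obtain ⟨k, hk⟩ := L1 h1.hp hP cP2 h2'.d.hc (fun i => h2'.d.c_free i x2) fx2 cP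
    have hkz : ∀ l : ℕ, (c1 ^ l) x2 = (c2' ^ (l * k)) x2 := by
      intro l
      induction l with
      | zero => simp
      | succ l ih =>
        rw [pow_succ', Perm.mul_apply, ih, hk]; congr 2; push_cast; ring
    have hk5 : ¬ ((5 : ℕ) : ℤ) ∣ k := by
      intro h5
      have e := hkz 1
      have e' : (c1 ^ (1 : ℤ)) x2 = x2 := by
        rw [zpow_one]
        rw [pow_one, zpow_eq_of_dvd h2'.d.hc (j := 0) (by simpa using h5)] at e
        simpa using e
      have := h1.d.c_free 1 x2 e'
      omega
    obtain ⟨m, hm⟩ := fx2 q1 q1P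
    obtain ⟨l, hl⟩ := zpow_solve h1.hp hk5 m
    apply F1.f2 x2 hne
    have h0 : 0 ≤ l % 5 := Int.emod_nonneg _ (by norm_num)
    refine ⟨(l % 5).toNat, ?_⟩
    rw [zpow_natCast, hkz, ← hm]
    congr 1
    refine zpow_eq_of_dvd h2'.d.hc ?_
    rw [Int.toNat_of_nonneg h0]
    have e2 : l % 5 = l - 5 * (l / 5) := by omega
    have e3 : l % 5 * k - m = (l * k - m) - ((5 : ℕ) : ℤ) * (l / 5 * k) := by
      rw [e2]; push_cast; ring
    rw [e3]
    exact dvd_sub hl (dvd_mul_right _ _)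
  have fx2' : ∀ g ∈ P, c2'.SameCycle x1 (g x1) := by
    intro g hg
    obtain ⟨i, hi⟩ := hx12.symm
    rw [← hi]
    have e1 := fx2 (c1 ^ i) (zpow_mem cP i)
    have e2 := fx2 _ (mul_mem hg (zpow_mem cP i))
    exact e1.symm.trans e2
  have q1k : q1 * c1 ^ k ∈ P := mul_mem q1P (zpow_mem cP k)
  have F1' := F1.mulc q1c' k
  obtain ⟨a, ha⟩ := fx1 c2' cP2
  have ha0 : ¬ ((5 : ℕ) : ℤ) ∣ a := by
    intro h5
    rw [zpow_eq_of_dvd h1.d.hc (j := 0) (by simpa using h5)] at ha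
    have := h2'.d.c_free 1 x1 (by simpa using ha.symm)
    omega
  obtain ⟨m, hm⟩ := zpow_solve h1.hp ha0 1
  have e5 : c2' = (c2' ^ m) ^ a := by
    rw [← zpow_mul, zpow_eq_of_dvd h2'.d.hc hm, zpow_one]
  apply Good.of_cpow a e5
  have G2' := G2.cpow h2'.d.hc hm
  refine combine h1 ⟨h2'.d.cpow h1.hp m a e5, zpow_mem h2'.cG m, h2'.zG, h2'.sG⟩ G1 G2' hP hPG cP
    (zpow_mem cP2 m) fx1 ?_ ?_ q1k F1' hk
  · intro g hg
    obtain ⟨i, hi⟩ := fx2' g hg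
    exact ⟨a * i, by rw [zpow_mul, ← e5, hi]⟩
  · -- c2 ^ m agrees with c1 at x1
    obtain ⟨k', hk'⟩ := L1 h1.hp hP cP h1.d.hc (fun i => h1.d.c_free i x1) fx1 cP2
    have e0 : c2' x1 = (c1 ^ k') x1 := by simpa using hk' 0
    have eo : (5 : ℤ) ∣ k' - a := by
      have e6 : (c1 ^ (k' - a)) x1 = x1 := by
        have : (c1 ^ (k' - a)) x1 = (c1 ^ (-a)) ((c1 ^ k') x1) := by rw [zadd]; congr 2; ring
        rw [this, ← e0, ← ha, zadd]; simp
      exact_mod_cast h1.d.c_free _ _ e6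
    have hkz : ∀ l : ℕ, (c2' ^ l) x1 = (c1 ^ (l * k')) x1 := by
      intro l
      induction l with
      | zero => simp
      | succ l ih =>
        rw [pow_succ', Perm.mul_apply, ih, hk']; congr 2; push_cast; ring
    have h0 : 0 ≤ m % 5 := Int.emod_nonneg _ (by norm_num)
    have e7 : c2' ^ m = c2' ^ ((m % 5).toNat : ℤ) := by
      refine zpow_eq_of_dvd h2'.d.hc ?_
      rw [Int.toNat_of_nonneg h0]
      omega
    rw [e7, zpow_natCast, hkz]
    have e8 : c1 ^ (((m % 5).toNat : ℤ) * k') = c1 ^ (1 : ℤ) := by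
      refine zpow_eq_of_dvd h1.d.hc ?_
      rw [Int.toNat_of_nonneg h0]
      have e2 : m % 5 = m - 5 * (m / 5) := by omega
      have e3 : m % 5 * k' - 1 = (m * a - 1) + m * (k' - a) - ((5 : ℕ) : ℤ) * (m / 5 * k') := by
        rw [e2]; push_cast; ring
      rw [e3]
      refine dvd_sub (dvd_add hm (Dvd.dvd.mul_left (by exact_mod_cast eo) _)) (dvd_mul_right _ _)
    rw [e8, zpow_one]

end main
end D6
namespace D6
open Equiv Equiv.Perm
open scoped Pointwise
section bridge
variable {D : Type*} [Group D]

/-- permutations commuting with all left multiplications, i.e. right multiplications -/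
def rightReg (D : Type*) [Group D] : Subgroup (Perm D) where
  carrier := {g | ∀ a x, g (a * x) = a * g x}
  mul_mem' := by
    intro g h hg hh a x
    simp only [Set.mem_ofPred_eq, Perm.mul_apply] at *
    rw [hh, hg]
  one_mem' := by intro a x; simp
  inv_mem' := by
    intro g hg a x
    simp only [Set.mem_ofPred_eq] at *
    apply g.injective
    rw [hg, apinv, apinv]

theorem mem_rightReg {g : Perm D} : g ∈ rightReg D ↔ ∀ a x, g (a * x) = a * g x := Iff.rfl

theorem rightReg_apply {g : Perm D} (h : g ∈ rightReg D) (x : D) : g x = x * g 1 := by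
  have := h x 1
  rwa [mul_one] at this

theorem mulRight_mem (a : D) : Equiv.mulRight a ∈ rightReg D := by
  intro x y
  simp [mul_assoc]

theorem rightReg_aut {g : Perm D} (h : g ∈ rightReg D) (S : Set D) :
    g ∈ autG (fun x y : D => y * x⁻¹ ∈ S) := by
  intro x y
  show g y * (g x)⁻¹ ∈ S ↔ y * x⁻¹ ∈ S
  rw [rightReg_apply h x, rightReg_apply h y]
  have : y * g 1 * (x * g 1)⁻¹ = y * x⁻¹ := by group
  rw [this]

theorem mulRight_zpow (a : D) (i : ℤ) : (Equiv.mulRight a) ^ i = Equiv.mulRight (a ^ i) := by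
  simp

variable {p : ℕ}

theorem r_zpow (n : ℕ) (a i : ℤ) :
    (DihedralGroup.r (a : ZMod n)) ^ i = DihedralGroup.r ((a * i : ℤ) : ZMod n) := by
  simp

theorem dih_std (hp : p.Prime) (hp3 : 3 < p) :
    Dih p (Equiv.mulRight (DihedralGroup.r ((3 : ℤ) : ZMod (3 * p))))
      (Equiv.mulRight (DihedralGroup.r ((p : ℤ) : ZMod (3 * p))))
      (Equiv.mulRight (DihedralGroup.sr (0 : ZMod (3 * p)))) := by
  have hcop : IsCoprime (p : ℤ) 3 := by
    have : Nat.Coprime p 3 := (Nat.coprime_primes hp Nat.prime_three).2 (by omega)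
    exact_mod_cast Nat.isCoprime_iff_coprime.2 this
  have key : ∀ (i j : ℤ) (x : DihedralGroup (3 * p)),
      ((Equiv.mulRight (DihedralGroup.r ((3 : ℤ) : ZMod (3 * p)))) ^ i)
      (((Equiv.mulRight (DihedralGroup.r ((p : ℤ) : ZMod (3 * p)))) ^ j) x) =
      x * DihedralGroup.r (((3 * i + p * j : ℤ)) : ZMod (3 * p)) := by
    intro i j x
    rw [mulRight_zpow, mulRight_zpow, r_zpow, r_zpow]
    simp only [Equiv.coe_mulRight, mul_assoc, DihedralGroup.r_mul_r]
    congr 2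
    push_cast; ring
  have cast0 : ∀ m : ℤ, ((m : ZMod (3 * p)) = 0 ↔ (3 * (p : ℤ)) ∣ m) := by
    intro m
    rw [ZMod.intCast_zmod_eq_zero_iff_dvd]
    push_cast; rfl
  refine ⟨?_, ?_, ?_, ?_, ?_, ?_, ?_, ?_, ?_⟩
  · rw [← zpow_natCast, mulRight_zpow, r_zpow, (cast0 _).2 (dvd_refl _)]
    ext x; simp
  · rw [← zpow_natCast, mulRight_zpow, r_zpow, (cast0 _).2 ⟨1, by push_cast; ring⟩]
    ext x; simp
  · ext x; simp [mul_assoc]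
  · show _ * _ = _ * _
    ext x; simp [mul_assoc, add_comm]
  · rw [Equiv.Perm.inv_def]
    ext x; simp [mul_assoc]
  · rw [Equiv.Perm.inv_def]
    ext x; simp [mul_assoc]
  · intro o y
    have surj : ∀ k : ZMod (3 * p), ∃ i j : ℤ, k = ((3 * i + p * j : ℤ) : ZMod (3 * p)) := by
      intro k
      obtain ⟨m, rfl⟩ := ZMod.intCast_surjective k
      obtain ⟨u, v, huv⟩ := hcop
      refine ⟨v * m, u * m, ?_⟩
      congr 1
      linear_combination (-m) * huv
    rcases h : o⁻¹ * y with k | k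
    · left
      obtain ⟨i, j, hk⟩ := surj k
      refine ⟨i, j, ?_⟩
      rw [key, ← hk, ← h]; simp
    · right
      obtain ⟨i, j, hk⟩ := surj k
      refine ⟨i, j, ?_⟩
      rw [key, ← hk]
      simp only [Equiv.coe_mulRight, mul_assoc, DihedralGroup.sr_mul_r, zero_add]
      rw [← h]; simp
  · intro i j x h
    rw [key, mul_eq_left, DihedralGroup.one_def] at h
    have h2 : ((3 * i + p * j : ℤ) : ZMod (3 * p)) = 0 := by
      injection h
    rw [cast0] at h2
    constructor
    · have : (p : ℤ) ∣ 3 * i + p * j := (dvd_mul_left _ _).trans h2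
      have : (p : ℤ) ∣ 3 * i := (Int.dvd_add_left (dvd_mul_right _ _)).1 this
      exact hcop.dvd_of_dvd_mul_left this
    · have : (3 : ℤ) ∣ 3 * i + p * j := (dvd_mul_right _ _).trans h2
      have : (3 : ℤ) ∣ p * j := (Int.dvd_add_right (dvd_mul_right _ _)).1 this
      exact hcop.symm.dvd_of_dvd_mul_left this
  · intro i j x h
    rw [key] at h
    simp only [Equiv.coe_mulRight, mul_assoc, DihedralGroup.sr_mul_r, zero_add] at h
    rw [mul_eq_left, DihedralGroup.one_def] at h
    injection h

theorem iso_aut (hp : p.Prime) (hp3 : 3 < p) (S T : Set (DihedralGroup (3 * p)))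
    (e : DihedralGroup (3 * p) ≃ DihedralGroup (3 * p))
    (he : ∀ x y, y * x⁻¹ ∈ S ↔ e y * (e x)⁻¹ ∈ T) :
    ∃ f : MulAut (DihedralGroup (3 * p)), ∀ x, x ∈ S ↔ f x ∈ T := by
  have : NeZero (3 * p) := ⟨by have := hp.pos; omega⟩
  have hd := dih_std hp hp3
  set c := Equiv.mulRight (DihedralGroup.r ((3 : ℤ) : ZMod (3 * p))) with hc
  set z := Equiv.mulRight (DihedralGroup.r ((p : ℤ) : ZMod (3 * p))) with hz
  set s := Equiv.mulRight (DihedralGroup.sr (0 : ZMod (3 * p))) with hs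
  have cR : c ∈ rightReg (DihedralGroup (3 * p)) := mulRight_mem _
  have zR : z ∈ rightReg (DihedralGroup (3 * p)) := mulRight_mem _
  have sR : s ∈ rightReg (DihedralGroup (3 * p)) := mulRight_mem _
  have b : Base (fun x y : DihedralGroup (3 * p) => y * x⁻¹ ∈ S) (rightReg _) p c z s :=
    ⟨hd, hp, hp3, rightReg_aut cR S, rightReg_aut zR S, rightReg_aut sR S, cR, zR, sR⟩
  have tr : ∀ g ∈ rightReg (DihedralGroup (3 * p)),
      (e : Perm (DihedralGroup (3 * p)))⁻¹ * g * (e : Perm (DihedralGroup (3 * p)))⁻¹⁻¹ ∈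
        autG (fun x y : DihedralGroup (3 * p) => y * x⁻¹ ∈ S) := by
    intro g hg x y
    show e.symm (g (e y)) * (e.symm (g (e x)))⁻¹ ∈ S ↔ y * x⁻¹ ∈ S
    rw [he, he]
    simp only [Equiv.apply_symm_apply]
    exact rightReg_aut hg T (e x) (e y)
  have b2 : Snd (fun x y : DihedralGroup (3 * p) => y * x⁻¹ ∈ S) p _ _ _ :=
    ⟨hd.conj (e : Perm (DihedralGroup (3 * p)))⁻¹, tr c cR, tr z zR, tr s sR⟩
  obtain ⟨φ, hφ, h1, h2, h3⟩ := main_good b b2 1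
  set f : Perm (DihedralGroup (3 * p)) := e * φ⁻¹ with hf
  have hfS : ∀ x y, y * x⁻¹ ∈ S ↔ f y * (f x)⁻¹ ∈ T := by
    intro x y
    rw [← (mem_autG.1 (inv_mem hφ)) x y, he]; rfl
  have conjmem : ∀ g, φ * ((e : Perm (DihedralGroup (3 * p)))⁻¹ * g *
      (e : Perm (DihedralGroup (3 * p)))⁻¹⁻¹) * φ⁻¹ = f⁻¹ * g * f⁻¹⁻¹ := by
    intro g; rw [hf]; group
  rw [conjmem] at h1 h2 h3
  have hall : ∀ g ∈ rightReg (DihedralGroup (3 * p)), f⁻¹ * g * f⁻¹⁻¹ ∈ rightReg _ := by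
    have hsub : ∀ g ∈ rightReg (DihedralGroup (3 * p)),
        g ∈ (rightReg (DihedralGroup (3 * p))).comap (MulAut.conj f⁻¹).toMonoidHom := by
      intro g hg
      have c' : c ∈ (rightReg (DihedralGroup (3 * p))).comap (MulAut.conj f⁻¹).toMonoidHom := h1
      have z' : z ∈ (rightReg (DihedralGroup (3 * p))).comap (MulAut.conj f⁻¹).toMonoidHom := h2
      have s' : s ∈ (rightReg (DihedralGroup (3 * p))).comap (MulAut.conj f⁻¹).toMonoidHom := h3
      have eqg : ∀ k ∈ rightReg (DihedralGroup (3 * p)), g 1 = k 1 → g = k := by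
        intro k hk h
        ext x
        rw [rightReg_apply hg x, rightReg_apply hk x, h]
      rcases hd.cov 1 (g 1) with ⟨i, j, h⟩ | ⟨i, j, h⟩
      · rw [eqg (c ^ i * z ^ j) (mul_mem (zpow_mem cR _) (zpow_mem zR _)) h]
        exact mul_mem (zpow_mem c' _) (zpow_mem z' _)
      · rw [eqg (c ^ i * z ^ j * s) (mul_mem (mul_mem (zpow_mem cR _) (zpow_mem zR _)) sR) h]
        exact mul_mem (mul_mem (zpow_mem c' _) (zpow_mem z' _)) s'
    exact hsub
  -- normalise
  set k : Perm (DihedralGroup (3 * p)) := Equiv.mulRight (f 1)⁻¹ * f with hk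
  have k1 : k 1 = 1 := by simp [hk]
  have hkS : ∀ x y, y * x⁻¹ ∈ S ↔ k y * (k x)⁻¹ ∈ T := by
    intro x y
    rw [hfS]
    exact (rightReg_aut (mulRight_mem (f 1)⁻¹) T (f x) (f y)).symm
  have hkr : ∀ g ∈ rightReg (DihedralGroup (3 * p)), k⁻¹ * g * k ∈ rightReg _ := by
    intro g hg
    have := hall ((Equiv.mulRight (f 1)⁻¹)⁻¹ * g * (Equiv.mulRight (f 1)⁻¹))
      (mul_mem (mul_mem (inv_mem (mulRight_mem _)) hg) (mulRight_mem _))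
    have e2 : k⁻¹ * g * k = f⁻¹ * ((Equiv.mulRight (f 1)⁻¹)⁻¹ * g * (Equiv.mulRight (f 1)⁻¹))
        * f⁻¹⁻¹ := by rw [hk]; group
    rw [e2]; exact this
  have hmul : ∀ x y, k (x * y) = k x * k y := by
    intro x y
    have h := rightReg_apply (hkr (Equiv.mulRight (k y)) (mulRight_mem _)) x
    have h4 : (k⁻¹ * Equiv.mulRight (k y) * k) 1 = y := by
      simp [Perm.mul_apply, k1]
    rw [h4] at h
    rw [← h]
    simp only [Perm.mul_apply, apinv]; rfl
  refine ⟨MulEquiv.mk k hmul, ?_⟩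
  intro x
  have := hkS 1 x
  rw [k1] at this
  simpa using this

theorem aut_iso {S T : Set D} (f : MulAut D) (h : ∀ x, x ∈ S ↔ f x ∈ T) :
    ∃ e : D ≃ D, ∀ x y : D, y * x⁻¹ ∈ S ↔ e y * (e x)⁻¹ ∈ T := by
  refine ⟨f.toEquiv, fun x y => ?_⟩
  rw [h]; simp

end bridge
end D6
namespace D6
open Equiv Equiv.Perm
open scoped Pointwise
section burnside

theorem cycles {X : Type*} [Finite X] (σ : Perm X) (N : ℕ) (hN : 0 < N) (h : σ ^ N = 1) :
    ∃ q : ℕ, Nat.card {S : Set X // ∀ x, σ x ∈ S ↔ x ∈ S} = 2 ^ q ∧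
      N * q = ∑ k ∈ Finset.range N, Nat.card {x : X // (σ ^ k) x = x} := by
  classical
  have : NeZero N := ⟨hN.ne'⟩
  let f : ZMod N →+ Additive (Perm X) := ZMod.lift N ⟨zmultiplesHom _ (Additive.ofMul σ), by
    simp [← ofMul_pow, h]⟩
  have hf : ∀ k : ℕ, f (k : ZMod N) = Additive.ofMul (σ ^ k) := by
    intro k
    have : ((k : ℤ) : ZMod N) = (k : ZMod N) := by simp
    rw [← this]
    show ZMod.lift N _ _ = _
    rw [ZMod.lift_coe]
    simp
  let F : Multiplicative (ZMod N) →* Perm X := AddMonoidHom.toMultiplicativeLeft f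
  let _ : MulAction (Multiplicative (ZMod N)) X := MulAction.compHom X F
  have hs : ∀ (k : ℕ) (x : X), (Multiplicative.ofAdd (k : ZMod N)) • x = (σ ^ k) x := by
    intro k x
    show (Additive.toMul (f (k : ZMod N))) x = _
    rw [hf]; rfl
  let _ : Fintype X := Fintype.ofFinite X
  have key := MulAction.sum_card_fixedBy_eq_card_orbits_mul_card_group (Multiplicative (ZMod N)) X
  refine ⟨Fintype.card (Quotient (MulAction.orbitRel (Multiplicative (ZMod N)) X)), ?_, ?_⟩
  · have e : {S : Set X // ∀ x, σ x ∈ S ↔ x ∈ S} ≃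
        (Quotient (MulAction.orbitRel (Multiplicative (ZMod N)) X) → Prop) := by
      refine ⟨fun S => Quotient.lift (fun x => x ∈ S.1) ?_,
        fun P => ⟨{x | P (Quotient.mk _ x)}, ?_⟩, ?_, ?_⟩
      · rintro x y ⟨g, hg⟩
        obtain ⟨k, hk⟩ := ZMod.natCast_zmod_surjective (Multiplicative.toAdd g)
        have hg2 : (σ ^ k) y = x := by
          rw [← hs, hk]; exact hg
        have : ∀ (k : ℕ) (y : X), (σ ^ k) y ∈ S.1 ↔ y ∈ S.1 := by
          intro k
          induction k with
          | zero => intro y; simp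
          | succ k ih => intro y; rw [pow_succ', Perm.mul_apply, S.2, ih]
        rw [← hg2]
        exact propext (this k y)
      · intro x
        have : (Quotient.mk (MulAction.orbitRel (Multiplicative (ZMod N)) X) (σ x)) =
            Quotient.mk _ x := by
          apply Quotient.sound
          refine ⟨Multiplicative.ofAdd ((1 : ℕ) : ZMod N), ?_⟩
          show _ • x = σ x
          rw [hs, pow_one]
        simp only [Set.mem_ofPred_eq, this]
      · intro S; rfl
      · intro P
        funext y
        induction y using Quotient.inductionOn
        rfl
    rw [Nat.card_congr e, Nat.card_fun]
    simp [Nat.card_eq_fintype_card]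
  · have e1 : Fintype.card (Multiplicative (ZMod N)) = N := by
      rw [Fintype.card_multiplicative, ZMod.card]
    rw [e1] at key
    rw [mul_comm, ← key]
    symm
    refine Finset.sum_bij (fun k _ => Multiplicative.ofAdd (k : ZMod N)) ?_ ?_ ?_ ?_
    · intros; simp
    · intro a ha b hb hab
      have h1 : (a : ZMod N) = b := hab
      rw [ZMod.natCast_eq_natCast_iff] at h1
      exact Nat.ModEq.eq_of_lt_of_lt h1 (Finset.mem_range.1 ha) (Finset.mem_range.1 hb)
    · intro g _
      refine ⟨(Multiplicative.toAdd g).val, Finset.mem_range.2 (ZMod.val_lt _), ?_⟩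
      rw [ZMod.natCast_zmod_val]; rfl
    · intro k _
      rw [← Nat.card_eq_fintype_card]
      refine Nat.card_congr (Equiv.subtypeEquivRight ?_)
      intro x
      rw [MulAction.mem_fixedBy, hs]

theorem inv_not_mem {X : Type*} [Finite X] (σ : Perm X) (x0 : X) (h : σ x0 = x0) :
    Nat.card {S : Set X // ∀ x, σ x ∈ S ↔ x ∈ S} =
      2 * Nat.card {S : Set X // x0 ∉ S ∧ ∀ x, σ x ∈ S ↔ x ∈ S} := by
  classical
  have h' : ∀ x, σ x = x0 ↔ x = x0 := by
    intro x
    constructor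
    · intro hx; apply σ.injective; rw [hx, h]
    · rintro rfl; exact h
  have e : {S : Set X // ∀ x, σ x ∈ S ↔ x ∈ S} ≃
      Prop × {S : Set X // x0 ∉ S ∧ ∀ x, σ x ∈ S ↔ x ∈ S} := by
    refine ⟨fun S => (x0 ∈ S.1, ⟨S.1 \ {x0}, by simp, ?_⟩),
      fun P => ⟨{x | (x = x0 ∧ P.1) ∨ x ∈ P.2.1}, ?_⟩, ?_, ?_⟩
    · intro x; simp only [Set.mem_sdiff, Set.mem_singleton_iff, h', S.2]
    · intro x; simp only [Set.mem_ofPred_eq, h', P.2.2.2]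
    · intro S
      apply Subtype.ext
      ext x
      simp only [Set.mem_ofPred_eq, Set.mem_sdiff, Set.mem_singleton_iff]
      by_cases hx : x = x0 <;> simp [hx]
    · rintro ⟨P, S, hS, hS2⟩
      refine Prod.ext ?_ (Subtype.ext ?_)
      · simp [hS]
      · ext x
        simp only [Set.mem_ofPred_eq, Set.mem_sdiff, Set.mem_singleton_iff]
        by_cases hx : x = x0 <;> simp [hx, hS]
  rw [Nat.card_congr e, Nat.card_prod]
  simp

theorem burnside_sets {D : Type*} [Group D] [Finite D] [Fintype (MulAut D)] :
    2 * Nat.card (Quot fun S T : {S : Set D // (1 : D) ∉ S} =>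
      ∃ f : MulAut D, ∀ x, x ∈ S.1 ↔ f x ∈ T.1) * Fintype.card (MulAut D) =
    ∑ f : MulAut D, Nat.card {S : Set D // ∀ x, f x ∈ S ↔ x ∈ S} := by
  classical
  let act : MulAction (MulAut D) {S : Set D // (1 : D) ∉ S} :=
    { smul := fun f S => ⟨{x | f⁻¹ x ∈ S.1}, by
        simpa using S.2⟩
      one_smul := by intro S; rfl
      mul_smul := by intro f g S; rfl }
  have hmem : ∀ (f : MulAut D) (S : {S : Set D // (1 : D) ∉ S}) (x : D),
    x ∈ (f • S).1 ↔ f⁻¹ x ∈ S.1 := fun _ _ _ => Iff.rfl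
  let _ : Fintype {S : Set D // (1 : D) ∉ S} := Fintype.ofFinite _
  let _ : Fintype (Quotient (MulAction.orbitRel (MulAut D) {S : Set D // (1 : D) ∉ S})) :=
    Fintype.ofFinite _
  have key := MulAction.sum_card_fixedBy_eq_card_orbits_mul_card_group (MulAut D)
    {S : Set D // (1 : D) ∉ S}
  have e : Nat.card (Quot fun S T : {S : Set D // (1 : D) ∉ S} =>
      ∃ f : MulAut D, ∀ x, x ∈ S.1 ↔ f x ∈ T.1) =
      Fintype.card (Quotient (MulAction.orbitRel (MulAut D) {S : Set D // (1 : D) ∉ S})) := by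
    rw [← Nat.card_eq_fintype_card]
    refine Nat.card_congr (Quot.congr (Equiv.refl _) ?_)
    intro S T
    show _ ↔ MulAction.orbitRel _ _ S T
    rw [MulAction.orbitRel_apply, MulAction.mem_orbit_iff]
    constructor
    · rintro ⟨f, hf⟩
      refine ⟨f⁻¹, Subtype.ext (Set.ext fun x => ?_)⟩
      rw [hmem, inv_inv]; exact (hf x).symm
    · rintro ⟨f, hf⟩
      refine ⟨f⁻¹, fun x => ?_⟩
      rw [← hmem, hf]
  rw [e, mul_assoc, ← key, Finset.mul_sum]
  refine Finset.sum_congr rfl fun f _ => ?_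
  refine Eq.trans ?_ (inv_not_mem (f.toEquiv : Perm D) 1 (map_one f)).symm
  rw [← Nat.card_eq_fintype_card]
  congr 1
  refine Nat.card_congr ⟨fun S => ⟨S.1.1, S.1.2, ?_⟩, fun S => ⟨⟨S.1, S.2.1⟩, ?_⟩, ?_, ?_⟩
  · intro x
    have := S.2
    rw [MulAction.mem_fixedBy] at this
    conv_lhs => rw [← this]
    rw [hmem]
    simp
  · rw [MulAction.mem_fixedBy]
    refine Subtype.ext (Set.ext fun x => ?_)
    rw [hmem]
    have := S.2.2 (f⁻¹ x)
    rw [← this]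
    simp
  · intro S; rfl
  · intro S; rfl

end burnside
end D6
namespace D6
open Equiv Equiv.Perm
open scoped Pointwise
section autos

/-- the automorphism `r i ↦ r (a i)`, `sr i ↦ sr (a i + b)` -/
def affAut {n : ℕ} (a : (ZMod n)ˣ) (b : ZMod n) : MulAut (DihedralGroup n) where
  toFun x := match x with
    | .r i => .r (a * i)
    | .sr i => .sr (a * i + b)
  invFun x := match x with
    | .r i => .r ((a⁻¹ : (ZMod n)ˣ) * i)
    | .sr i => .sr ((a⁻¹ : (ZMod n)ˣ) * (i - b))
  left_inv x := by
    rcases x with i | i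
    · simp
    · simp
  right_inv x := by
    rcases x with i | i
    · simp
    · simp
  map_mul' x y := by
    rcases x with i | i <;> rcases y with j | j <;>
      simp <;> ring

theorem affAut_r {n : ℕ} (a : (ZMod n)ˣ) (b i : ZMod n) :
    affAut a b (.r i) = .r (a * i) := rfl
theorem affAut_sr {n : ℕ} (a : (ZMod n)ˣ) (b i : ZMod n) :
    affAut a b (.sr i) = .sr (a * i + b) := rfl

theorem affAut_bij {n : ℕ} (hn : 2 < n) :
    Function.Bijective (fun ab : (ZMod n)ˣ × ZMod n => affAut ab.1 ab.2) := by
  have : NeZero n := ⟨by omega⟩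
  have h2 : (2 : ZMod n) ≠ 0 := by
    intro h
    have : ((2 : ℕ) : ZMod n) = 0 := by exact_mod_cast h
    rw [ZMod.natCast_eq_zero_iff] at this
    exact absurd (Nat.le_of_dvd (by norm_num) this) (by omega)
  constructor
  · rintro ⟨a, b⟩ ⟨a', b'⟩ h
    have e1 := congrArg (fun f : MulAut (DihedralGroup n) => f (.r 1)) h
    have e2 := congrArg (fun f : MulAut (DihedralGroup n) => f (.sr 0)) h
    simp only [affAut_r, affAut_sr, mul_one, mul_zero, zero_add] at e1 e2
    injection e1 with e1
    injection e2 with e2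
    rw [Units.ext e1, e2]
  · intro f
    have hr : ∀ f : MulAut (DihedralGroup n), ∃ a : ZMod n, ∀ i, f (.r i) = .r (a * i) := by
      intro f
      rcases h : f (.r 1) with a | k
      · refine ⟨a, fun i => ?_⟩
        have : (DihedralGroup.r i : DihedralGroup n) = (.r 1) ^ i.val := by
          rw [DihedralGroup.r_one_pow, ZMod.natCast_zmod_val]
        rw [this, map_pow, h, DihedralGroup.r_pow, ZMod.natCast_zmod_val]
      · exfalso
        have e : f (.r 2) = 1 := by
          have : (DihedralGroup.r 2 : DihedralGroup n) = .r 1 * .r 1 := by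
            rw [DihedralGroup.r_mul_r]; norm_num
          rw [this, map_mul, h]; simp
        have e3 := (map_eq_one_iff f f.injective).1 e
        rw [DihedralGroup.one_def] at e3
        injection e3 with e3
        exact h2 e3
    obtain ⟨a, ha⟩ := hr f
    obtain ⟨a', ha'⟩ := hr f⁻¹
    have haa : a * a' = 1 := by
      have : f (f⁻¹ (.r 1)) = .r 1 := by simp
      rw [ha', ha] at this
      injection this with this
      rw [← this]; ring
    let u : (ZMod n)ˣ := ⟨a, a', haa, by rw [mul_comm, haa]⟩
    rcases h : f (.sr 0) with k | b
    · exfalso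
      have e1 : f (.r (a' * k)) = .r k := by rw [ha, ← mul_assoc, haa, one_mul]
      have := f.injective (h.trans e1.symm)
      injection this
    · refine ⟨(u, b), ?_⟩
      ext x
      rcases x with i | i
      · show affAut u b (.r i) = _
        rw [affAut_r, ha]
      · show affAut u b (.sr i) = _
        have e1 : (DihedralGroup.sr i : DihedralGroup n) = .sr 0 * .r i := by simp
        rw [affAut_sr, e1, map_mul, h, ha, DihedralGroup.sr_mul_r, add_comm]

/-- number of fixed points of the `k`-th iterate of `x ↦ a x + b` -/
noncomputable def fixc {A : Type*} [CommRing A] (a b : A) (k : ℕ) : ℕ :=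
  Nat.card {x : A // (fun x => a * x + b)^[k] x = x}

theorem fix_aut {n : ℕ} [NeZero n] (a : (ZMod n)ˣ) (b : ZMod n) (k : ℕ) :
    Nat.card {x : DihedralGroup n // (((affAut a b).toEquiv : Perm _) ^ k) x = x} =
      fixc (a : ZMod n) 0 k + fixc (a : ZMod n) b k := by
  have h1 : ∀ i : ZMod n, (((affAut a b).toEquiv : Perm _) ^ k) (.r i) =
      .r ((fun x => (a : ZMod n) * x + 0)^[k] i) := by
    induction k with
    | zero => intro i; rfl
    | succ k ih =>
      intro i
      rw [pow_succ', Perm.mul_apply, ih, Function.iterate_succ_apply', add_zero]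
      rfl
  have h2 : ∀ i : ZMod n, (((affAut a b).toEquiv : Perm _) ^ k) (.sr i) =
      .sr ((fun x => (a : ZMod n) * x + b)^[k] i) := by
    clear h1
    induction k with
    | zero => intro i; rfl
    | succ k ih =>
      intro i
      rw [pow_succ', Perm.mul_apply, ih, Function.iterate_succ_apply']
      rfl
  unfold fixc
  rw [← Nat.card_sum]
  refine Nat.card_congr ⟨fun x => match x with
    | ⟨.r i, h⟩ => .inl ⟨i, by rw [h1] at h; injection h⟩
    | ⟨.sr i, h⟩ => .inr ⟨i, by rw [h2] at h; injection h⟩,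
    fun y => match y with
    | .inl x => ⟨.r x.1, by rw [h1, x.2]⟩
    | .inr x => ⟨.sr x.1, by rw [h2, x.2]⟩, ?_, ?_⟩
  · rintro ⟨i | i, h⟩ <;> rfl
  · rintro (x | x) <;> rfl

theorem fixc_equiv {A B : Type*} [CommRing A] [CommRing B] (e : A ≃+* B) (a b : A) (k : ℕ) :
    fixc a b k = fixc (e a) (e b) k := by
  have h : ∀ x, e ((fun x => a * x + b)^[k] x) = (fun x => e a * x + e b)^[k] (e x) := by
    induction k with
    | zero => intro x; rfl
    | succ k ih => intro x; rw [Function.iterate_succ_apply, ih, Function.iterate_succ_apply]; simp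
  refine Nat.card_congr (e.toEquiv.subtypeEquiv fun x => ?_)
  show _ ↔ _ = e x
  rw [← e.injective.eq_iff, h]; rfl

theorem fixc_prod {A B : Type*} [CommRing A] [CommRing B] (a b : A × B) (k : ℕ) :
    fixc a b k = fixc a.1 b.1 k * fixc a.2 b.2 k := by
  have h : ∀ x : A × B, (fun x => a * x + b)^[k] x =
      ((fun x => a.1 * x + b.1)^[k] x.1, (fun x => a.2 * x + b.2)^[k] x.2) := by
    induction k with
    | zero => intro x; rfl
    | succ k ih => intro x; rw [Function.iterate_succ_apply, ih]; rfl
  unfold fixc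
  rw [← Nat.card_prod]
  refine Nat.card_congr ⟨fun x => (⟨x.1.1, ?_⟩, ⟨x.1.2, ?_⟩), fun y => ⟨(y.1.1, y.2.1), ?_⟩, ?_, ?_⟩
  · have := x.2; rw [h] at this; exact congrArg Prod.fst this
  · have := x.2; rw [h] at this; exact congrArg Prod.snd this
  · rw [h, y.1.2, y.2.2]
  · intro x; rfl
  · intro x; rfl

theorem fixc_field {q : ℕ} [Fact q.Prime] (a b : ZMod q) (ha : a ≠ 0) (k : ℕ) :
    fixc a b k = if a = 1 then (if b = 0 then q else if q ∣ k then q else 0)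
      else (if orderOf a ∣ k then q else 1) := by
  by_cases h1 : a = 1
  · subst h1
    have h : ∀ x : ZMod q, (fun x => 1 * x + b)^[k] x = x + k * b := by
      induction k with
      | zero => intro x; simp
      | succ k ih => intro x; rw [Function.iterate_succ_apply, ih]; push_cast; ring
    have h3 : fixc 1 b k = Nat.card {x : ZMod q // (k : ZMod q) * b = 0} := by
      refine Nat.card_congr (Equiv.subtypeEquivRight fun x => ?_)
      rw [h]; simp
    rw [h3, if_pos rfl]
    have h4 : (k : ZMod q) * b = 0 ↔ q ∣ k ∨ b = 0 := by
      rw [mul_eq_zero, ZMod.natCast_eq_zero_iff]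
    by_cases h5 : b = 0
    · simp [h5]
    · rw [if_neg h5]
      by_cases h6 : q ∣ k
      · simp [h4, h6]
      · simp [h4, h5, h6]
  · rw [if_neg h1]
    have hne : 1 - a ≠ 0 := sub_ne_zero.2 (Ne.symm h1)
    set x0 : ZMod q := b / (1 - a) with hx0
    have hx : a * x0 + b = x0 := by
      rw [hx0]; field_simp; ring
    have h : ∀ x : ZMod q, (fun x => a * x + b)^[k] x = a ^ k * (x - x0) + x0 := by
      induction k with
      | zero => intro x; simp
      | succ k ih =>
        intro x
        rw [Function.iterate_succ_apply, ih]
        linear_combination (a ^ k) * hx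
    have h3 : fixc a b k = Nat.card {x : ZMod q // (a ^ k - 1) * (x - x0) = 0} := by
      refine Nat.card_congr (Equiv.subtypeEquivRight fun x => ?_)
      rw [h]
      constructor
      · intro h; linear_combination h
      · intro h; linear_combination h
    rw [h3]
    by_cases h6 : orderOf a ∣ k
    · rw [if_pos h6]
      rw [orderOf_dvd_iff_pow_eq_one] at h6
      simp [h6]
    · rw [if_neg h6]
      rw [orderOf_dvd_iff_pow_eq_one] at h6
      have : ∀ x, (a ^ k - 1) * (x - x0) = 0 ↔ x = x0 := by
        intro x
        rw [mul_eq_zero, or_iff_right (sub_ne_zero.2 h6), sub_eq_zero]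
      simp only [this]
      simp

end autos
end D6
namespace D6
open Equiv Equiv.Perm
open scoped Pointwise
section cyc

/-- number of cycles of `x ↦ a x + b` on `ZMod 3 × ZMod p` -/
noncomputable def cyc (p : ℕ) (a3 b3 : ZMod 3) (a b : ZMod p) : ℕ :=
  if a = 1 then (if b = 0 then p else 1) * (if a3 = 1 then (if b3 = 0 then 3 else 1) else 2)
  else if a3 = 1 then
    (if b3 = 0 then 3 + 3 * ((p - 1) / orderOf a)
      else if 3 ∣ orderOf a then 1 + 3 * ((p - 1) / orderOf a) else 1 + (p - 1) / orderOf a)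
  else if 2 ∣ orderOf a then 2 + 3 * ((p - 1) / orderOf a) else 2 + 2 * ((p - 1) / orderOf a)

theorem sum_dvd (q M : ℕ) (hq : 0 < q) :
    ∑ k ∈ Finset.range (q * M), (if q ∣ k then 1 else 0) = M := by
  rw [← Finset.card_filter]
  have : Finset.filter (fun k => q ∣ k) (Finset.range (q * M)) =
      (Finset.range M).image (fun k => q * k) := by
    ext k
    simp only [Finset.mem_filter, Finset.mem_range, Finset.mem_image]
    constructor
    · rintro ⟨h, j, rfl⟩
      exact ⟨j, Nat.lt_of_mul_lt_mul_left h, rfl⟩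
    · rintro ⟨j, hj, rfl⟩
      exact ⟨Nat.mul_lt_mul_of_pos_left hj hq, dvd_mul_right _ _⟩
  rw [this, Finset.card_image_of_injective _ (fun x y h => Nat.eq_of_mul_eq_mul_left hq h), Finset.card_range]

theorem sum_dvd' (q N M : ℕ) (hq : 0 < q) (h : N = q * M) :
    ∑ k ∈ Finset.range N, (if q ∣ k then 1 else 0) = M := by
  rw [h, sum_dvd q M hq]

theorem ord3 {a : ZMod 3} (h0 : a ≠ 0) (h1 : a ≠ 1) : orderOf a = 2 := by
  have : a = -1 := by revert h0 h1; revert a; decide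
  subst this
  exact orderOf_eq_prime (by decide) (by decide)

theorem cyc_sum {p : ℕ} (hp : p.Prime) (hp3 : 3 < p) (a3 b3 : ZMod 3) (a b : ZMod p)
    (ha3 : a3 ≠ 0) (ha : a ≠ 0) :
    ∑ k ∈ Finset.range (6 * p * (p - 1)), fixc a3 b3 k * fixc a b k =
      6 * p * (p - 1) * cyc p a3 b3 a b := by
  have : Fact p.Prime := ⟨hp⟩
  have : Fact (Nat.Prime 3) := ⟨Nat.prime_three⟩
  have hN : ∑ k ∈ Finset.range (6 * p * (p - 1)), 1 = 6 * p * (p - 1) := by simp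
  have h2 := sum_dvd' 2 (6 * p * (p - 1)) (3 * p * (p - 1)) (by norm_num) (by ring)
  have h3 := sum_dvd' 3 (6 * p * (p - 1)) (2 * p * (p - 1)) (by norm_num) (by ring)
  have hhp := sum_dvd' p (6 * p * (p - 1)) (6 * (p - 1)) hp.pos (by ring)
  have h2p := sum_dvd' (2 * p) (6 * p * (p - 1)) (3 * (p - 1)) (by have := hp.pos; omega) (by ring)
  have h3p := sum_dvd' (3 * p) (6 * p * (p - 1)) (2 * (p - 1)) (by have := hp.pos; omega) (by ring)
  have c2p : Nat.Coprime 2 p := (Nat.coprime_primes Nat.prime_two hp).2 (by omega)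
  have c3p : Nat.Coprime 3 p := (Nat.coprime_primes Nat.prime_three hp).2 (by omega)
  have e2p : ∀ k, (2 ∣ k ∧ p ∣ k) ↔ 2 * p ∣ k := fun k => (Nat.Coprime.mul_dvd_of_dvd_of_dvd c2p |> fun f =>
    ⟨fun h => f h.1 h.2, fun h => ⟨(dvd_mul_right _ _).trans h, (dvd_mul_left _ _).trans h⟩⟩)
  have e3p : ∀ k, (3 ∣ k ∧ p ∣ k) ↔ 3 * p ∣ k := fun k => (Nat.Coprime.mul_dvd_of_dvd_of_dvd c3p |> fun f =>
    ⟨fun h => f h.1 h.2, fun h => ⟨(dvd_mul_right _ _).trans h, (dvd_mul_left _ _).trans h⟩⟩)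
  by_cases h1 : a = 1
  · by_cases hb : b = 0
    · by_cases h31 : a3 = 1
      · by_cases hb3 : b3 = 0
        · have : ∀ k, fixc a3 b3 k * fixc a b k = 3 * p * 1 := by
            intro k
            rw [fixc_field a3 b3 ha3, fixc_field a b ha, if_pos h1, if_pos hb, if_pos h31, if_pos hb3,
              mul_one]
          rw [Finset.sum_congr rfl (fun k _ => this k), ← Finset.mul_sum, hN]
          simp only [cyc, h1, hb, h31, hb3, if_true]
          ring
        · have : ∀ k, fixc a3 b3 k * fixc a b k = 3 * p * (if 3 ∣ k then 1 else 0) := by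
            intro k
            rw [fixc_field a3 b3 ha3, fixc_field a b ha, if_pos h1, if_pos hb, if_pos h31, if_neg hb3]
            split_ifs <;> ring
          rw [Finset.sum_congr rfl (fun k _ => this k), ← Finset.mul_sum, h3]
          simp only [cyc, h1, hb, h31, hb3, if_true, if_false]
          ring
      · have : ∀ k, fixc a3 b3 k * fixc a b k = p * 1 + 2 * p * (if 2 ∣ k then 1 else 0) := by
          intro k
          rw [fixc_field a3 b3 ha3, fixc_field a b ha, if_pos h1, if_pos hb, if_neg h31, ord3 ha3 h31]
          split_ifs <;> ring
        rw [Finset.sum_congr rfl (fun k _ => this k), Finset.sum_add_distrib, ← Finset.mul_sum,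
          ← Finset.mul_sum, h2, hN]
        simp only [cyc, h1, hb, h31, if_true, if_false]
        ring
    · by_cases h31 : a3 = 1
      · by_cases hb3 : b3 = 0
        · have : ∀ k, fixc a3 b3 k * fixc a b k = 3 * p * (if p ∣ k then 1 else 0) := by
            intro k
            rw [fixc_field a3 b3 ha3, fixc_field a b ha, if_pos h1, if_neg hb, if_pos h31, if_pos hb3]
            split_ifs <;> ring
          rw [Finset.sum_congr rfl (fun k _ => this k), ← Finset.mul_sum, hhp]
          simp only [cyc, h1, hb, h31, hb3, if_true, if_false]
          ring
        · have : ∀ k, fixc a3 b3 k * fixc a b k = 3 * p * (if 3 * p ∣ k then 1 else 0) := by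
            intro k
            rw [fixc_field a3 b3 ha3, fixc_field a b ha, if_pos h1, if_neg hb, if_pos h31, if_neg hb3]
            simp only [← e3p]
            split_ifs <;> first | ring1 | tauto
          rw [Finset.sum_congr rfl (fun k _ => this k), ← Finset.mul_sum, h3p]
          simp only [cyc, h1, hb, h31, hb3, if_true, if_false]
          ring
      · have : ∀ k, fixc a3 b3 k * fixc a b k =
            p * (if p ∣ k then 1 else 0) + 2 * p * (if 2 * p ∣ k then 1 else 0) := by
          intro k
          rw [fixc_field a3 b3 ha3, fixc_field a b ha, if_pos h1, if_neg hb, if_neg h31, ord3 ha3 h31]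
          simp only [← e2p]
          split_ifs <;> first | ring1 | tauto
        rw [Finset.sum_congr rfl (fun k _ => this k), Finset.sum_add_distrib, ← Finset.mul_sum,
          ← Finset.mul_sum, h2p, hhp]
        simp only [cyc, h1, hb, h31, if_true, if_false]
        ring
  · have hd0 : 0 < orderOf a := (isOfFinOrder_iff_pow_eq_one.2
      ⟨p - 1, by omega, ZMod.pow_card_sub_one_eq_one ha⟩).orderOf_pos
    have hdd : orderOf a ∣ p - 1 := orderOf_dvd_of_pow_eq_one (ZMod.pow_card_sub_one_eq_one ha)
    obtain ⟨d, hd⟩ : ∃ d, d = orderOf a := ⟨_, rfl⟩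
    have hfa : ∀ k, fixc a b k = 1 + (p - 1) * (if d ∣ k then 1 else 0) := by
      intro k
      rw [fixc_field a b ha, if_neg h1, hd]
      have := hp.pos
      split_ifs <;> omega
    simp only [cyc, ← hd, h1, if_false] at *
    obtain ⟨m, hm⟩ := hdd
    have hpm : (p - 1) / d = m := by rw [hm, Nat.mul_div_cancel_left _ hd0]
    have hhd := sum_dvd' d (6 * p * (p - 1)) (6 * p * m) hd0 (by rw [hm]; ring)
    rw [hpm]
    by_cases h31 : a3 = 1
    · by_cases hb3 : b3 = 0
      · have : ∀ k, fixc a3 b3 k * fixc a b k = 3 * 1 + 3 * (p - 1) * (if d ∣ k then 1 else 0) := by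
          intro k
          rw [fixc_field a3 b3 ha3, hfa, if_pos h31, if_pos hb3]
          ring
        rw [Finset.sum_congr rfl (fun k _ => this k), Finset.sum_add_distrib, ← Finset.mul_sum,
          ← Finset.mul_sum, hhd, hN]
        simp only [h31, hb3, if_true]
        ring
      · by_cases h3d : 3 ∣ d
        · have : ∀ k, fixc a3 b3 k * fixc a b k =
              3 * (if 3 ∣ k then 1 else 0) + 3 * (p - 1) * (if d ∣ k then 1 else 0) := by
            intro k
            rw [fixc_field a3 b3 ha3, hfa, if_pos h31, if_neg hb3]
            by_cases hk : d ∣ k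
            · rw [if_pos hk, if_pos (h3d.trans hk), if_pos (h3d.trans hk)]; ring
            · rw [if_neg hk]; split_ifs <;> ring
          rw [Finset.sum_congr rfl (fun k _ => this k), Finset.sum_add_distrib, ← Finset.mul_sum,
            ← Finset.mul_sum, hhd, h3]
          simp only [h31, hb3, h3d, if_true, if_false]
          ring
        · have c3 : Nat.Coprime 3 d := (Nat.Prime.coprime_iff_not_dvd Nat.prime_three).2 h3d
          have h3d' := sum_dvd' (3 * d) (6 * p * (p - 1)) (2 * p * m) (by omega) (by rw [hm]; ring)
          have : ∀ k, fixc a3 b3 k * fixc a b k =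
              3 * (if 3 ∣ k then 1 else 0) + 3 * (p - 1) * (if 3 * d ∣ k then 1 else 0) := by
            intro k
            rw [fixc_field a3 b3 ha3, hfa, if_pos h31, if_neg hb3]
            by_cases hk : 3 * d ∣ k
            · rw [if_pos hk, if_pos ((dvd_mul_right _ _).trans hk),
                if_pos ((dvd_mul_left _ _).trans hk), if_pos ((dvd_mul_right _ _).trans hk)]; ring
            · have : ¬ (3 ∣ k ∧ d ∣ k) := fun h => hk (c3.mul_dvd_of_dvd_of_dvd h.1 h.2)
              rw [if_neg hk]; split_ifs <;> first | ring1 | tauto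
          rw [Finset.sum_congr rfl (fun k _ => this k), Finset.sum_add_distrib, ← Finset.mul_sum,
            ← Finset.mul_sum, h3d', h3]
          simp only [h31, hb3, h3d, if_true, if_false]
          ring
    · have hf3 : ∀ k, fixc a3 b3 k = 1 + 2 * (if 2 ∣ k then 1 else 0) := by
        intro k
        rw [fixc_field a3 b3 ha3, if_neg h31, ord3 ha3 h31]
        split_ifs <;> rfl
      by_cases h2d : 2 ∣ d
      · have : ∀ k, fixc a3 b3 k * fixc a b k =
            1 + 2 * (if 2 ∣ k then 1 else 0) + 3 * (p - 1) * (if d ∣ k then 1 else 0) := by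
          intro k
          rw [hf3, hfa]
          by_cases hk : d ∣ k
          · rw [if_pos hk, if_pos (h2d.trans hk)]; ring
          · rw [if_neg hk]; ring
        rw [Finset.sum_congr rfl (fun k _ => this k), Finset.sum_add_distrib, Finset.sum_add_distrib,
          ← Finset.mul_sum, ← Finset.mul_sum, hhd, h2, hN]
        simp only [h31, h2d, if_true, if_false]
        ring
      · have c2 : Nat.Coprime 2 d := (Nat.Prime.coprime_iff_not_dvd Nat.prime_two).2 h2d
        have h2d' := sum_dvd' (2 * d) (6 * p * (p - 1)) (3 * p * m) (by omega) (by rw [hm]; ring)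
        have : ∀ k, fixc a3 b3 k * fixc a b k =
            1 + 2 * (if 2 ∣ k then 1 else 0) + (p - 1) * (if d ∣ k then 1 else 0)
              + 2 * (p - 1) * (if 2 * d ∣ k then 1 else 0) := by
          intro k
          rw [hf3, hfa]
          by_cases hk : 2 * d ∣ k
          · rw [if_pos hk, if_pos ((dvd_mul_right _ _).trans hk),
              if_pos ((dvd_mul_left _ _).trans hk)]; ring
          · have : ¬ (2 ∣ k ∧ d ∣ k) := fun h => hk (c2.mul_dvd_of_dvd_of_dvd h.1 h.2)
            rw [if_neg hk]; split_ifs <;> first | ring1 | tauto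
        rw [Finset.sum_congr rfl (fun k _ => this k), Finset.sum_add_distrib, Finset.sum_add_distrib,
          Finset.sum_add_distrib, ← Finset.mul_sum, ← Finset.mul_sum, ← Finset.mul_sum, hhd, h2, hN,
          h2d']
        simp only [h31, h2d, if_false]
        ring

end cyc
end D6
namespace D6
open Equiv Equiv.Perm
open scoped Pointwise
section total

theorem total {p : ℕ} [NeZero p] (hp : p.Prime) (hp3 : 3 < p) :
    2 * Nat.card (Quot fun S T : {S : Set (DihedralGroup (3 * p)) // (1 : DihedralGroup (3 * p)) ∉ S} =>
      ∃ f : MulAut (DihedralGroup (3 * p)), ∀ x, x ∈ S.1 ↔ f x ∈ T.1) * (6 * p * (p - 1)) =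
    ∑ r ∈ Finset.filter (fun r => Nat.gcd r (3 * p) = 1) (Finset.range (3 * p)),
      ∑ b3 : ZMod 3, ∑ b : ZMod p,
        2 ^ (cyc p (r : ZMod 3) 0 (r : ZMod p) 0 + cyc p (r : ZMod 3) b3 (r : ZMod p) b) := by
  classical
  have hF : Fact p.Prime := ⟨hp⟩
  have hF3 : Fact (Nat.Prime 3) := ⟨Nat.prime_three⟩
  have hn : NeZero (3 * p) := ⟨by have := hp.pos; omega⟩
  have c3p : Nat.Coprime 3 p := (Nat.coprime_primes Nat.prime_three hp).2 (by omega)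
  have hbij := affAut_bij (n := 3 * p) (by omega)
  let eqv := Equiv.ofBijective _ hbij
  let fin : Fintype (MulAut (DihedralGroup (3 * p))) := Fintype.ofEquiv _ eqv
  have hcard : Fintype.card (MulAut (DihedralGroup (3 * p))) = 6 * p * (p - 1) := by
    rw [← Fintype.card_congr eqv, Fintype.card_prod, ZMod.card_units_eq_totient, ZMod.card,
      Nat.totient_mul c3p, Nat.totient_prime hp, Nat.totient_prime Nat.prime_three]
    ring
  have key := burnside_sets (D := DihedralGroup (3 * p))
  rw [hcard] at key
  rw [key, ← hbij.sum_comp, Fintype.sum_prod_type]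
  let ψ : ZMod (3 * p) ≃+* ZMod 3 × ZMod p := ZMod.chineseRemainder c3p
  have hNpos : 0 < 6 * p * (p - 1) := by
    have := hp.pos
    have : 0 < p - 1 := by omega
    positivity
  refine Finset.sum_bij (fun a _ => (a : ZMod (3 * p)).val) ?_ ?_ ?_ ?_
  · intro a _
    rw [Finset.mem_filter, Finset.mem_range]
    exact ⟨ZMod.val_lt _, ZMod.val_coe_unit_coprime a⟩
  · intro a _ b _ h
    exact Units.ext (ZMod.val_injective _ h)
  · intro r hr
    rw [Finset.mem_filter, Finset.mem_range] at hr
    refine ⟨ZMod.unitOfCoprime r hr.2, Finset.mem_univ _, ?_⟩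
    rw [ZMod.coe_unitOfCoprime, ZMod.val_natCast_of_lt hr.1]
  · intro a _
    set r := (a : ZMod (3 * p)).val with hr
    have har : (a : ZMod (3 * p)) = (r : ZMod (3 * p)) := by rw [hr, ZMod.natCast_zmod_val]
    have hcop : Nat.Coprime r (3 * p) := ZMod.val_coe_unit_coprime a
    have ha3 : (r : ZMod 3) ≠ 0 := by
      rw [Ne, ZMod.natCast_eq_zero_iff, ← Nat.Prime.coprime_iff_not_dvd Nat.prime_three]
      exact (Nat.Coprime.coprime_mul_right_right hcop).symm
    have hap : (r : ZMod p) ≠ 0 := by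
      rw [Ne, ZMod.natCast_eq_zero_iff, ← Nat.Prime.coprime_iff_not_dvd hp]
      exact (Nat.Coprime.coprime_mul_left_right hcop).symm
    have hfc : ∀ b k, fixc (a : ZMod (3 * p)) b k =
        fixc (r : ZMod 3) (ψ b).1 k * fixc (r : ZMod p) (ψ b).2 k := by
      intro b k
      rw [fixc_equiv ψ, fixc_prod, har, map_natCast]; rfl
    have h1 : ∀ b : ZMod (3 * p), Nat.card {S : Set (DihedralGroup (3 * p)) //
        ∀ x, (affAut a b) x ∈ S ↔ x ∈ S} =
        2 ^ (cyc p (r : ZMod 3) 0 (r : ZMod p) 0 +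
          cyc p (r : ZMod 3) (ψ b).1 (r : ZMod p) (ψ b).2) := by
      intro b
      have hpow : ((affAut a b).toEquiv : Perm (DihedralGroup (3 * p))) ^ (6 * p * (p - 1)) = 1 := by
        have h2 : (affAut a b) ^ (6 * p * (p - 1)) = 1 := by rw [← hcard]; exact pow_card_eq_one
        have h3 := congrArg (MulAut.toPerm (DihedralGroup (3 * p))) h2
        rw [map_pow, map_one] at h3
        exact h3
      obtain ⟨q, hq1, hq2⟩ := cycles _ _ hNpos hpow
      refine Eq.trans hq1 ?_
      congr 1
      apply Nat.eq_of_mul_eq_mul_left hNpos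
      rw [hq2, mul_add, ← cyc_sum hp hp3 _ _ _ _ ha3 hap, ← cyc_sum hp hp3 _ _ _ _ ha3 hap,
        ← Finset.sum_add_distrib]
      refine Finset.sum_congr rfl fun k _ => ?_
      rw [fix_aut, hfc, hfc, map_zero]; rfl
    rw [Finset.sum_congr rfl (fun b _ => h1 b), ← Fintype.sum_prod_type']
    exact Fintype.sum_equiv ψ.toEquiv _ _ (fun b => rfl)

end total
end D6
namespace D6
open Equiv Equiv.Perm
open scoped Pointwise
section final

theorem two_ne : ((2 : ℕ) : ZMod 3) ≠ 1 := by decide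
theorem nz2 : ∀ x y : ZMod 3, x ≠ 0 → x ≠ 1 → y ≠ 0 → y ≠ 1 → x = y := by decide

theorem sum_split {q : ℕ} [NeZero q] (f : ZMod q → ℚ) (y : ℚ) (h : ∀ b, b ≠ 0 → f b = y) :
    ∑ b : ZMod q, f b = f 0 + ((q : ℚ) - 1) * y := by
  classical
  rw [← Finset.add_sum_erase _ _ (Finset.mem_univ (0 : ZMod q)),
    Finset.sum_congr rfl (fun b hb => h b (Finset.ne_of_mem_erase hb)), Finset.sum_const,
    Finset.card_erase_of_mem (Finset.mem_univ _), Finset.card_univ, ZMod.card, nsmul_eq_mul,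
    Nat.cast_sub (NeZero.pos q)]
  simp

theorem sum_split2 {p : ℕ} [NeZero p] (f : ZMod 3 → ZMod p → ℚ) (y00 y01 y10 y11 : ℚ)
    (h00 : f 0 0 = y00) (h01 : ∀ b, b ≠ 0 → f 0 b = y01) (h10 : ∀ b3, b3 ≠ 0 → f b3 0 = y10)
    (h11 : ∀ b3 b, b3 ≠ 0 → b ≠ 0 → f b3 b = y11) :
    ∑ b3 : ZMod 3, ∑ b : ZMod p, f b3 b =
      y00 + ((p : ℚ) - 1) * y01 + 2 * (y10 + ((p : ℚ) - 1) * y11) := by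
  rw [sum_split _ (y10 + ((p : ℚ) - 1) * y11), sum_split _ y01 h01, h00]
  · push_cast; ring
  · intro b3 hb3
    rw [sum_split _ y11 (h11 b3 · hb3), h10 b3 hb3]

theorem inner11 {p : ℕ} [NeZero p] :
    ∑ b3 : ZMod 3, ∑ b : ZMod p, (2 : ℚ) ^ (cyc p 1 0 1 0 + cyc p 1 b3 1 b) =
      2 ^ (6 * p) + 2 * 2 ^ (4 * p) + ((p : ℚ) - 1) * 12 * 2 ^ (3 * p) := by
  rw [sum_split2 _ (2 ^ (3 * p + 3 * p)) (2 ^ (3 * p + 3)) (2 ^ (3 * p + p)) (2 ^ (3 * p + 1))]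
  · have e1 : 6 * p = 3 * p + 3 * p := by ring
    have e2 : 4 * p = 3 * p + p := by ring
    rw [e1, e2]
    simp only [pow_add]
    ring
  · simp [cyc]; ring
  · intro b hb; simp [cyc, hb]; ring
  · intro b hb; simp [cyc, hb]; ring
  · intro b3 b hb3 hb; simp [cyc, hb, hb3]; ring

theorem inner21 {p : ℕ} [NeZero p] (a3 : ZMod 3) (h : a3 ≠ 1) :
    ∑ b3 : ZMod 3, ∑ b : ZMod p, (2 : ℚ) ^ (cyc p a3 0 1 0 + cyc p a3 b3 1 b) =
      3 * 2 ^ (4 * p) + ((p : ℚ) - 1) * 12 * 2 ^ (2 * p) := by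
  rw [sum_split2 _ (2 ^ (2 * p + 2 * p)) (2 ^ (2 * p + 2)) (2 ^ (2 * p + 2 * p)) (2 ^ (2 * p + 2))]
  · have e2 : 4 * p = 2 * p + 2 * p := by ring
    rw [e2]
    simp only [pow_add]
    ring
  · simp [cyc, h]; ring
  · intro b hb; simp [cyc, hb, h]; ring
  · intro b hb; simp [cyc, h]; ring
  · intro b3 b hb3 hb; simp [cyc, hb, h]; ring

theorem inner1d {p : ℕ} [NeZero p] (a : ZMod p) (h : a ≠ 1) (h3 : ¬ 3 ∣ orderOf a) :
    ∑ b3 : ZMod 3, ∑ b : ZMod p, (2 : ℚ) ^ (cyc p 1 0 a 0 + cyc p 1 b3 a b) =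
      p * 32 * (2 ^ (4 * ((p - 1) / orderOf a)) + 2 ^ (1 + 6 * ((p - 1) / orderOf a))) := by
  generalize hm : (p - 1) / orderOf a = m
  rw [sum_split2 _ (2 ^ (6 + 6 * m)) (2 ^ (6 + 6 * m)) (2 ^ (4 + 4 * m)) (2 ^ (4 + 4 * m))]
  · simp only [pow_add]
    ring
  · simp [cyc, h, hm]; ring
  · intro b hb; simp [cyc, h, hm]; ring
  · intro b hb; simp [cyc, h, hb, h3, hm]; ring
  · intro b3 b hb3 hb; simp [cyc, hb3, h, h3, hm]; ring

theorem inner1d3 {p : ℕ} [NeZero p] (a : ZMod p) (h : a ≠ 1) (h3 : 3 ∣ orderOf a) :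
    ∑ b3 : ZMod 3, ∑ b : ZMod p, (2 : ℚ) ^ (cyc p 1 0 a 0 + cyc p 1 b3 a b) =
      p * 96 * 2 ^ (6 * ((p - 1) / orderOf a)) := by
  generalize hm : (p - 1) / orderOf a = m
  rw [sum_split2 _ (2 ^ (6 + 6 * m)) (2 ^ (6 + 6 * m)) (2 ^ (4 + 6 * m)) (2 ^ (4 + 6 * m))]
  · simp only [pow_add]
    ring
  · simp [cyc, h, hm]; ring
  · intro b hb; simp [cyc, h, hm]; ring
  · intro b hb; simp [cyc, h, hb, h3, hm]; ring
  · intro b3 b hb3 hb; simp [cyc, hb3, h, h3, hm]; ring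

theorem inner2d {p : ℕ} [NeZero p] (a3 : ZMod 3) (h31 : a3 ≠ 1) (a : ZMod p) (h : a ≠ 1)
    (h3 : ¬ 2 ∣ orderOf a) :
    ∑ b3 : ZMod 3, ∑ b : ZMod p, (2 : ℚ) ^ (cyc p a3 0 a 0 + cyc p a3 b3 a b) =
      p * 48 * 2 ^ (4 * ((p - 1) / orderOf a)) := by
  generalize hm : (p - 1) / orderOf a = m
  have : ∀ b3 b, (2 : ℚ) ^ (cyc p a3 0 a 0 + cyc p a3 b3 a b) = 2 ^ (4 + 4 * m) := by
    intro b3 b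
    simp only [cyc, h, h31, h3, hm, if_false]
    congr 1; ring
  simp only [this]
  simp only [Finset.sum_const, Finset.card_univ, ZMod.card, nsmul_eq_mul, pow_add]
  push_cast; ring

theorem inner2d2 {p : ℕ} [NeZero p] (a3 : ZMod 3) (h31 : a3 ≠ 1) (a : ZMod p) (h : a ≠ 1)
    (h3 : 2 ∣ orderOf a) :
    ∑ b3 : ZMod 3, ∑ b : ZMod p, (2 : ℚ) ^ (cyc p a3 0 a 0 + cyc p a3 b3 a b) =
      p * 48 * 2 ^ (6 * ((p - 1) / orderOf a)) := by
  generalize hm : (p - 1) / orderOf a = m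
  have : ∀ b3 b, (2 : ℚ) ^ (cyc p a3 0 a 0 + cyc p a3 b3 a b) = 2 ^ (4 + 6 * m) := by
    intro b3 b
    simp only [cyc, h, h31, h3, hm, if_false, if_true]
    congr 1; ring
  simp only [this]
  simp only [Finset.sum_const, Finset.card_univ, ZMod.card, nsmul_eq_mul, pow_add]
  push_cast; ring

end final
end D6
/-- For a prime `p > 3`, the number of isomorphism classes of Cayley
digraphs on the dihedral group `D_{6p}` is given by the explicit formula of the main theorem,
where in each sum `r` ranges over integers with `1 < r < 3p` and `gcd(r,3p) = 1` satisfying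
the indicated conditions on `|r|_3` and `|r|_p`. -/
theorem card_cayleyClasses_D6p (p : ℕ) (hp : p.Prime) (hp3 : 3 < p) :
    (Nat.card (Quot fun S T : {S : Set (DihedralGroup (3 * p)) // (1 : DihedralGroup (3 * p)) ∉ S} =>
        cayleyIso (S : Set (DihedralGroup (3 * p))) (T : Set (DihedralGroup (3 * p)))) : ℚ)
      = (2 : ℚ) ^ (4 * p - 2) / (3 * (p : ℚ) * ((p : ℚ) - 1)) * ((2 : ℚ) ^ (2 * p) + 5)
        + (2 : ℚ) ^ (2 * p) / (p : ℚ) * ((2 : ℚ) ^ p + 1)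
        + 8 / (3 * ((p : ℚ) - 1)) *
            ∑ r ∈ Finset.filter
                (fun r => Nat.gcd r (3 * p) = 1 ∧ ordMod 3 (r : ℤ) = 1 ∧ ¬(3 ∣ ordMod p (r : ℤ)))
                (Finset.Ioo 1 (3 * p)),
              ((2 : ℚ) ^ (4 * (p - 1) / ordMod p (r : ℤ))
                + (2 : ℚ) ^ (1 + 6 * (p - 1) / ordMod p (r : ℤ)))
        + 8 / ((p : ℚ) - 1) *
            ∑ r ∈ Finset.filter
                (fun r => Nat.gcd r (3 * p) = 1 ∧ ordMod 3 (r : ℤ) = 1 ∧ 3 ∣ ordMod p (r : ℤ))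
                (Finset.Ioo 1 (3 * p)),
              (2 : ℚ) ^ (6 * (p - 1) / ordMod p (r : ℤ))
        + 4 / ((p : ℚ) - 1) *
            ((∑ r ∈ Finset.filter
                (fun r => Nat.gcd r (3 * p) = 1 ∧ ordMod 3 (r : ℤ) = 2 ∧
                  ¬(2 ∣ ordMod p (r : ℤ)) ∧ 1 < ordMod p (r : ℤ))
                (Finset.Ioo 1 (3 * p)),
              (2 : ℚ) ^ (4 * (p - 1) / ordMod p (r : ℤ)))
            + ∑ r ∈ Finset.filter
                (fun r => Nat.gcd r (3 * p) = 1 ∧ ordMod 3 (r : ℤ) = 2 ∧ 2 ∣ ordMod p (r : ℤ))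
                (Finset.Ioo 1 (3 * p)),
              (2 : ℚ) ^ (6 * (p - 1) / ordMod p (r : ℤ))) := by
  have hF : Fact p.Prime := ⟨hp⟩
  have hF3 : Fact (Nat.Prime 3) := ⟨Nat.prime_three⟩
  have hpn : NeZero p := ⟨hp.ne_zero⟩
  have c3p : Nat.Coprime 3 p := (Nat.coprime_primes Nat.prime_three hp).2 (by omega)
  have hq : (Quot fun S T : {S : Set (DihedralGroup (3 * p)) // (1 : DihedralGroup (3 * p)) ∉ S} =>
        cayleyIso (S : Set (DihedralGroup (3 * p))) (T : Set (DihedralGroup (3 * p)))) =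
      (Quot fun S T : {S : Set (DihedralGroup (3 * p)) // (1 : DihedralGroup (3 * p)) ∉ S} =>
        ∃ f : MulAut (DihedralGroup (3 * p)), ∀ x, x ∈ S.1 ↔ f x ∈ T.1) := by
    congr 1
    funext S T
    apply propext
    constructor
    · rintro ⟨e, he⟩
      exact D6.iso_aut hp hp3 S.1 T.1 e he
    · rintro ⟨f, hf⟩
      exact D6.aut_iso f hf
  rw [hq]
  have tot := D6.total hp hp3
  generalize Nat.card (Quot fun S T : {S : Set (DihedralGroup (3 * p)) // (1 : DihedralGroup (3 * p)) ∉ S} =>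
        ∃ f : MulAut (DihedralGroup (3 * p)), ∀ x, x ∈ S.1 ↔ f x ∈ T.1) = Q at tot ⊢
  have totq := congrArg (Nat.cast : ℕ → ℚ) tot
  clear tot hq
  push_cast [Nat.cast_sub hp.one_le] at totq
  have hord : ∀ (m r : ℕ), ordMod m (r : ℤ) = orderOf (r : ZMod m) := by
    intro m r; unfold ordMod; simp
  -- the exceptional residue
  obtain ⟨s, hs3, hsp⟩ := Nat.chineseRemainder c3p 2 1
  obtain ⟨t, ht, hts⟩ : ∃ t, t < 3 * p ∧ t ≡ s [MOD 3 * p] :=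
    ⟨s % (3 * p), Nat.mod_lt _ (by omega), Nat.mod_modEq _ _⟩
  have ht3 : t ≡ 2 [MOD 3] := (hts.of_mul_right p).trans hs3
  have htp : t ≡ 1 [MOD p] := (hts.of_mul_left 3).trans hsp
  have htcop : Nat.gcd t (3 * p) = 1 := by
    refine Nat.Coprime.mul_right ?_ ?_
    · have := ht3.gcd_eq
      rw [Nat.Coprime, this]; rfl
    · have := htp.gcd_eq
      rw [Nat.Coprime, this]; simp
  have ht1 : t ≠ 1 := by
    rintro rfl
    exact absurd ht3 (by decide)
  have ht3' : (t : ZMod 3) ≠ 1 := by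
    have : (t : ZMod 3) = (2 : ℕ) := (ZMod.natCast_eq_natCast_iff _ _ _).2 ht3
    rw [this]; exact D6.two_ne
  have htp' : (t : ZMod p) = 1 := by
    have : (t : ZMod p) = (1 : ℕ) := (ZMod.natCast_eq_natCast_iff _ _ _).2 htp
    simpa using this
  have cop3 : ∀ r, Nat.gcd r (3 * p) = 1 → (r : ZMod 3) ≠ 0 := by
    intro r hr
    rw [Ne, ZMod.natCast_eq_zero_iff, ← Nat.Prime.coprime_iff_not_dvd Nat.prime_three]
    exact (Nat.Coprime.coprime_mul_right_right hr).symm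
  have copp : ∀ r, Nat.gcd r (3 * p) = 1 → (r : ZMod p) ≠ 0 := by
    intro r hr
    rw [Ne, ZMod.natCast_eq_zero_iff, ← Nat.Prime.coprime_iff_not_dvd hp]
    exact (Nat.Coprime.coprime_mul_left_right hr).symm
  have uniq : ∀ r, r < 3 * p → ∀ r', r' < 3 * p → (r : ZMod 3) = r' → (r : ZMod p) = r' → r = r' := by
    intro r hr r' hr' h1 h2
    rw [ZMod.natCast_eq_natCast_iff] at h1 h2
    exact Nat.ModEq.eq_of_lt_of_lt ((Nat.modEq_and_modEq_iff_modEq_mul c3p).1 ⟨h1, h2⟩) hr hr'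
  have nz2 : ∀ x y : ZMod 3, x ≠ 0 → x ≠ 1 → y ≠ 0 → y ≠ 1 → x = y := D6.nz2
  set U := Finset.filter (fun r => Nat.gcd r (3 * p) = 1) (Finset.range (3 * p)) with hU
  have hI : ∀ P : ℕ → Prop, ∀ _ : DecidablePred P, ∀ f : ℕ → ℚ,
      ∑ r ∈ Finset.filter (fun r => Nat.gcd r (3 * p) = 1 ∧ P r) (Finset.Ioo 1 (3 * p)), f r =
      ∑ r ∈ U, if r ≠ 1 ∧ P r then f r else 0 := by
    intro P _ f
    rw [← Finset.sum_filter]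
    refine Finset.sum_congr ?_ (fun _ _ => rfl)
    ext r
    simp only [hU, Finset.mem_filter, Finset.mem_Ioo, Finset.mem_range]
    constructor
    · rintro ⟨⟨h1, h2⟩, h3, h4⟩
      exact ⟨⟨h2, h3⟩, by omega, h4⟩
    · rintro ⟨⟨h2, h3⟩, h1, h4⟩
      refine ⟨⟨?_, h2⟩, h3, h4⟩
      have : r ≠ 0 := by
        rintro rfl
        rw [Nat.gcd_zero_left] at h3
        omega
      omega
  simp only [hord]
  rw [hI (fun r => orderOf (r : ZMod 3) = 1 ∧ ¬(3 ∣ orderOf (r : ZMod p))),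
    hI (fun r => orderOf (r : ZMod 3) = 1 ∧ 3 ∣ orderOf (r : ZMod p)),
    hI (fun r => orderOf (r : ZMod 3) = 2 ∧ ¬(2 ∣ orderOf (r : ZMod p)) ∧ 1 < orderOf (r : ZMod p)),
    hI (fun r => orderOf (r : ZMod 3) = 2 ∧ 2 ∣ orderOf (r : ZMod p))]
  have h1U : 1 ∈ U := by
    simp only [hU, Finset.mem_filter, Finset.mem_range]
    exact ⟨by omega, Nat.gcd_one_left _⟩
  have htU : t ∈ U := by
    simp only [hU, Finset.mem_filter, Finset.mem_range]
    exact ⟨ht, htcop⟩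
  have hpt : ∀ r ∈ U, (∑ b3 : ZMod 3, ∑ b : ZMod p,
      (2 : ℚ) ^ (D6.cyc p (r : ZMod 3) 0 (r : ZMod p) 0 + D6.cyc p (r : ZMod 3) b3 (r : ZMod p) b)) =
      (if r = 1 then 2 ^ (6 * p) + 2 * 2 ^ (4 * p) + ((p : ℚ) - 1) * 12 * 2 ^ (3 * p) else 0)
      + (if r = t then 3 * 2 ^ (4 * p) + ((p : ℚ) - 1) * 12 * 2 ^ (2 * p) else 0)
      + p * 32 * (if r ≠ 1 ∧ orderOf (r : ZMod 3) = 1 ∧ ¬(3 ∣ orderOf (r : ZMod p)) then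
          ((2 : ℚ) ^ (4 * (p - 1) / orderOf (r : ZMod p))
            + (2 : ℚ) ^ (1 + 6 * (p - 1) / orderOf (r : ZMod p))) else 0)
      + p * 96 * (if r ≠ 1 ∧ orderOf (r : ZMod 3) = 1 ∧ 3 ∣ orderOf (r : ZMod p) then
          (2 : ℚ) ^ (6 * (p - 1) / orderOf (r : ZMod p)) else 0)
      + p * 48 * (if r ≠ 1 ∧ orderOf (r : ZMod 3) = 2 ∧ ¬(2 ∣ orderOf (r : ZMod p)) ∧
            1 < orderOf (r : ZMod p) then
          (2 : ℚ) ^ (4 * (p - 1) / orderOf (r : ZMod p)) else 0)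
      + p * 48 * (if r ≠ 1 ∧ orderOf (r : ZMod 3) = 2 ∧ 2 ∣ orderOf (r : ZMod p) then
          (2 : ℚ) ^ (6 * (p - 1) / orderOf (r : ZMod p)) else 0) := by
    intro r hr
    simp only [hU, Finset.mem_filter, Finset.mem_range] at hr
    have hr3 := cop3 r hr.2
    have hrp := copp r hr.2
    by_cases ha : (r : ZMod p) = 1
    · by_cases ha3 : (r : ZMod 3) = 1
      · have : r = 1 := uniq r hr.1 1 (by omega) (by simpa using ha3) (by simpa using ha)
        subst this
        simp only [Nat.cast_one, D6.inner11]
        simp [ht1.symm]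
      · have : r = t := uniq r hr.1 t ht (nz2 _ _ hr3 ha3 (cop3 t htcop) ht3') (by rw [ha, htp'])
        subst this
        rw [ha, D6.inner21 _ ha3, D6.ord3 hr3 ha3]
        simp [ht1]
    · have hr1 : r ≠ 1 := by rintro rfl; simp at ha
      have hrt : r ≠ t := by rintro rfl; exact ha htp'
      have hd0 : 0 < orderOf (r : ZMod p) := (isOfFinOrder_iff_pow_eq_one.2
        ⟨p - 1, by omega, ZMod.pow_card_sub_one_eq_one hrp⟩).orderOf_pos
      have hd1 : orderOf (r : ZMod p) ≠ 1 := by rwa [Ne, orderOf_eq_one_iff]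
      have hd2 : 1 < orderOf (r : ZMod p) := by omega
      have hdd : orderOf (r : ZMod p) ∣ p - 1 :=
        orderOf_dvd_of_pow_eq_one (ZMod.pow_card_sub_one_eq_one hrp)
      rw [Nat.mul_div_assoc _ hdd, Nat.mul_div_assoc _ hdd]
      by_cases ha3 : (r : ZMod 3) = 1
      · rw [ha3]
        by_cases h3 : 3 ∣ orderOf (r : ZMod p)
        · rw [D6.inner1d3 _ ha h3]
          simp [hr1, hrt, h3]
        · rw [D6.inner1d _ ha h3]
          simp [hr1, hrt, h3]
      · by_cases h2 : 2 ∣ orderOf (r : ZMod p)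
        · rw [D6.inner2d2 _ ha3 _ ha h2, D6.ord3 hr3 ha3]
          simp [hr1, hrt, h2]
        · rw [D6.inner2d _ ha3 _ ha h2, D6.ord3 hr3 ha3]
          simp only [hr1, hrt, h2, hd2]
          simp
          exact fun h => absurd h hr1
  rw [Finset.sum_congr rfl hpt] at totq
  simp only [Finset.sum_add_distrib, ← Finset.mul_sum] at totq
  rw [Finset.sum_ite_eq' U 1, if_pos h1U, Finset.sum_ite_eq' U t, if_pos htU] at totq
  have hp0 : (p : ℚ) ≠ 0 := by exact_mod_cast hp.ne_zero
  have hp1 : (p : ℚ) - 1 ≠ 0 := by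
    have : (1 : ℚ) < p := by exact_mod_cast hp.one_lt
    linarith
  have e4 : (2 : ℚ) ^ (4 * p - 2) = 2 ^ (4 * p) / 4 := by
    have : 4 * p = (4 * p - 2) + 2 := by omega
    rw [eq_div_iff (by norm_num)]
    conv_rhs => rw [this, pow_add]
    norm_num
  rw [e4]
  have e6 : (2 : ℚ) ^ (6 * p) = 2 ^ (4 * p) * 2 ^ (2 * p) := by rw [← pow_add]; congr 1; ring
  have e3 : (2 : ℚ) ^ (3 * p) = 2 ^ (2 * p) * 2 ^ p := by rw [← pow_add]; congr 1; ring
  rw [e6, e3] at totq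
  generalize (∑ r ∈ U, if r ≠ 1 ∧ orderOf (r : ZMod 3) = 1 ∧ ¬(3 ∣ orderOf (r : ZMod p)) then
          ((2 : ℚ) ^ (4 * (p - 1) / orderOf (r : ZMod p))
            + (2 : ℚ) ^ (1 + 6 * (p - 1) / orderOf (r : ZMod p))) else 0) = X1 at totq ⊢
  generalize (∑ r ∈ U, if r ≠ 1 ∧ orderOf (r : ZMod 3) = 1 ∧ 3 ∣ orderOf (r : ZMod p) then
          (2 : ℚ) ^ (6 * (p - 1) / orderOf (r : ZMod p)) else 0) = X2 at totq ⊢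
  generalize (∑ r ∈ U, if r ≠ 1 ∧ orderOf (r : ZMod 3) = 2 ∧ ¬(2 ∣ orderOf (r : ZMod p)) ∧
            1 < orderOf (r : ZMod p) then
          (2 : ℚ) ^ (4 * (p - 1) / orderOf (r : ZMod p)) else 0) = X3 at totq ⊢
  generalize (∑ r ∈ U, if r ≠ 1 ∧ orderOf (r : ZMod 3) = 2 ∧ 2 ∣ orderOf (r : ZMod p) then
          (2 : ℚ) ^ (6 * (p - 1) / orderOf (r : ZMod p)) else 0) = X4 at totq ⊢
  generalize (2 : ℚ) ^ (4 * p) = Y4 at totq ⊢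
  generalize (2 : ℚ) ^ (2 * p) = Y2 at totq ⊢
  generalize (2 : ℚ) ^ p = Y1 at totq ⊢
  have hQ : (Q : ℚ) = (2 * Q * (6 * p * ((p : ℚ) - 1))) / (12 * p * ((p : ℚ) - 1)) := by
    field_simp; ring
  rw [hQ, totq]
  field_simp
  ring
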